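/- Let N = p₁^m p₂^n, where m, n ≥ 1 and p₁, p₂ are primes with p₁ ≡ 1 (mod 4) and p₂ ≡ 3 (mod 4). Let p be a prime with ord_{p₁^m}(p) = φ(p₁^m), ord_{p₂^n}(p) = φ(p₂^n), and [Z_N^* : ⟨p⟩] = 2. Let f = φ(N)/2, q = p^f, and let χ be a complex multiplicative character of F_q of order N. Then there exist integers b and c with b, c ≢ 0 (mod p), 4p^h = b² + p₁p₂c², and b·p^{(f−h)/2} ≡ 2 (mod p₁p₂), where h is the class number of Q(√(−p₁p₂)), such that: for all 0 ≤ s ≤ m−1 and 0 ≤ t ≤ n−1, G(χ^{p₁^s p₂^t}) = p^{(f − h p₁^s p₂^t)/2} · ((b + c·i·√(p₁p₂))/2)^{p₁^s p₂^t}; for all 0 ≤ t ≤ n−1, G(χ^{p₁^m p₂^t}) = −p^{f/2}; and for all 0 ≤ s ≤ m−1, G(χ^{p₁^s p₂^n}) = p^{f/2}. -/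

import Mathlib

open scoped Classical

/-- The canonical additive character `ψ(x) = exp(2πi·Tr_{q/p}(x)/p)` of a finite field of
characteristic `p`. -/
noncomputable def psi (p : ℕ) {F : Type*} [Field F] [Fintype F] [Algebra (ZMod p) F]
    (x : F) : ℂ :=
  Complex.exp (2 * Real.pi * Complex.I * ((Algebra.trace (ZMod p) F x).val : ℂ) / p)

/-- The Gauss sum `G(χ) = Σ_{x ∈ F_q^*} χ(x) ψ(x)`. -/
noncomputable def gaussSumF (p : ℕ) {F : Type*} [Field F] [Fintype F] [Algebra (ZMod p) F]
    (χ : MulChar F ℂ) : ℂ :=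
  ∑ x : Fˣ, χ (x : F) * psi p (x : F)

/-! Part B1: structure of the imaginary quadratic field -/

section QuadField

open NumberField

/-- A rational number whose image in `ℂ` is integral over `ℤ` is an integer. -/
lemma exists_int_of_isIntegral_ratCast {x : ℚ} (hx : IsIntegral ℤ (x : ℂ)) : ∃ n : ℤ, (n : ℚ) = x := by
  have h1 : IsIntegral ℤ x := by
    have : IsIntegral ℤ (algebraMap ℚ ℂ x) := by simpa using hx
    exact (isIntegral_algebraMap_iff (algebraMap ℚ ℂ).injective).1 this
  obtain ⟨n, hn⟩ := IsIntegrallyClosed.isIntegral_iff.1 h1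
  exact ⟨n, by simpa using hn⟩

/-- A rational number `y` with `d * y ^ 2` an integer, `d` squarefree, is an integer. -/
lemma exists_int_of_squarefree_mul_sq {d : ℕ} (hd : Squarefree d) {y : ℚ} {n : ℤ}
    (h : (d : ℚ) * y ^ 2 = n) : ∃ m : ℤ, (m : ℚ) = y := by
  have h1 : (d : ℤ) * y.num ^ 2 = n * (y.den : ℤ) ^ 2 := by
    have hy : y = y.num / y.den := (Rat.num_div_den y).symm
    have hden : (y.den : ℚ) ≠ 0 := by exact_mod_cast y.den_ne_zero
    rw [hy] at h
    field_simp at h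
    rw [mul_comm n]
    exact_mod_cast h
  have hcop : IsCoprime ((y.den : ℤ) ^ 2) (y.num ^ 2) := by
    apply IsCoprime.pow
    have := y.reduced
    rw [Int.isCoprime_iff_gcd_eq_one]
    rw [Int.gcd_comm]
    simpa [Int.gcd, Nat.Coprime] using this
  have h2 : (y.den : ℤ) ^ 2 ∣ (d : ℤ) := by
    apply hcop.dvd_of_dvd_mul_right
    exact ⟨n, by rw [h1]; ring⟩
  have h3 : y.den * y.den ∣ d := by
    have : ((y.den * y.den : ℕ) : ℤ) ∣ (d : ℤ) := by push_cast; rw [← sq]; exact h2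
    exact_mod_cast this
  have h4 : y.den = 1 := Nat.isUnit_iff.1 (hd _ h3)
  exact ⟨y.num, Rat.coe_int_num_of_den_eq_one h4⟩

variable {K : Type*} [Field K] [NumberField K] {d : ℕ} {α : K}

lemma quad_exists_rat (hα : α ^ 2 = -(d : K)) (hKα : Algebra.adjoin ℚ {α} = ⊤) (x : K) :
    ∃ u v : ℚ, x = u + v * α := by
  have hx : x ∈ Algebra.adjoin ℚ {α} := by rw [hKα]; trivial
  induction hx using Algebra.adjoin_induction with
  | mem x hx => rw [Set.mem_singleton_iff] at hx; exact ⟨0, 1, by simp [hx]⟩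
  | algebraMap r => exact ⟨r, 0, by simp⟩
  | add x y _ _ hx hy =>
    obtain ⟨u, v, rfl⟩ := hx
    obtain ⟨u', v', rfl⟩ := hy
    exact ⟨u + u', v + v', by push_cast; ring⟩
  | mul x y _ _ hx hy =>
    obtain ⟨u, v, rfl⟩ := hx
    obtain ⟨u', v', rfl⟩ := hy
    refine ⟨u * u' - d * v * v', u * v' + u' * v, ?_⟩
    push_cast
    linear_combination (v * v' : K) * hα

lemma quad_embedding (hα : α ^ 2 = -(d : K)) (φ : K →+* ℂ) :
    starRingEnd ℂ (φ α) = - φ α := by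
  have h : (φ α) ^ 2 = -(d : ℂ) := by rw [← map_pow, hα]; simp
  have him : (φ α).re = 0 := by
    have h1 := congrArg Complex.re h
    have h2 := congrArg Complex.im h
    simp [sq] at h1 h2
    have h3 : (φ α).re * (φ α).im = 0 := by linarith
    rcases mul_eq_zero.1 h3 with h | h
    · exact h
    · rw [h] at h1
      have : (φ α).re * (φ α).re ≤ 0 := by
        have : (0 : ℝ) ≤ d := by positivity
        linarith
      nlinarith
  apply Complex.ext <;> simp [him]

/-- The ring of integers is `ℤ[(1+α)/2]`. -/
lemma quad_integer (hd : Squarefree d) (hd4 : d % 4 = 3) (hα : α ^ 2 = -(d : K))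
    (hKα : Algebra.adjoin ℚ {α} = ⊤) (x : K) (hx : IsIntegral ℤ x) :
    ∃ a b : ℤ, x = a + b * ((1 + α) / 2) := by
  obtain ⟨u, v, rfl⟩ := quad_exists_rat hα hKα x
  let φ : K →+* ℂ := Classical.arbitrary _
  have h1 : IsIntegral ℤ (φ (u + v * α)) := map_isIntegral_int φ hx
  have h2 : IsIntegral ℤ (starRingEnd ℂ (φ (u + v * α))) := map_isIntegral_int (starRingEnd ℂ) h1
  have e1 : φ (u + v * α) = u + v * φ α := by simp
  have e2 : starRingEnd ℂ (φ (u + v * α)) = u - v * φ α := by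
    rw [e1, map_add, map_mul, quad_embedding hα]; simp [sub_eq_add_neg]
  have hφ : (φ α) ^ 2 = -(d : ℂ) := by rw [← map_pow, hα]; simp
  obtain ⟨A, hA⟩ := exists_int_of_isIntegral_ratCast (x := 2 * u) (by
    have e : ((2 * u : ℚ) : ℂ) = φ (u + v * α) + starRingEnd ℂ (φ (u + v * α)) := by
      rw [e2, e1]; push_cast; ring
    rw [e]; exact h1.add h2)
  obtain ⟨B, hB⟩ := exists_int_of_isIntegral_ratCast (x := u ^ 2 + d * v ^ 2) (by
    have e : ((u ^ 2 + d * v ^ 2 : ℚ) : ℂ) = φ (u + v * α) * starRingEnd ℂ (φ (u + v * α)) := by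
      rw [e2, e1]; push_cast; linear_combination ((v : ℂ) ^ 2) * hφ
    rw [e]; exact h1.mul h2)
  obtain ⟨V, hV⟩ := exists_int_of_squarefree_mul_sq hd (y := 2 * v) (n := 4 * B - A ^ 2) (by
    push_cast; rw [hA, hB]; ring)
  have h3 : A ^ 2 + d * V ^ 2 = 4 * B := by
    have : ((A ^ 2 + d * V ^ 2 : ℤ) : ℚ) = (4 * B : ℤ) := by
      push_cast; rw [hA, hB, hV]; ring
    exact_mod_cast this
  have h4 : (A - V) % 2 = 0 := by
    obtain ⟨k, hk⟩ : ∃ k : ℤ, (d : ℤ) = 4 * k + 3 := ⟨d / 4, by omega⟩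
    have h5 : A ^ 2 + 3 * V ^ 2 = 4 * (B - k * V ^ 2) := by rw [hk] at h3; linarith
    rcases Int.even_or_odd' A with ⟨a, rfl | rfl⟩ <;> rcases Int.even_or_odd' V with ⟨w, rfl | rfl⟩
    · omega
    · ring_nf at h5; omega
    · ring_nf at h5; omega
    · omega
  obtain ⟨a, ha⟩ : ∃ a, A - V = 2 * a := ⟨(A - V) / 2, by omega⟩
  refine ⟨a, V, ?_⟩
  have hA' : (A : K) = 2 * u := by exact_mod_cast congrArg (Rat.cast : ℚ → K) hA
  have hV' : (V : K) = 2 * v := by exact_mod_cast congrArg (Rat.cast : ℚ → K) hV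
  have ha' : (A : K) - V = 2 * a := by exact_mod_cast congrArg (Int.cast : ℤ → K) ha
  have h20 : (2 : K) ≠ 0 := two_ne_zero
  field_simp
  linear_combination ha' - hA' - α * hV'

lemma quad_theta_isIntegral (hd4 : d % 4 = 3) (hα : α ^ 2 = -(d : K)) :
    ((1 + α) / 2) * ((1 + α) / 2) = ((-((d + 1) / 4 : ℕ) : ℤ) : K) + (1 + α) / 2 ∧
    IsIntegral ℤ ((1 + α) / 2 : K) := by
  obtain ⟨k, hk⟩ : ∃ k : ℕ, d + 1 = 4 * k := ⟨(d + 1) / 4, by omega⟩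
  have hk' : (d + 1) / 4 = k := by omega
  have hk'' : (d : K) + 1 = 4 * k := by exact_mod_cast congrArg (Nat.cast : ℕ → K) hk
  have h20 : (2 : K) ≠ 0 := two_ne_zero
  have e : ((1 + α) / 2) * ((1 + α) / 2) = ((-((d + 1) / 4 : ℕ) : ℤ) : K) + (1 + α) / 2 := by
    rw [hk']
    push_cast
    field_simp
    linear_combination hα - hk''
  refine ⟨e, ?_⟩
  refine ⟨Polynomial.X ^ 2 - Polynomial.X + Polynomial.C (k : ℤ), ?_, ?_⟩
  · monicity!
  · simp only [Polynomial.eval₂_add, Polynomial.eval₂_sub, Polynomial.eval₂_pow, Polynomial.eval₂_X,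
      Polynomial.eval₂_C]
    rw [sq, e, hk']
    simp

/-- The isomorphism of `ℤ[(1+√-d)/2]` with the ring of integers. -/
lemma quad_equiv (hd : Squarefree d) (hd4 : d % 4 = 3) (hα : α ^ 2 = -(d : K))
    (hKα : Algebra.adjoin ℚ {α} = ⊤) :
    ∃ e : QuadraticAlgebra ℤ (-((d + 1) / 4 : ℕ) : ℤ) 1 ≃ₐ[ℤ] 𝓞 K,
      ∀ z, ((e z : 𝓞 K) : K) = z.re + z.im * ((1 + α) / 2) := by
  obtain ⟨h1, h2⟩ := quad_theta_isIntegral hd4 hα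
  let θ : 𝓞 K := ⟨(1 + α) / 2, h2⟩
  have hθ : θ * θ = (-((d + 1) / 4 : ℕ) : ℤ) • (1 : 𝓞 K) + (1 : ℤ) • θ := by
    apply RingOfIntegers.ext
    simp only [map_mul, map_add, zsmul_eq_mul, mul_one, map_intCast, Int.cast_one, one_mul]
    exact h1
  let φ := QuadraticAlgebra.lift (R := ℤ) (A := 𝓞 K) ⟨θ, hθ⟩
  have hφ : ∀ z, ((φ z : 𝓞 K) : K) = z.re + z.im * ((1 + α) / 2) := by
    intro z
    simp only [φ, QuadraticAlgebra.lift_apply_apply]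
    simp only [map_mul, map_add, zsmul_eq_mul, mul_one, map_intCast]
    rfl
  have hinj : Function.Injective φ := by
    rw [injective_iff_map_eq_zero]
    intro z hz
    have h3 := hφ z
    rw [hz] at h3
    simp only [map_zero] at h3
    have h5 : (2 : K) * z.re + z.im = - (z.im : K) * α := by
      field_simp at h3; linear_combination -h3
    have h6 : ((2 : K) * z.re + z.im) ^ 2 = -(d * (z.im : K) ^ 2) := by
      rw [h5]; linear_combination (z.im : K) ^ 2 * hα
    have h7 : (2 * z.re + z.im) ^ 2 + (d : ℤ) * z.im ^ 2 = 0 := by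
      have : ((2 * z.re + z.im) ^ 2 + (d : ℤ) * z.im ^ 2 : K) = 0 := by
        rw [h6]; push_cast; ring
      exact_mod_cast this
    have hd0 : (0 : ℤ) < d := by omega
    have h8 : z.im = 0 := by
      by_contra h
      have : 0 < z.im ^ 2 := by positivity
      nlinarith [sq_nonneg (2 * z.re + z.im), mul_pos hd0 this]
    have h9 : z.re = 0 := by
      rw [h8] at h7
      simp at h7
      exact h7
    ext
    · exact h9
    · exact h8
  have hsurj : Function.Surjective φ := by
    intro x
    obtain ⟨a, b, hab⟩ := quad_integer hd hd4 hα hKα (x : K) x.isIntegral_coe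
    refine ⟨⟨a, b⟩, RingOfIntegers.ext ?_⟩
    rw [hφ]
    exact hab.symm
  exact ⟨AlgEquiv.ofBijective φ ⟨hinj, hsurj⟩, hφ⟩

end QuadField

section QuadField2

open NumberField

variable {K : Type*} [Field K] [NumberField K] {d : ℕ} {α : K}

lemma quad_basis_zero (a : ℤ) : QuadraticAlgebra.basis a 1 0 = 1 := by
  apply (QuadraticAlgebra.basis a 1).repr.injective
  ext i
  fin_cases i <;> simp [QuadraticAlgebra.basis_repr_apply, QuadraticAlgebra.re_one, QuadraticAlgebra.im_one]

lemma quad_basis_one (a : ℤ) : QuadraticAlgebra.basis a 1 1 = QuadraticAlgebra.omega := by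
  apply (QuadraticAlgebra.basis a 1).repr.injective
  ext i
  fin_cases i <;> simp [QuadraticAlgebra.basis_repr_apply, QuadraticAlgebra.re_one, QuadraticAlgebra.im_one]

lemma quad_trace (a : ℤ) (z : QuadraticAlgebra ℤ a 1) :
    Algebra.trace ℤ (QuadraticAlgebra ℤ a 1) z = 2 * z.re + z.im := by
  rw [Algebra.trace_eq_matrix_trace (QuadraticAlgebra.basis a 1)]
  simp [Matrix.trace, Fin.sum_univ_two, Algebra.leftMulMatrix_eq_repr_mul, 
    QuadraticAlgebra.basis_repr_apply, quad_basis_zero, quad_basis_one, QuadraticAlgebra.re_one, QuadraticAlgebra.im_one]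
  ring

lemma quad_discr (hd : Squarefree d) (hd4 : d % 4 = 3) (hα : α ^ 2 = -(d : K))
    (hKα : Algebra.adjoin ℚ {α} = ⊤) : discr K = -d := by
  obtain ⟨e, -⟩ := quad_equiv hd hd4 hα hKα
  obtain ⟨k, hk⟩ : ∃ k : ℕ, d + 1 = 4 * k := ⟨(d + 1) / 4, by omega⟩
  have hk' : (d + 1) / 4 = k := by omega
  rw [hk'] at e
  rw [← NumberField.discr_eq_discr K ((QuadraticAlgebra.basis _ _).map e.toLinearEquiv)]
  have h2 := Algebra.discr_eq_discr_of_algEquiv (QuadraticAlgebra.basis (-(k : ℕ) : ℤ) 1) e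
  have h3 : (⇑((QuadraticAlgebra.basis (-(k : ℕ) : ℤ) 1).map e.toLinearEquiv)) = 
     (⇑e ∘ ⇑(QuadraticAlgebra.basis (-(k : ℕ) : ℤ) 1)) := by ext; simp
  rw [h3, ← h2, Algebra.discr_def, Matrix.det_fin_two]
  simp only [Algebra.traceMatrix_apply, Algebra.traceForm_apply, quad_trace, quad_basis_zero, quad_basis_one, QuadraticAlgebra.re_one, QuadraticAlgebra.im_one]
  simp [QuadraticAlgebra.re_one, QuadraticAlgebra.im_one]
  omega

lemma quad_complex (hd : 0 < d) (hα : α ^ 2 = -(d : K)) : IsTotallyComplex K := by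
  constructor
  intro v
  rw [← InfinitePlace.not_isReal_iff_isComplex]
  intro hv
  have h1 := InfinitePlace.isReal_iff.1 hv
  have h2 := quad_embedding hα v.embedding
  have h3 : starRingEnd ℂ (v.embedding α) = v.embedding α := RingHom.congr_fun h1 α
  have h4 : v.embedding α = 0 := by
    rw [h3] at h2
    exact self_eq_neg.1 h2
  have h5 : α = 0 := by simpa using h4
  rw [h5] at hα
  have : (d : K) = 0 := by simpa using hα.symm
  have : d = 0 := by exact_mod_cast this
  omega

lemma quad_finrank (hd : Squarefree d) (hd4 : d % 4 = 3) (hα : α ^ 2 = -(d : K))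
    (hKα : Algebra.adjoin ℚ {α} = ⊤) : Module.finrank ℚ K = 2 := by
  obtain ⟨e, -⟩ := quad_equiv hd hd4 hα hKα
  rw [← RingOfIntegers.rank K, ← e.toLinearEquiv.finrank_eq,
    Module.finrank_eq_card_basis (QuadraticAlgebra.basis _ _)]
  simp

lemma quad_torsionOrder (hd : Squarefree d) (hd4 : d % 4 = 3) (hd5 : 5 ≤ d) (hα : α ^ 2 = -(d : K))
    (hKα : Algebra.adjoin ℚ {α} = ⊤) : Units.torsionOrder K = 2 := by
  obtain ⟨e, -⟩ := quad_equiv hd hd4 hα hKα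
  obtain ⟨k, hk⟩ : ∃ k : ℕ, d + 1 = 4 * k := ⟨(d + 1) / 4, by omega⟩
  have hk' : (d + 1) / 4 = k := by omega
  rw [hk'] at e
  have hu : ∀ u : (𝓞 K)ˣ, u = 1 ∨ u = -1 := by
    intro u
    have h1 : IsUnit (e.symm u) := u.isUnit.map e.symm
    rw [QuadraticAlgebra.isUnit_iff_norm_isUnit, QuadraticAlgebra.norm_def, Int.isUnit_iff] at h1
    set z := e.symm (u : 𝓞 K) with hz
    have hk2 : (d : ℤ) + 1 = 4 * k := by exact_mod_cast hk
    have h2 : (2 * z.re + z.im) ^ 2 + (d : ℤ) * z.im ^ 2 = 4 := by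
      have h0 : (2 * z.re + z.im) ^ 2 + (d : ℤ) * z.im ^ 2 = 4 *
        (z.re * z.re + 1 * z.re * z.im - -(k : ℤ) * z.im * z.im) := by
        linear_combination z.im ^ 2 * hk2
      rcases h1 with h1 | h1
      · rw [h0, h1]; norm_num
      · rw [h1] at h0
        nlinarith [sq_nonneg (2 * z.re + z.im), sq_nonneg z.im]
    have h3 : z.im = 0 := by
      by_contra h
      have : 0 < z.im ^ 2 := by positivity
      have hd5' : (5 : ℤ) ≤ d := by exact_mod_cast hd5
      nlinarith [sq_nonneg (2 * z.re + z.im)]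
    rw [h3] at h2
    have h4 : (z.re - 1) * (z.re + 1) = 0 := by linarith
    have h6 : (u : 𝓞 K) = e z := by simp [hz]
    rcases mul_eq_zero.1 h4 with h5 | h5
    · left
      have : z = 1 := by ext <;> simp [QuadraticAlgebra.re_one, QuadraticAlgebra.im_one, h3]; omega
      apply Units.ext
      rw [h6, this]; simp
    · right
      have : z = -1 := by ext <;> simp [QuadraticAlgebra.re_one, QuadraticAlgebra.im_one, h3]; omega
      apply Units.ext
      rw [h6, this]; simp
  have h1 : Units.torsionOrder K ≤ 2 := by
    rw [Units.torsionOrder]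
    let g : Units.torsion K → Bool := fun u => decide ((u : (𝓞 K)ˣ) = 1)
    have hg : Function.Injective g := by
      intro u v huv
      simp only [g, decide_eq_decide] at huv
      apply Subtype.ext
      rcases hu u with h | h
      · rw [h, huv.1 h]
      · rcases hu v with h' | h'
        · rw [h', huv.2 h']
        · rw [h, h']
    simpa using Nat.card_le_card_of_injective g hg
  have h2 := Units.even_torsionOrder K
  have h3 := Units.torsionOrder_pos K
  obtain ⟨r, hr⟩ := h2
  omega

lemma quad_residue (hd : Squarefree d) (hd4 : d % 4 = 3) (hd5 : 5 ≤ d) (hα : α ^ 2 = -(d : K))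
    (hKα : Algebra.adjoin ℚ {α} = ⊤) :
    dedekindZeta_residue K = Real.pi * classNumber K / √d := by
  have := quad_complex (by omega) hα
  have h1 := IsTotallyComplex.nrRealPlaces_eq_zero K
  have h2 : InfinitePlace.nrComplexPlaces K = 1 := by
    have := InfinitePlace.card_add_two_mul_card_eq_rank K
    rw [h1, quad_finrank hd hd4 hα hKα] at this
    omega
  have hcard : Fintype.card (InfinitePlace K) = 1 := by
    rw [InfinitePlace.card_eq_nrRealPlaces_add_nrComplexPlaces, h1, h2]
  have h3 : Units.rank K = 0 := by
    rw [Units.rank, hcard]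
  have h4 : Units.regulator K = 1 := by
    rw [Units.regulator_eq_det']
    have : IsEmpty {w : InfinitePlace K // w ≠ Units.dirichletUnitTheorem.w₀} := by
      have : Subsingleton (InfinitePlace K) := Fintype.card_le_one_iff_subsingleton.1 hcard.le
      exact ⟨fun w => w.2 (Subsingleton.elim _ _)⟩
    rw [Matrix.det_isEmpty]; simp
  rw [dedekindZeta_residue_def, h1, h2, h4, quad_discr hd hd4 hα hKα,
    quad_torsionOrder hd hd4 hd5 hα hKα]
  simp
  field_simp

end QuadField2

section IdealCount

variable {S : Type*} [CommRing S] [IsDedekindDomain S] [Module.Free ℤ S] [Module.Finite ℤ S]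
  [CharZero S]

lemma ideal_eq_of_le_of_absNorm_eq {I J : Ideal S} (h : I ≤ J)
    (hn : Ideal.absNorm I = Ideal.absNorm J) (h0 : Ideal.absNorm J ≠ 0) : I = J := by
  obtain ⟨A, rfl⟩ := Ideal.dvd_iff_le.2 h
  rw [map_mul] at hn
  have : Ideal.absNorm A = 1 := by
    have h1 : Ideal.absNorm J * Ideal.absNorm A = Ideal.absNorm J * 1 := by rw [hn, mul_one]
    exact Nat.eq_of_mul_eq_mul_left (Nat.pos_of_ne_zero h0) h1
  rw [Ideal.absNorm_eq_one_iff.1 this, Ideal.mul_top]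

lemma natCast_mem_of_absNorm {I : Ideal S} {n : ℕ} (h : Ideal.absNorm I = n) : (n : S) ∈ I := by
  rw [← h]; exact Ideal.absNorm_mem I

lemma sup_eq_top_of_natCast_coprime {I J : Ideal S} {m n : ℕ} (hmn : Nat.Coprime m n)
    (hm : (m : S) ∈ I) (hn : (n : S) ∈ J) : I ⊔ J = ⊤ := by
  have h : IsCoprime (m : ℤ) (n : ℤ) := Nat.isCoprime_iff_coprime.2 hmn
  obtain ⟨a, b, hab⟩ := h
  rw [Ideal.eq_top_iff_one]
  have : (1 : S) = (a : S) * m + (b : S) * n := by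
    have := congrArg (Int.cast : ℤ → S) hab
    push_cast at this
    exact this.symm
  rw [this]
  exact Submodule.add_mem_sup (I.mul_mem_left _ hm) (J.mul_mem_left _ hn)

variable (S) in
/-- Number of ideals of given norm. -/
noncomputable def idealCount (n : ℕ) : ℕ := Nat.card {I : Ideal S // Ideal.absNorm I = n}

lemma idealCount_mul {m n : ℕ} (hmn : Nat.Coprime m n) (hm0 : m ≠ 0) (hn0 : n ≠ 0) :
    idealCount S (m * n) = idealCount S m * idealCount S n := by
  rw [idealCount, idealCount, idealCount, ← Nat.card_prod]
  symm
  let F : {I : Ideal S // Ideal.absNorm I = m} × {I : Ideal S // Ideal.absNorm I = n} →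
      {I : Ideal S // Ideal.absNorm I = m * n} := fun x => ⟨x.1.1 * x.2.1, by
    rw [map_mul, x.1.2, x.2.2]⟩
  have key1 : ∀ (a b : ℕ) (_ : Nat.Coprime a b) (A B : Ideal S) (_ : Ideal.absNorm A = a)
      (_ : Ideal.absNorm B = b), A * B ⊔ Ideal.span {(a : S)} = A := by
    intro a b hab A B hA hB
    rw [Ideal.mul_sup_eq_of_coprime_right]
    · rw [sup_eq_left, Ideal.span_singleton_le_iff_mem]
      exact natCast_mem_of_absNorm hA
    · exact sup_eq_top_of_natCast_coprime hab.symm (natCast_mem_of_absNorm hB)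
        (Ideal.mem_span_singleton_self _)
  apply Nat.card_eq_of_bijective F
  constructor
  · rintro ⟨⟨A, hA⟩, ⟨B, hB⟩⟩ ⟨⟨A', hA'⟩, ⟨B', hB'⟩⟩ h
    have h1 : A * B = A' * B' := congrArg Subtype.val h
    have e1 : A = A' := by
      rw [← key1 m n hmn A B hA hB, h1, key1 m n hmn A' B' hA' hB']
    have e2 : B = B' := by
      rw [← key1 n m hmn.symm B A hB hA, mul_comm B, h1, mul_comm A',
        key1 n m hmn.symm B' A' hB' hA']
    subst e1; subst e2; rfl
  · rintro ⟨I, hI⟩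
    set A := I ⊔ Ideal.span {(m : S)} with hA
    set B := I ⊔ Ideal.span {(n : S)} with hB
    have hmA : (m : S) ∈ A := Ideal.mem_sup_right (Ideal.mem_span_singleton_self _)
    have hnB : (n : S) ∈ B := Ideal.mem_sup_right (Ideal.mem_span_singleton_self _)
    have hmnI : (m : S) * n ∈ I := by
      have := natCast_mem_of_absNorm hI
      rwa [Nat.cast_mul] at this
    have h1 : A * B = I := by
      apply le_antisymm
      · rw [hA, hB, Ideal.sup_mul, Ideal.mul_sup, Ideal.mul_sup]
        refine sup_le (sup_le Ideal.mul_le_left Ideal.mul_le_left) (sup_le Ideal.mul_le_right ?_)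
        rw [Ideal.span_singleton_mul_span_singleton, Ideal.span_singleton_le_iff_mem]
        exact hmnI
      · rw [Ideal.mul_eq_inf_of_coprime (sup_eq_top_of_natCast_coprime hmn hmA hnB)]
        exact le_inf le_sup_left le_sup_left
    have h2 : Ideal.absNorm A * Ideal.absNorm B = m * n := by rw [← map_mul, h1, hI]
    have h3 : Ideal.absNorm A ∣ m ^ Module.finrank ℤ S := by
      rw [← Ideal.absNorm_span_natCast]
      exact Ideal.absNorm_dvd_absNorm_of_le le_sup_right
    have h4 : Ideal.absNorm B ∣ n ^ Module.finrank ℤ S := by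
      rw [← Ideal.absNorm_span_natCast]
      exact Ideal.absNorm_dvd_absNorm_of_le le_sup_right
    have h5 : Ideal.absNorm A ∣ m := by
      have : Nat.Coprime (Ideal.absNorm A) n := Nat.Coprime.coprime_dvd_left h3 (hmn.pow_left _)
      exact this.dvd_of_dvd_mul_right (Dvd.intro _ h2)
    have h6 : Ideal.absNorm B ∣ n := by
      have : Nat.Coprime (Ideal.absNorm B) m :=
        Nat.Coprime.coprime_dvd_left h4 (hmn.symm.pow_left _)
      exact this.dvd_of_dvd_mul_left (Dvd.intro_left _ h2)
    have h7 : Ideal.absNorm A = m := by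
      obtain ⟨u, hu⟩ := h5
      obtain ⟨v, hv⟩ := h6
      have hA0 : 0 < Ideal.absNorm A := by
        rcases Nat.eq_zero_or_pos (Ideal.absNorm A) with h | h
        · rw [h, zero_mul] at hu; exact absurd hu hm0
        · exact h
      have hB0 : 0 < Ideal.absNorm B := by
        rcases Nat.eq_zero_or_pos (Ideal.absNorm B) with h | h
        · rw [h, zero_mul] at hv; exact absurd hv hn0
        · exact h
      have h8 : u * v = 1 := by
        have : (Ideal.absNorm A * Ideal.absNorm B) * (u * v) = (Ideal.absNorm A * Ideal.absNorm B) * 1 := by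
          rw [mul_one, h2]; nth_rewrite 2 [hu]; nth_rewrite 2 [hv]
          rw [← h2]; ring
        exact Nat.eq_of_mul_eq_mul_left (Nat.mul_pos hA0 hB0) this
      rw [Nat.eq_one_of_mul_eq_one_right h8, mul_one] at hu
      exact hu.symm
    have h8 : Ideal.absNorm B = n := by
      rw [h7] at h2
      exact Nat.eq_of_mul_eq_mul_left (Nat.pos_of_ne_zero hm0) h2
    exact ⟨(⟨A, h7⟩, ⟨B, h8⟩), Subtype.ext h1⟩

lemma idealCount_one : idealCount S 1 = 1 := by
  rw [idealCount, Nat.card_eq_one_iff_exists]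
  refine ⟨⟨⊤, Ideal.absNorm_top⟩, ?_⟩
  rintro ⟨I, hI⟩
  exact Subtype.ext (Ideal.absNorm_eq_one_iff.1 hI)

lemma dvd_span_pow_of_absNorm {I : Ideal S} {l k : ℕ} (h : Ideal.absNorm I = l ^ k) :
    I ∣ (Ideal.span {(l : S)}) ^ k := by
  rw [Ideal.dvd_iff_le, Ideal.span_singleton_pow, Ideal.span_singleton_le_iff_mem]
  have := natCast_mem_of_absNorm h
  rwa [Nat.cast_pow] at this

lemma idealCount_inert {l : ℕ} (hl : l.Prime) (hfin : Module.finrank ℤ S = 2)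
    (h : (Ideal.span {(l : S)}).IsPrime) (k : ℕ) :
    idealCount S (l ^ k) = if Even k then 1 else 0 := by
  have hN : Ideal.absNorm (Ideal.span {(l : S)}) = l ^ 2 := by rw [Ideal.absNorm_span_natCast, hfin]
  have h0 : Ideal.span {(l : S)} ≠ ⊥ := by
    intro h'
    rw [h', Ideal.absNorm_bot] at hN
    exact (pow_ne_zero 2 hl.ne_zero) hN.symm
  have hP : Prime (Ideal.span {(l : S)}) := Ideal.prime_of_isPrime h0 h
  have key : ∀ I : Ideal S, Ideal.absNorm I = l ^ k →
      ∃ j, I = (Ideal.span {(l : S)}) ^ j ∧ k = 2 * j := by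
    intro I hI
    obtain ⟨j, -, hj⟩ := (dvd_prime_pow hP k).1 (dvd_span_pow_of_absNorm hI)
    rw [associated_iff_eq] at hj
    refine ⟨j, hj, ?_⟩
    rw [hj, map_pow, hN, ← pow_mul] at hI
    exact (Nat.pow_right_injective hl.two_le hI).symm
  split_ifs with hk
  · obtain ⟨j, hj⟩ := hk
    rw [idealCount, Nat.card_eq_one_iff_exists]
    refine ⟨⟨(Ideal.span {(l : S)}) ^ j, by rw [map_pow, hN, ← pow_mul]; congr 1; omega⟩, ?_⟩
    rintro ⟨I, hI⟩
    obtain ⟨j', h1, h2⟩ := key I hI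
    apply Subtype.ext
    simp only
    rw [h1]
    congr 1
    omega
  · rw [idealCount, Nat.card_eq_zero]
    left
    refine ⟨?_⟩
    rintro ⟨I, hI⟩
    obtain ⟨j', h1, h2⟩ := key I hI
    exact hk ⟨j', by omega⟩

lemma idealCount_ram {l : ℕ} (hl : l.Prime) {P : Ideal S} (hN : Ideal.absNorm P = l)
    (h : Ideal.span {(l : S)} = P * P) (k : ℕ) : idealCount S (l ^ k) = 1 := by
  have hP' : P.IsPrime := Ideal.isPrime_of_irreducible_absNorm (by rw [hN]; exact hl)
  have h0 : P ≠ ⊥ := by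
    intro h'
    rw [h', Ideal.absNorm_bot] at hN
    exact hl.ne_zero hN.symm
  have hP : Prime P := Ideal.prime_of_isPrime h0 hP'
  rw [idealCount, Nat.card_eq_one_iff_exists]
  refine ⟨⟨P ^ k, by rw [map_pow, hN]⟩, ?_⟩
  rintro ⟨I, hI⟩
  have h1 := dvd_span_pow_of_absNorm hI
  rw [h, ← sq, ← pow_mul] at h1
  obtain ⟨j, -, hj⟩ := (dvd_prime_pow hP _).1 h1
  rw [associated_iff_eq] at hj
  apply Subtype.ext
  rw [hj, map_pow, hN] at hI
  simp only
  rw [hj, Nat.pow_right_injective hl.two_le hI]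

lemma idealCount_split {l : ℕ} (hl : l.Prime) {P Q : Ideal S} (hP : Ideal.absNorm P = l)
    (hQ : Ideal.absNorm Q = l) (hPQ : P ⊔ Q = ⊤)
    (h : Ideal.span {(l : S)} = P * Q) (k : ℕ) : idealCount S (l ^ k) = k + 1 := by
  have hprime : ∀ P : Ideal S, Ideal.absNorm P = l → Prime P := by
    intro P hN
    have hP' : P.IsPrime := Ideal.isPrime_of_irreducible_absNorm (by rw [hN]; exact hl)
    refine Ideal.prime_of_isPrime ?_ hP'
    intro h'
    rw [h', Ideal.absNorm_bot] at hN
    exact hl.ne_zero hN.symm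
  let F : Fin (k + 1) → {I : Ideal S // Ideal.absNorm I = l ^ k} := fun i =>
    ⟨P ^ (i : ℕ) * Q ^ (k - (i : ℕ)), by
      rw [map_mul, map_pow, map_pow, hP, hQ, ← pow_add]; congr 1; omega⟩
  have hF : Function.Bijective F := by
    constructor
    · have key : ∀ i j : Fin (k + 1), F i = F j → (j : ℕ) ≤ i := by
        intro i j hij
        have h1 : P ^ (i : ℕ) * Q ^ (k - (i : ℕ)) = P ^ (j : ℕ) * Q ^ (k - (j : ℕ)) :=
          congrArg Subtype.val hij
        have h2 : P ^ (j : ℕ) ∣ P ^ (i : ℕ) * Q ^ (k - (i : ℕ)) := by rw [h1]; exact dvd_mul_right _ _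
        have h3 : IsCoprime (P ^ (j : ℕ)) (Q ^ (k - (i : ℕ))) := by
          apply IsCoprime.pow
          rw [Ideal.isCoprime_iff_sup_eq]; exact hPQ
        have h4 := h3.dvd_of_dvd_mul_right h2
        have h5 := Ideal.absNorm_dvd_absNorm_of_le (Ideal.dvd_iff_le.1 h4)
        rw [map_pow, map_pow, hP] at h5
        exact (Nat.pow_dvd_pow_iff_le_right hl.one_lt).1 h5
      intro i j hij
      apply Fin.ext
      exact le_antisymm (key j i hij.symm) (key i j hij)
    · rintro ⟨I, hI⟩
      have h1 := dvd_span_pow_of_absNorm hI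
      rw [h, mul_pow] at h1
      obtain ⟨A, B, hA, hB, hAB⟩ := exists_dvd_and_dvd_of_dvd_mul h1
      obtain ⟨i, -, hi⟩ := (dvd_prime_pow (hprime P hP) _).1 hA
      obtain ⟨j, -, hj⟩ := (dvd_prime_pow (hprime Q hQ) _).1 hB
      rw [associated_iff_eq] at hi hj
      rw [hAB, hi, hj, map_mul, map_pow, map_pow, hP, hQ, ← pow_add] at hI
      have hij := Nat.pow_right_injective hl.two_le hI
      refine ⟨⟨i, by omega⟩, Subtype.ext ?_⟩
      simp only [F]
      rw [hAB, hi, hj]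
      congr 2
      omega
  rw [idealCount, ← Nat.card_eq_of_bijective F hF, Nat.card_fin]

end IdealCount

section Decomp

open NumberField

lemma absNorm_ker_zmod {S : Type*} [CommRing S] [IsDedekindDomain S] [Module.Free ℤ S]
    {l : ℕ} [Fact l.Prime] (φ : S →+* ZMod l) : Ideal.absNorm (RingHom.ker φ) = l := by
  have h := RingHom.quotientKerEquivOfSurjective (ZMod.ringHom_surjective φ)
  rw [Ideal.absNorm_apply, Submodule.cardQuot_apply, Nat.card_congr h.toEquiv, Nat.card_zmod]

lemma exists_ker_zmod_of_absNorm {S : Type*} [CommRing S] [IsDedekindDomain S] [Module.Free ℤ S]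
    {l : ℕ} [Fact l.Prime] {P : Ideal S} (hP : Ideal.absNorm P = l) :
    ∃ φ : S →+* ZMod l, RingHom.ker φ = P := by
  have hl : l.Prime := Fact.out
  rw [Ideal.absNorm_apply, Submodule.cardQuot_apply] at hP
  have : Finite (S ⧸ P) := Nat.finite_of_card_ne_zero (by rw [hP]; exact hl.ne_zero)
  have : Fintype (S ⧸ P) := Fintype.ofFinite _
  have e := ZMod.ringEquivOfPrime (S ⧸ P) hl (by rw [← hP, Nat.card_eq_fintype_card])
  refine ⟨e.symm.toRingHom.comp (Ideal.Quotient.mk P), ?_⟩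
  ext x
  rw [RingHom.mem_ker]
  simp [Ideal.Quotient.eq_zero_iff_mem]

variable {K : Type*} [Field K] [NumberField K] {d : ℕ} {α : K}

/-- Ring homs to `ZMod l` correspond to roots. -/
lemma quad_homs (hd : Squarefree d) (hd4 : d % 4 = 3) (hα : α ^ 2 = -(d : K))
    (hKα : Algebra.adjoin ℚ {α} = ⊤) (l : ℕ) :
    ∃ θ : 𝓞 K, (∀ φ : 𝓞 K →+* ZMod l, φ θ * φ θ = -((d + 1) / 4 : ℕ) + φ θ) ∧
      (∀ φ ψ : 𝓞 K →+* ZMod l, φ θ = ψ θ → φ = ψ) ∧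
      (∀ r : ZMod l, r * r = -((d + 1) / 4 : ℕ) + r → ∃ φ : 𝓞 K →+* ZMod l, φ θ = r) := by
  obtain ⟨e, -⟩ := quad_equiv hd hd4 hα hKα
  generalize (d + 1) / 4 = k at e ⊢
  refine ⟨e QuadraticAlgebra.omega, ?_, ?_, ?_⟩
  · intro φ
    rw [← map_mul, ← map_mul, QuadraticAlgebra.omega_mul_omega_eq_add]
    simp
  · intro φ ψ h
    have h1 : (φ.toIntAlgHom.comp e.toAlgHom) = (ψ.toIntAlgHom.comp e.toAlgHom) := by
      apply QuadraticAlgebra.algHom_ext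
      simpa using h
    ext x
    have := DFunLike.congr_fun h1 (e.symm x)
    simpa using this
  · intro r hr
    refine ⟨((QuadraticAlgebra.lift (R := ℤ) (A := ZMod l) ⟨r, by simpa using hr⟩).comp
      e.symm.toAlgHom).toRingHom, ?_⟩
    simp

lemma quad_inert (hd : Squarefree d) (hd4 : d % 4 = 3) (hα : α ^ 2 = -(d : K))
    (hKα : Algebra.adjoin ℚ {α} = ⊤) {l : ℕ} [Fact l.Prime]
    (hr : ¬ ∃ r : ZMod l, r * r = -((d + 1) / 4 : ℕ) + r) :
    (Ideal.span {(l : 𝓞 K)}).IsPrime := by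
  have hl : l.Prime := Fact.out
  have hfin : Module.finrank ℤ (𝓞 K) = 2 := by
    rw [RingOfIntegers.rank K, quad_finrank hd hd4 hα hKα]
  obtain ⟨θ, h1, h2, h3⟩ := quad_homs hd hd4 hα hKα l
  have hN : Ideal.absNorm (Ideal.span {(l : 𝓞 K)}) = l ^ 2 := by
    rw [Ideal.absNorm_span_natCast, hfin]
  have hne : Ideal.span {(l : 𝓞 K)} ≠ ⊤ := by
    intro h
    rw [h, Ideal.absNorm_top] at hN
    exact absurd hN.symm (Nat.one_lt_pow two_ne_zero hl.one_lt).ne'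
  obtain ⟨P, hP, hle⟩ := Ideal.exists_le_maximal _ hne
  have h4 : Ideal.absNorm P ∣ l ^ 2 := by
    rw [← hN]; exact Ideal.absNorm_dvd_absNorm_of_le hle
  obtain ⟨i, hi, hPi⟩ := (Nat.dvd_prime_pow hl).1 h4
  have : i = 0 ∨ i = 1 ∨ i = 2 := by omega
  rcases this with rfl | rfl | rfl
  · rw [pow_zero, Ideal.absNorm_eq_one_iff] at hPi
    exact absurd hPi hP.ne_top
  · rw [pow_one] at hPi
    obtain ⟨φ, -⟩ := exists_ker_zmod_of_absNorm hPi
    exact absurd ⟨φ θ, h1 φ⟩ hr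
  · rw [ideal_eq_of_le_of_absNorm_eq hle (by rw [hN, hPi]) (by rw [hPi]; exact pow_ne_zero _ hl.ne_zero)]
    exact hP.isPrime

lemma quad_split (hd : Squarefree d) (hd4 : d % 4 = 3) (hα : α ^ 2 = -(d : K))
    (hKα : Algebra.adjoin ℚ {α} = ⊤) {l : ℕ} [Fact l.Prime]
    (r : ZMod l) (hr : r * r = -((d + 1) / 4 : ℕ) + r) (hr2 : r ≠ 1 - r) :
    ∃ P Q : Ideal (𝓞 K), Ideal.absNorm P = l ∧ Ideal.absNorm Q = l ∧ P ⊔ Q = ⊤ ∧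
      Ideal.span {(l : 𝓞 K)} = P * Q := by
  have hl : l.Prime := Fact.out
  have hfin : Module.finrank ℤ (𝓞 K) = 2 := by
    rw [RingOfIntegers.rank K, quad_finrank hd hd4 hα hKα]
  obtain ⟨θ, h1, h2, h3⟩ := quad_homs hd hd4 hα hKα l
  have hN : Ideal.absNorm (Ideal.span {(l : 𝓞 K)}) = l ^ 2 := by
    rw [Ideal.absNorm_span_natCast, hfin]
  obtain ⟨φ, hφ⟩ := h3 r hr
  obtain ⟨ψ, hψ⟩ := h3 (1 - r) (by linear_combination hr)
  have hP := absNorm_ker_zmod φ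
  have hQ := absNorm_ker_zmod ψ
  have hPmax : (RingHom.ker φ).IsMaximal :=
    RingHom.ker_isMaximal_of_surjective φ (ZMod.ringHom_surjective φ)
  have hQmax : (RingHom.ker ψ).IsMaximal :=
    RingHom.ker_isMaximal_of_surjective ψ (ZMod.ringHom_surjective ψ)
  have hne : RingHom.ker φ ≠ RingHom.ker ψ := by
    intro h
    obtain ⟨n, hn⟩ := ZMod.natCast_zmod_surjective r
    have h4 : θ - n ∈ RingHom.ker φ := by rw [RingHom.mem_ker, map_sub, hφ, map_natCast, hn, sub_self]
    rw [h, RingHom.mem_ker, map_sub, hψ, map_natCast, hn] at h4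
    exact hr2 (sub_eq_zero.1 h4).symm
  have hcop : RingHom.ker φ ⊔ RingHom.ker ψ = ⊤ := Ideal.IsMaximal.coprime_of_ne hPmax hQmax hne
  refine ⟨RingHom.ker φ, RingHom.ker ψ, hP, hQ, hcop, ?_⟩
  apply ideal_eq_of_le_of_absNorm_eq
  · rw [Ideal.mul_eq_inf_of_coprime hcop, Ideal.span_singleton_le_iff_mem]
    constructor <;> simp
  · rw [hN, map_mul, hP, hQ, sq]
  · rw [map_mul, hP, hQ]; exact mul_ne_zero hl.ne_zero hl.ne_zero

lemma quad_ram (hd : Squarefree d) (hd4 : d % 4 = 3) (hα : α ^ 2 = -(d : K))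
    (hKα : Algebra.adjoin ℚ {α} = ⊤) {l : ℕ} [Fact l.Prime]
    (r : ZMod l) (hr : r * r = -((d + 1) / 4 : ℕ) + r) (hr2 : r = 1 - r) :
    ∃ P : Ideal (𝓞 K), Ideal.absNorm P = l ∧ Ideal.span {(l : 𝓞 K)} = P * P := by
  have hl : l.Prime := Fact.out
  have hfin : Module.finrank ℤ (𝓞 K) = 2 := by
    rw [RingOfIntegers.rank K, quad_finrank hd hd4 hα hKα]
  obtain ⟨θ, h1, h2, h3⟩ := quad_homs hd hd4 hα hKα l
  have hN : Ideal.absNorm (Ideal.span {(l : 𝓞 K)}) = l ^ 2 := by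
    rw [Ideal.absNorm_span_natCast, hfin]
  obtain ⟨φ, hφ⟩ := h3 r hr
  have hP := absNorm_ker_zmod φ
  have hle : RingHom.ker φ ∣ Ideal.span {(l : 𝓞 K)} := by
    rw [Ideal.dvd_iff_le, Ideal.span_singleton_le_iff_mem, RingHom.mem_ker]; simp
  obtain ⟨Q, hQ⟩ := hle
  have hQN : Ideal.absNorm Q = l := by
    rw [hQ, map_mul, hP, sq] at hN
    exact Nat.eq_of_mul_eq_mul_left hl.pos hN
  obtain ⟨ψ, hψ⟩ := exists_ker_zmod_of_absNorm hQN
  have h4 : ψ θ = r := by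
    have h5 := h1 ψ
    have h6 : (ψ θ - r) * (ψ θ - r) = 0 := by
      have h7 : r + r = 1 := by linear_combination hr2
      linear_combination h5 - ψ θ * h7 - hr + r * h7
    have := mul_self_eq_zero.1 h6
    exact sub_eq_zero.1 this
  have h5 : ψ = φ := h2 _ _ (by rw [h4, hφ])
  refine ⟨RingHom.ker φ, hP, ?_⟩
  rw [hQ, ← hψ, h5]

end Decomp

section Decomp2

open NumberField

variable {K : Type*} [Field K] [NumberField K] {d : ℕ} {α : K}

lemma zmod_two_aux1 : ¬ ∃ r : ZMod 2, r * r = -1 + r := by decide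

lemma zmod_two_aux2 : ∃ r : ZMod 2, r * r = -0 + r ∧ r ≠ 1 - r := by decide

lemma sum_neg_one_pow_range (k : ℕ) :
    ∑ i ∈ Finset.range (k + 1), (-1 : ℤ) ^ i = if Even k then 1 else 0 := by
  induction k with
  | zero => simp
  | succ k ih =>
    rw [Finset.sum_range_succ, ih]
    rcases Nat.even_or_odd k with h | h
    · have h2 : ¬ Even (k + 1) := by rw [Nat.even_add_one]; simpa using h
      simp [h, h2, h.add_one.neg_one_pow]
    · have h2 : Even (k + 1) := h.add_one
      have h1 : ¬ Even k := by simpa using h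
      simp [h1, h2, h2.neg_one_pow]

lemma jacobi_recip {l : ℕ} [Fact l.Prime] (hl2 : l ≠ 2) (hd4 : d % 4 = 3) :
    jacobiSym l d = legendreSym l (-(d : ℤ)) := by
  have hl : l.Prime := Fact.out
  have hodd : Odd l := hl.odd_of_ne_two hl2
  have hdodd : Odd d := Nat.odd_iff.2 (by omega)
  rw [jacobiSym.legendreSym.to_jacobiSym, jacobiSym.neg _ hodd, ZMod.χ₄_nat_eq_if_mod_four]
  have h2 : l % 2 = 1 := Nat.odd_iff.1 hodd
  have h4 : l % 4 = 1 ∨ l % 4 = 3 := by omega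
  rcases h4 with h4 | h4
  · rw [jacobiSym.quadratic_reciprocity_one_mod_four h4 hdodd]
    simp [h2, h4]
  · rw [jacobiSym.quadratic_reciprocity_three_mod_four h4 hd4]
    simp [h2, h4]

lemma quad_idealCount (hd : Squarefree d) (hd4 : d % 4 = 3) (hα : α ^ 2 = -(d : K))
    (hKα : Algebra.adjoin ℚ {α} = ⊤) {l : ℕ} [Fact l.Prime] (k : ℕ) :
    (idealCount (𝓞 K) (l ^ k) : ℤ) = ∑ i ∈ Finset.range (k + 1), (jacobiSym l d) ^ i := by
  have hl : l.Prime := Fact.out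
  have hfin : Module.finrank ℤ (𝓞 K) = 2 := by
    rw [RingOfIntegers.rank K, quad_finrank hd hd4 hα hKα]
  have hdodd : Odd d := Nat.odd_iff.2 (by omega)
  obtain ⟨w, hw⟩ : ∃ w : ℕ, d + 1 = 4 * w := ⟨(d + 1) / 4, by omega⟩
  have hw' : (d + 1) / 4 = w := by omega
  have key1 : jacobiSym l d = 1 → (∃ r : ZMod l, r * r = -((d + 1) / 4 : ℕ) + r ∧ r ≠ 1 - r) →
      (idealCount (𝓞 K) (l ^ k) : ℤ) = ∑ i ∈ Finset.range (k + 1), (jacobiSym l d) ^ i := by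
    rintro hj ⟨r, hr, hr2⟩
    obtain ⟨P, Q, hP, hQ, hPQ, h⟩ := quad_split hd hd4 hα hKα r hr hr2
    rw [idealCount_split hl hP hQ hPQ h, hj]
    simp
  have key2 : jacobiSym l d = -1 → (¬ ∃ r : ZMod l, r * r = -((d + 1) / 4 : ℕ) + r) →
      (idealCount (𝓞 K) (l ^ k) : ℤ) = ∑ i ∈ Finset.range (k + 1), (jacobiSym l d) ^ i := by
    intro hj hr
    rw [idealCount_inert hl hfin (quad_inert hd hd4 hα hKα hr), hj, sum_neg_one_pow_range]
    split_ifs <;> simp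
  have key3 : jacobiSym l d = 0 → (∃ r : ZMod l, r * r = -((d + 1) / 4 : ℕ) + r ∧ r = 1 - r) →
      (idealCount (𝓞 K) (l ^ k) : ℤ) = ∑ i ∈ Finset.range (k + 1), (jacobiSym l d) ^ i := by
    rintro hj ⟨r, hr, hr2⟩
    obtain ⟨P, hP, h⟩ := quad_ram hd hd4 hα hKα r hr hr2
    rw [idealCount_ram hl hP h, hj, Finset.sum_range_succ']
    simp
  rw [hw'] at key1 key2 key3
  by_cases hl2 : l = 2
  · subst hl2
    have h2 : jacobiSym ((2 : ℕ) : ℤ) d = ZMod.χ₈ d := by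
      exact_mod_cast jacobiSym.at_two hdodd
    rw [ZMod.χ₈_nat_eq_if_mod_eight] at h2
    have h8 : d % 8 = 3 ∨ d % 8 = 7 := by omega
    have hm : d % 2 = 1 := by omega
    rcases h8 with h8 | h8
    · apply key2
      · rw [h2]; simp [hm, h8]
      · have : (w : ZMod 2) = 1 := by
          have : w % 2 = 1 := by omega
          rw [← ZMod.natCast_mod, this]; rfl
        rw [this]; exact zmod_two_aux1
    · apply key1
      · rw [h2]; simp [hm, h8]
      · have : (w : ZMod 2) = 0 := by
          have : w % 2 = 0 := by omega
          rw [← ZMod.natCast_mod, this]; rfl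
        rw [this]; exact zmod_two_aux2
  · have hj := jacobi_recip (d := d) hl2 hd4
    have h20 : (2 : ZMod l) ≠ 0 := by
      intro h
      have h' : ((2 : ℕ) : ZMod l) = 0 := by exact_mod_cast h
      rw [ZMod.natCast_eq_zero_iff] at h'
      exact hl2 ((Nat.prime_dvd_prime_iff_eq hl Nat.prime_two).1 h')
    have hwd : (d : ZMod l) + 1 = 4 * w := by exact_mod_cast congrArg (Nat.cast : ℕ → ZMod l) hw
    have hcast : ((-(d : ℤ) : ℤ) : ZMod l) = -(d : ZMod l) := by push_cast; rfl
    obtain ⟨t, ht⟩ : ∃ t : ZMod l, 2 * t = 1 := ⟨2⁻¹, mul_inv_cancel₀ h20⟩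
    by_cases h0 : (d : ZMod l) = 0
    · apply key3
      · rw [hj, legendreSym.eq_zero_iff, hcast, h0, neg_zero]
      · refine ⟨t, ?_, ?_⟩
        · linear_combination t * ht - w * (1 + 2 * t) * ht - t ^ 2 * hwd + t ^ 2 * h0
        · linear_combination ht
    · by_cases hs : IsSquare (-(d : ZMod l))
      · apply key1
        · rw [hj, legendreSym.eq_one_iff, hcast]
          · exact hs
          · rw [hcast]; exact neg_ne_zero.2 h0
        · obtain ⟨c, hc⟩ := hs
          refine ⟨(1 + c) * t, ?_, ?_⟩
          · linear_combination (1 + c) * t * ht - t ^ 2 * hc - w * (1 + 2 * t) * ht - t ^ 2 * hwd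
          · intro h
            have : c = 0 := by linear_combination h - (1 + c) * ht
            rw [this, mul_zero, neg_eq_zero] at hc
            exact h0 hc
      · apply key2
        · rw [hj, legendreSym.eq_neg_one_iff, hcast]; exact hs
        · rintro ⟨r, hr⟩
          exact hs ⟨2 * r - 1, by linear_combination - hwd - 4 * hr⟩

/-- The arithmetic function `n ↦ (n/d)` . -/
noncomputable def jacArith (d : ℕ) (hd : 1 < d) : ArithmeticFunction ℤ :=
  ⟨fun n => jacobiSym n d, by
    have : NeZero d := ⟨by omega⟩
    rw [jacobiSym.eq_zero_iff_not_coprime]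
    simp; omega⟩

lemma jacArith_mult (hd : 1 < d) : (jacArith d hd).IsMultiplicative := by
  rw [ArithmeticFunction.IsMultiplicative.iff_ne_zero]
  constructor
  · simp [jacArith, jacobiSym.one_left]
  · intro m n _ _ _
    simp [jacArith, jacobiSym.mul_left]

lemma quad_idealCount_arith (hd : Squarefree d) (hd4 : d % 4 = 3) (hd1 : 1 < d)
    (hα : α ^ 2 = -(d : K)) (hKα : Algebra.adjoin ℚ {α} = ⊤) (n : ℕ) (hn : n ≠ 0) :
    (idealCount (𝓞 K) n : ℤ) = ((ArithmeticFunction.zeta : ArithmeticFunction ℤ) * jacArith d hd1) n := by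
  let R : ArithmeticFunction ℤ := ⟨fun n => if n = 0 then 0 else idealCount (𝓞 K) n, by simp⟩
  have hR : R.IsMultiplicative := by
    rw [ArithmeticFunction.IsMultiplicative.iff_ne_zero]
    constructor
    · simp [R, idealCount_one]
    · intro m n hm hn hmn
      simp [R, hm, hn, idealCount_mul hmn hm hn]
  have h1 : R = (ArithmeticFunction.zeta : ArithmeticFunction ℤ) * jacArith d hd1 := by
    rw [ArithmeticFunction.IsMultiplicative.eq_iff_eq_on_prime_powers R hR _
      (ArithmeticFunction.isMultiplicative_zeta.natCast.mul (jacArith_mult hd1))]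
    intro l k hl
    have : Fact l.Prime := ⟨hl⟩
    rw [ArithmeticFunction.coe_zeta_mul_apply, Nat.sum_divisors_prime_pow hl]
    have h2 : R (l ^ k) = idealCount (𝓞 K) (l ^ k) := by
      simp [R, hl.ne_zero]
    rw [h2, quad_idealCount hd hd4 hα hKα]
    apply Finset.sum_congr rfl
    intro i _
    simp [jacArith, jacobiSym.pow_left]
  rw [← h1]
  simp [R, hn]

end Decomp2

section LOne

open Filter Topology

lemma rpow_diff_bound {u w s : ℝ} (hu : 1 ≤ u) (huw : u ≤ w) (hs1 : 1 ≤ s) (hs2 : s ≤ 2) :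
    0 ≤ u ^ (-s) - w ^ (-s) ∧ u ^ (-s) - w ^ (-s) ≤ 2 * (w - u) / u ^ 2 := by
  have hu0 : 0 < u := by linarith
  have hw0 : 0 < w := by linarith
  constructor
  · have := Real.rpow_le_rpow_of_nonpos hu0 huw (by linarith : -s ≤ 0)
    linarith
  · have h1 : w ^ (-s) = u ^ (-s) * (u / w) ^ s := by
      rw [Real.div_rpow hu0.le hw0.le, Real.rpow_neg hu0.le, Real.rpow_neg hw0.le]
      have : u ^ s ≠ 0 := (Real.rpow_pos_of_pos hu0 s).ne'
      field_simp
    have hq0 : 0 < u / w := div_pos hu0 hw0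
    have hq1 : u / w ≤ 1 := (div_le_one hw0).2 huw
    have h2 : (u / w) ^ (2 : ℝ) ≤ (u / w) ^ s := Real.rpow_le_rpow_of_exponent_ge hq0 hq1 hs2
    rw [Real.rpow_two] at h2
    have h3 : u ^ (-s) ≤ u⁻¹ := by
      rw [← Real.rpow_neg_one]
      exact Real.rpow_le_rpow_of_exponent_le hu (by linarith)
    have h4 : u ^ (-s) - w ^ (-s) = u ^ (-s) * (1 - (u / w) ^ s) := by rw [h1]; ring
    have h5 : 1 - (u / w) ^ s ≤ 2 * (1 - u / w) := by nlinarith [sq_nonneg (1 - u / w)]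
    have h6 : 0 ≤ 2 * (1 - u / w) := by linarith
    have h7 : 2 * (1 - u / w) ≤ 2 * ((w - u) / u) := by
      have : 1 - u / w = (w - u) / w := by field_simp
      rw [this]
      have : (w - u) / w ≤ (w - u) / u := by
        apply div_le_div_of_nonneg_left (by linarith) hu0 huw
      linarith
    have h8 : 0 ≤ u ^ (-s) := (Real.rpow_pos_of_pos hu0 _).le
    calc u ^ (-s) - w ^ (-s) = u ^ (-s) * (1 - (u / w) ^ s) := h4
      _ ≤ u⁻¹ * (2 * ((w - u) / u)) := by
          have h9 : (u / w) ^ s ≤ 1 := Real.rpow_le_one hq0.le hq1 (by linarith)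
          exact mul_le_mul h3 (h5.trans h7) (by linarith) (by positivity)
      _ = 2 * (w - u) / u ^ 2 := by field_simp

lemma rpow_diff_bound' {u w s D m : ℝ} (hm : 1 ≤ m) (hu : m ≤ u) (hw : m ≤ w) (hD : |w - u| ≤ D)
    (hs1 : 1 ≤ s) (hs2 : s ≤ 2) :
    |u ^ (-s) - w ^ (-s)| ≤ 2 * D / m ^ 2 := by
  have hm0 : 0 < m := by linarith
  have key : ∀ u w : ℝ, m ≤ u → |w - u| ≤ D → u ≤ w → |u ^ (-s) - w ^ (-s)| ≤ 2 * D / m ^ 2 := by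
    intro u w hu hD huw
    obtain ⟨h1, h2⟩ := rpow_diff_bound (hm.trans hu) huw hs1 hs2
    rw [abs_of_nonneg h1]
    refine h2.trans ?_
    rw [abs_of_nonneg (by linarith)] at hD
    have : m ^ 2 ≤ u ^ 2 := by gcongr
    have hD0 : 0 ≤ D := by linarith
    gcongr
  rcases le_total u w with h | h
  · exact key u w hu hD h
  · rw [abs_sub_comm]
    exact key w u hw (by rwa [abs_sub_comm]) h

/-- Dominated convergence for the paired series. -/
lemma paired_tendsto {d v : ℕ} (hv : 0 < v) (hvd : v < d) :
    Tendsto (fun s : ℝ => ∑' m : ℕ, (((v : ℝ) + d * m) ^ (-s) - (((d - v : ℕ) : ℝ) + d * m) ^ (-s)))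
      (𝓝[>] 1) (𝓝 (∑' m : ℕ, (((v : ℝ) + d * m) ^ (-1 : ℝ) - (((d - v : ℕ) : ℝ) + d * m) ^ (-1 : ℝ)))) ∧
    Summable (fun m : ℕ => (((v : ℝ) + d * m) ^ (-1 : ℝ) - (((d - v : ℕ) : ℝ) + d * m) ^ (-1 : ℝ))) := by
  have hv1 : (1 : ℝ) ≤ v := by exact_mod_cast hv
  have hw1 : (1 : ℝ) ≤ ((d - v : ℕ) : ℝ) := by exact_mod_cast (by omega : 1 ≤ d - v)
  have hd1 : (1 : ℝ) ≤ d := by exact_mod_cast (by omega : 1 ≤ d)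
  have hsum : Summable (fun m : ℕ => 2 * (d : ℝ) / ((m : ℝ) + 1) ^ 2) := by
    have h1 : Summable (fun m : ℕ => 1 / ((m : ℝ)) ^ 2) := Real.summable_one_div_nat_pow.2 (by norm_num)
    have h2 := (summable_nat_add_iff 1).2 h1
    have h3 := h2.mul_left (2 * (d : ℝ))
    refine h3.congr ?_
    intro m
    push_cast
    ring
  have hbound : ∀ s : ℝ, 1 ≤ s → s ≤ 2 → ∀ m : ℕ,
      ‖((v : ℝ) + d * m) ^ (-s) - (((d - v : ℕ) : ℝ) + d * m) ^ (-s)‖ ≤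
      2 * (d : ℝ) / ((m : ℝ) + 1) ^ 2 := by
    intro s hs1 hs2 m
    have hm0 : (0 : ℝ) ≤ m := by positivity
    have hdm : (m : ℝ) ≤ d * m := by nlinarith
    apply rpow_diff_bound' (by linarith) (by linarith) (by linarith) _ hs1 hs2
    have hle : ((d - v : ℕ) : ℝ) = d - v := by rw [Nat.cast_sub hvd.le]
    rw [hle, abs_le]
    have hv' : (v : ℝ) < d := by exact_mod_cast hvd
    constructor <;> linarith
  refine ⟨?_, Summable.of_norm_bounded hsum (hbound 1 le_rfl (by norm_num))⟩
  apply tendsto_tsum_of_dominated_convergence hsum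
  · intro m
    have hm0 : (0 : ℝ) ≤ d * m := by positivity
    have c1 : ∀ x : ℝ, 1 ≤ x → Tendsto (fun s : ℝ => x ^ (-s)) (𝓝[>] 1) (𝓝 (x ^ (-1 : ℝ))) := by
      intro x hx
      have : ContinuousAt (fun s : ℝ => x ^ (-s)) 1 :=
        (Real.continuousAt_const_rpow (by linarith)).comp continuousAt_neg
      exact this.tendsto.mono_left nhdsWithin_le_nhds
    exact (c1 _ (by linarith)).sub (c1 _ (by linarith))
  · have : Set.Ioo (1 : ℝ) 2 ∈ 𝓝[>] (1 : ℝ) := Ioo_mem_nhdsGT (by norm_num)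
    filter_upwards [this] with s hs
    exact hbound s hs.1.le hs.2.le

lemma paired_cot {d v : ℕ} (hv : 0 < v) (hvd : v < d) :
    ((∑' m : ℕ, (((v : ℝ) + d * m) ^ (-1 : ℝ) - (((d - v : ℕ) : ℝ) + d * m) ^ (-1 : ℝ)) : ℝ) : ℂ) =
      Real.pi / d * Complex.cot (Real.pi * ((v : ℂ) / d)) := by
  obtain ⟨-, hs⟩ := paired_tendsto hv hvd
  have h1 := hs.hasSum.tendsto_sum_nat
  have h2 := (Complex.continuous_ofReal.tendsto _).comp h1
  refine tendsto_nhds_unique h2 ?_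
  have hd0 : (d : ℂ) ≠ 0 := by exact_mod_cast (by omega : d ≠ 0)
  have hv0 : (v : ℂ) ≠ 0 := by exact_mod_cast (by omega : v ≠ 0)
  set x : ℂ := (v : ℂ) / d with hx
  have hxZ : x ∈ Complex.integerComplement := by
    rw [Complex.integerComplement, Set.mem_compl_iff]
    rintro ⟨n, hn⟩
    rw [hx, eq_div_iff hd0] at hn
    have hn' : n * d = v := by exact_mod_cast hn
    rcases lt_trichotomy n 0 with h | h | h
    · have : n * (d : ℤ) ≤ 0 := by nlinarith
      omega
    · rw [h] at hn'; omega
    · have : (d : ℤ) ≤ n * d := by nlinarith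
      omega
  have hxn : ∀ n : ℤ, x + n ≠ 0 := by
    intro n hn
    apply hxZ
    exact ⟨-n, by push_cast; linear_combination -hn⟩
  have h3 := tendsto_logDeriv_euler_cot_sub hxZ
  have h4 : Tendsto (fun M : ℕ => 1 / (x + (M : ℂ))) atTop (𝓝 0) := by
    simp only [one_div]
    apply tendsto_inv₀_cobounded.comp
    rw [← tendsto_norm_atTop_iff_cobounded]
    have h6 : Tendsto (fun M : ℕ => (M : ℝ) - ‖x‖) atTop atTop :=
      tendsto_atTop_add_const_right _ _ tendsto_natCast_atTop_atTop
    refine tendsto_atTop_mono ?_ h6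
    intro M
    have h7 : ‖(M : ℂ)‖ ≤ ‖x + M‖ + ‖x‖ := by
      calc ‖(M : ℂ)‖ = ‖(x + M) - x‖ := by congr 1; ring
        _ ≤ _ := norm_sub_le _ _
    rw [Complex.norm_natCast] at h7
    linarith
  have h5 := ((h3.const_add (1 / x)).sub h4).const_mul (1 / (d : ℂ))
  have e : (1 / (d : ℂ)) * (1 / x + (Real.pi * Complex.cot (Real.pi * x) - 1 / x) - 0) =
      Real.pi / d * Complex.cot (Real.pi * x) := by ring
  rw [e] at h5
  refine h5.congr ?_
  intro M
  simp only [Function.comp]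
  induction M with
  | zero => simp
  | succ M ih =>
    rw [Finset.sum_range_succ, Finset.sum_range_succ]
    have hle : ((d - v : ℕ) : ℝ) = d - v := by rw [Nat.cast_sub hvd.le]
    rw [Complex.ofReal_add, ← ih]
    rw [Real.rpow_neg_one, Real.rpow_neg_one, hle]
    have e1 : (v : ℂ) + d * M = d * (x + M) := by rw [hx]; field_simp
    have e2 : (d : ℂ) - v + d * M = - d * (x - (M + 1)) := by rw [hx]; field_simp; ring
    push_cast
    rw [e1, e2]
    have n1 := hxn M
    have n2 := hxn (M + 1)
    have n3 := hxn (-(M + 1))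
    push_cast at n1 n2 n3
    have n3' : x - (M + 1) ≠ 0 := by
      intro h; apply n3; linear_combination h
    field_simp
    ring

end LOne

section LOne2

open Filter Topology

lemma odd_LSeries_tendsto {d : ℕ} [NeZero d] (ε : ZMod d → ℂ) (hodd : ∀ j, ε (-j) = - ε j)
    (hb : ∀ j, ‖ε j‖ ≤ 1) :
    Tendsto (fun s : ℝ => LSeries (fun n => ε (n : ZMod d)) (s : ℂ)) (𝓝[>] 1)
      (𝓝 (Real.pi / (2 * d) * ∑ j : ZMod d, ε j * Complex.cot (Real.pi * ((j.val : ℂ) / d)))) := by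
  have h0 : ε 0 = 0 := by
    have := hodd 0
    rw [neg_zero] at this
    exact self_eq_neg.1 this
  let D : ZMod d → ℝ → ℝ := fun j s =>
    ∑' m : ℕ, (((j.val : ℝ) + d * m) ^ (-s) - (((d - j.val : ℕ) : ℝ) + d * m) ^ (-s))
  have hL : ∀ s : ℝ, 1 < s → LSeries (fun n => ε (n : ZMod d)) (s : ℂ) =
      1 / 2 * ∑ j : ZMod d, ε j * (D j s : ℂ) := by
    intro s hs
    have hsum : LSeriesSummable (fun n => ε (n : ZMod d)) (s : ℂ) :=
      LSeriesSummable_of_bounded_of_one_lt_re (m := 1) (fun n _ => hb _) (by simpa using hs)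
    have hterm : ∀ (j : ZMod d) (m : ℕ), LSeries.term (fun n => ε (n : ZMod d)) (s : ℂ) (j.val + d * m) =
        ε j * (((((j.val : ℝ) + d * m) ^ (-s) : ℝ)) : ℂ) := by
      intro j m
      have hj : ((j.val + d * m : ℕ) : ZMod d) = j := by simp
      by_cases hj0 : j = 0
      · rw [LSeries.term_def]
        split_ifs
        · rw [hj0, h0]; simp
        · rw [hj, hj0, h0]; simp
      · have hpos : 0 < j.val := by
          rw [ZMod.val_pos]; exact hj0
        rw [LSeries.term_of_ne_zero (by omega), hj, div_eq_mul_inv]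
        congr 1
        rw [Real.rpow_neg (by positivity), Complex.ofReal_inv,
          Complex.ofReal_cpow (by positivity)]
        push_cast
        rfl
    have hAs : ∀ v : ℕ, Summable (fun m : ℕ => ((v : ℝ) + d * m) ^ (-s)) := by
      intro v
      have h1 : Summable (fun n : ℕ => (n : ℝ) ^ (-s)) := Real.summable_nat_rpow.2 (by linarith)
      have h2 : Function.Injective (fun m : ℕ => v + d * m) := by
        intro a b hab
        have : d * a = d * b := by simpa using hab
        exact Nat.eq_of_mul_eq_mul_left (Nat.pos_of_ne_zero (NeZero.ne d)) this
      have h3 := h1.comp_injective h2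
      refine h3.congr ?_
      intro m
      simp
    let A : ZMod d → ℂ := fun j => ((∑' m : ℕ, ((j.val : ℝ) + d * m) ^ (-s) : ℝ) : ℂ)
    have h1 : LSeries (fun n => ε (n : ZMod d)) (s : ℂ) = ∑ j : ZMod d, ε j * A j := by
      rw [LSeries, Nat.sumByResidueClasses hsum d]
      apply Finset.sum_congr rfl
      intro j _
      simp_rw [hterm]
      rw [tsum_mul_left]
      simp only [A]
      rw [Complex.ofReal_tsum]
    have h2 : ∑ j : ZMod d, ε j * A j = ∑ j : ZMod d, - (ε j * A (-j)) := by
      rw [← Equiv.sum_comp (Equiv.neg (ZMod d))]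
      apply Finset.sum_congr rfl
      intro j _
      simp only [Equiv.neg_apply]
      rw [hodd]; ring
    have h3 : ∀ j, ε j * A j + - (ε j * A (-j)) = ε j * (D j s : ℂ) := by
      intro j
      by_cases hj0 : j = 0
      · rw [hj0, h0]; ring
      · have : A j - A (-j) = (D j s : ℂ) := by
          simp only [A, D]
          rw [ZMod.neg_val, if_neg hj0, ← Complex.ofReal_sub, (hAs _).tsum_sub (hAs _)]
        rw [← this]; ring
    have h4 : 2 * LSeries (fun n => ε (n : ZMod d)) (s : ℂ) = ∑ j : ZMod d, ε j * (D j s : ℂ) := by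
      rw [two_mul]
      nth_rewrite 2 [h1]
      rw [h1, h2]
      nth_rewrite 1 [← h2]
      rw [← Finset.sum_add_distrib]
      exact Finset.sum_congr rfl (fun j _ => h3 j)
    rw [← h4]; ring
  have hlim : Tendsto (fun s : ℝ => 1 / 2 * ∑ j : ZMod d, ε j * (D j s : ℂ)) (𝓝[>] 1)
      (𝓝 (1 / 2 * ∑ j : ZMod d, ε j * (Real.pi / d * Complex.cot (Real.pi * ((j.val : ℂ) / d))))) := by
    apply Tendsto.const_mul
    apply tendsto_finsetSum
    intro j _
    by_cases hj0 : j = 0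
    · rw [hj0, h0]; simp
    · have hpos : 0 < j.val := by rw [ZMod.val_pos]; exact hj0
      have hlt : j.val < d := ZMod.val_lt j
      apply Tendsto.const_mul
      rw [← paired_cot hpos hlt]
      exact (Complex.continuous_ofReal.tendsto _).comp (paired_tendsto hpos hlt).1
  have e : Real.pi / (2 * d) * ∑ j : ZMod d, ε j * Complex.cot (Real.pi * ((j.val : ℂ) / d)) =
      1 / 2 * ∑ j : ZMod d, ε j * (Real.pi / d * Complex.cot (Real.pi * ((j.val : ℂ) / d))) := by
    rw [Finset.mul_sum, Finset.mul_sum]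
    apply Finset.sum_congr rfl
    intro j _
    ring
  rw [e]
  refine hlim.congr' ?_
  filter_upwards [self_mem_nhdsWithin] with s hs
  exact (hL s hs).symm

lemma sum_mul_pow_of_pow_eq_one {x : ℂ} (hx : x ≠ 1) (n : ℕ) (hn : 0 < n) (hxn : x ^ n = 1) :
    ∑ b ∈ Finset.range n, (b : ℂ) * x ^ b = n / (x - 1) := by
  have hx' : x - 1 ≠ 0 := sub_ne_zero.2 hx
  have key : ∀ n : ℕ, (∑ b ∈ Finset.range n, (b : ℂ) * x ^ b) * (x - 1) =
      n * x ^ n - x * ∑ b ∈ Finset.range n, x ^ b := by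
    intro n
    induction n with
    | zero => simp
    | succ n ih =>
      rw [Finset.sum_range_succ, add_mul, ih, Finset.sum_range_succ]
      push_cast
      ring
  have h2 : ∑ b ∈ Finset.range n, x ^ b = 0 := by
    have := mul_geom_sum x n
    rw [hxn, sub_self] at this
    exact (mul_eq_zero.1 this).resolve_left hx'
  rw [eq_div_iff hx', key, h2, hxn]
  ring

/-- Evaluation of the cotangent sum by means of the Gauss sum. -/
lemma cot_sum_eq {d : ℕ} [NeZero d] (ε : ZMod d → ℂ) (hodd : ∀ j, ε (-j) = - ε j) (τ : ℂ)
    (hτ : ∀ b, ∑ j : ZMod d, ε j * ZMod.stdAddChar (j * b) = ε b * τ) :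
    ∑ j : ZMod d, ε j * Complex.cot (Real.pi * ((j.val : ℂ) / d)) =
      2 * Complex.I / d * τ * ∑ b : ZMod d, ε b * b.val := by
  have h0 : ε 0 = 0 := by
    have := hodd 0
    rw [neg_zero] at this
    exact self_eq_neg.1 this
  have hd0 : (d : ℂ) ≠ 0 := by exact_mod_cast NeZero.ne d
  have hsum0 : ∑ j : ZMod d, ε j = 0 := by
    have := hτ 0
    simpa [h0] using this
  have h1 : ∀ j : ZMod d, j ≠ 0 → ∑ b : ZMod d, (b.val : ℂ) * ZMod.stdAddChar (j * b) =
      d / (ZMod.stdAddChar j - 1) := by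
    intro j hj
    have hne : ZMod.stdAddChar j ≠ (1 : ℂ) := by
      intro h
      apply hj
      apply ZMod.injective_stdAddChar
      rw [h, AddChar.map_zero_eq_one]
    have hpow : ∀ b : ℕ, (ZMod.stdAddChar j : ℂ) ^ b = ZMod.stdAddChar (j * (b : ZMod d)) := by
      intro b
      rw [← AddChar.map_nsmul_eq_pow, nsmul_eq_mul, mul_comm]
    rw [← sum_mul_pow_of_pow_eq_one hne d (Nat.pos_of_ne_zero (NeZero.ne d))]
    · symm
      apply Finset.sum_bij' (fun (b : ℕ) _ => (b : ZMod d)) (fun (b : ZMod d) _ => b.val)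
      · intro b _; simp
      · intro b _; simpa using ZMod.val_lt b
      · intro b hb
        exact ZMod.val_cast_of_lt (by simpa using hb)
      · intro b _; simp
      · intro b hb
        rw [hpow, ZMod.val_cast_of_lt (by simpa using hb)]
    · rw [hpow]; simp
  have h2 : ∀ j : ZMod d, ε j * Complex.cot (Real.pi * ((j.val : ℂ) / d)) =
      Complex.I * ε j + 2 * Complex.I / d * (ε j * ∑ b : ZMod d, (b.val : ℂ) * ZMod.stdAddChar (j * b)) := by
    intro j
    by_cases hj : j = 0
    · rw [hj, h0]; simp
    · rw [h1 j hj, Complex.cot_pi_eq_exp_ratio]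
      have e1 : Complex.exp (2 * Real.pi * Complex.I * ((j.val : ℂ) / d)) = ZMod.stdAddChar j := by
        rw [ZMod.stdAddChar_apply, ZMod.toCircle_apply]
        congr 1
        ring
      have hne : ZMod.stdAddChar j ≠ (1 : ℂ) := by
        intro h
        apply hj
        apply ZMod.injective_stdAddChar
        rw [h, AddChar.map_zero_eq_one]
      rw [e1]
      have h3 : (ZMod.stdAddChar j : ℂ) - 1 ≠ 0 := sub_ne_zero.2 hne
      have h4 : 1 - (ZMod.stdAddChar j : ℂ) ≠ 0 := sub_ne_zero.2 hne.symm
      have hI := Complex.I_sq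
      have hI0 := Complex.I_ne_zero
      generalize (ZMod.stdAddChar j : ℂ) = y at *
      have e2 : (y + 1) / (Complex.I * (1 - y)) = Complex.I * (1 + 2 / (y - 1)) := by
        rw [div_eq_iff (mul_ne_zero hI0 h4)]
        field_simp
        linear_combination (- (1 - y) * (y + 1)) * hI
      rw [e2]
      field_simp
  simp_rw [h2]
  rw [Finset.sum_add_distrib, ← Finset.mul_sum, hsum0, ← Finset.mul_sum]
  simp_rw [Finset.mul_sum]
  rw [Finset.sum_comm]
  rw [mul_zero, zero_add]
  apply Finset.sum_congr rfl
  intro b _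
  have := hτ b
  rw [← Finset.mul_sum]
  calc _ = 2 * Complex.I / d * (b.val * ∑ j : ZMod d, ε j * ZMod.stdAddChar (j * b)) := by
        congr 1
        rw [Finset.mul_sum]
        apply Finset.sum_congr rfl
        intro j _; ring
    _ = _ := by rw [this]; ring

end LOne2

section TauTheory

/-- The Jacobi symbol as a function on `ZMod d`. -/
noncomputable def eps (d : ℕ) (j : ZMod d) : ℤ := jacobiSym (j.val : ℤ) d

lemma eps_intCast (d : ℕ) [NeZero d] (a : ℤ) : eps d (a : ZMod d) = jacobiSym a d := by
  unfold eps
  rw [ZMod.val_intCast]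
  exact (jacobiSym.mod_left a d).symm

lemma eps_natCast (d : ℕ) [NeZero d] (a : ℕ) : eps d (a : ZMod d) = jacobiSym a d := by
  have := eps_intCast d (a : ℤ)
  simpa using this

lemma eps_mul (d : ℕ) [NeZero d] (a b : ZMod d) : eps d (a * b) = eps d a * eps d b := by
  rw [← ZMod.natCast_zmod_val a, ← ZMod.natCast_zmod_val b, ← Nat.cast_mul]
  simp only [eps_natCast]
  push_cast
  rw [jacobiSym.mul_left]

lemma eps_neg {d : ℕ} [NeZero d] (hd : d % 4 = 3) (a : ZMod d) : eps d (-a) = - eps d a := by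
  have : -a = ((-(a.val : ℤ) : ℤ) : ZMod d) := by simp
  rw [this, eps_intCast, jacobiSym.neg _ (Nat.odd_iff.2 (by omega)), ZMod.χ₄_nat_three_mod_four hd]
  simp [eps]

lemma eps_one (d : ℕ) [NeZero d] : eps d 1 = 1 := by
  have := eps_natCast d 1
  simpa using this

lemma eps_sq_unit (d : ℕ) [NeZero d] {a : ZMod d} (ha : IsUnit a) : eps d a * eps d a = 1 := by
  have h1 := (ZMod.isUnit_iff_coprime a.val d).1 (by simpa using ha)
  have := jacobiSym.sq_one (a := (a.val : ℤ)) (b := d) (by rw [Int.gcd_natCast_natCast]; exact h1)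
  unfold eps
  rw [← this]; ring

lemma eps_unit_or (d : ℕ) [NeZero d] {a : ZMod d} (ha : IsUnit a) : eps d a = 1 ∨ eps d a = -1 :=
  mul_self_eq_one_iff.1 (eps_sq_unit d ha)

lemma eps_nonunit (d : ℕ) [NeZero d] {a : ZMod d} (ha : ¬ IsUnit a) : eps d a = 0 := by
  have h1 : ¬ Nat.Coprime a.val d := by
    rw [← ZMod.isUnit_iff_coprime]; simpa using ha
  unfold eps
  rw [jacobiSym.eq_zero_iff_not_coprime]
  rw [Int.gcd_natCast_natCast]; exact h1

lemma exists_nonresidue (r : ℕ) (hr : r.Prime) (hr2 : r ≠ 2) :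
    ∃ a : ℕ, jacobiSym a r = -1 := by
  have := Fact.mk hr
  obtain ⟨a, ha⟩ := quadraticChar_exists_neg_one (F := ZMod r) (by rwa [ringChar.eq (ZMod r) r])
  refine ⟨a.val, ?_⟩
  rw [← jacobiSym.legendreSym.to_jacobiSym]
  simp [legendreSym, ha]

lemma eps_exists_fix_aux {p₁ p₂ : ℕ} (hp₁ : p₁.Prime) (hp₂ : p₂.Prime) (h12 : p₁ ≠ p₂)
    (h1 : p₁ ≠ 2) (b : ℕ) (hb : p₁ ∣ b) :
    ∃ c : ℕ, jacobiSym c (p₁ * p₂) = -1 ∧ ((c * b : ℕ) : ZMod (p₁ * p₂)) = (b : ZMod (p₁ * p₂)) := by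
  obtain ⟨a, ha⟩ := exists_nonresidue p₁ hp₁ h1
  have hc : Nat.Coprime p₁ p₂ := (Nat.coprime_primes hp₁ hp₂).2 h12
  obtain ⟨c, hca, hc1⟩ := Nat.chineseRemainder hc a 1
  have := NeZero.mk hp₁.ne_zero
  have := NeZero.mk hp₂.ne_zero
  refine ⟨c, ?_, ?_⟩
  · rw [jacobiSym.mul_right]
    have e1 : jacobiSym c p₁ = -1 := by
      rw [jacobiSym.mod_left, show ((c : ℤ) % p₁) = (a : ℤ) % p₁ by exact_mod_cast hca,
        ← jacobiSym.mod_left, ha]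
    have e2 : jacobiSym c p₂ = 1 := by
      rw [jacobiSym.mod_left, show ((c : ℤ) % p₂) = (1 : ℤ) % p₂ by exact_mod_cast hc1,
        ← jacobiSym.mod_left, jacobiSym.one_left]
    rw [e1, e2]; rfl
  · rw [ZMod.natCast_eq_natCast_iff]
    apply (Nat.modEq_and_modEq_iff_modEq_mul hc).1
    constructor
    · exact ((Nat.modEq_zero_iff_dvd.2 (hb.mul_left c))).trans (Nat.modEq_zero_iff_dvd.2 hb).symm
    · simpa using hc1.mul_right b

lemma eps_exists_fix {p₁ p₂ : ℕ} (hp₁ : p₁.Prime) (hp₂ : p₂.Prime) (h12 : p₁ ≠ p₂)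
    (h1 : p₁ ≠ 2) (h2 : p₂ ≠ 2) (b : ZMod (p₁ * p₂)) (hb : ¬ IsUnit b) :
    ∃ c : ZMod (p₁ * p₂), eps (p₁ * p₂) c = -1 ∧ c * b = b := by
  have := NeZero.mk hp₁.ne_zero
  have := NeZero.mk hp₂.ne_zero
  have hb' : ¬ Nat.Coprime b.val (p₁ * p₂) := by
    rw [← ZMod.isUnit_iff_coprime]; simpa using hb
  rw [Nat.coprime_mul_iff_right, not_and_or] at hb'
  rcases hb' with hb' | hb'
  · have : p₁ ∣ b.val := by
      rwa [Nat.coprime_comm, hp₁.coprime_iff_not_dvd, not_not] at hb'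
    obtain ⟨c, hc, hcb⟩ := eps_exists_fix_aux hp₁ hp₂ h12 h1 b.val this
    refine ⟨c, ?_, ?_⟩
    · rw [eps_natCast, hc]
    · simpa using hcb
  · have : p₂ ∣ b.val := by
      rwa [Nat.coprime_comm, hp₂.coprime_iff_not_dvd, not_not] at hb'
    obtain ⟨c, hc, hcb⟩ := eps_exists_fix_aux hp₂ hp₁ h12.symm h2 b.val this
    rw [mul_comm p₂ p₁] at hc hcb
    refine ⟨c, ?_, ?_⟩
    · rw [eps_natCast, hc]
    · simpa using hcb

/-- The quadratic Gauss sum modulo `d`. -/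
noncomputable def tau (d : ℕ) [NeZero d] : ℂ := ∑ j : ZMod d, (eps d j : ℂ) * ZMod.stdAddChar j

lemma tau_shift {p₁ p₂ : ℕ} [NeZero (p₁ * p₂)] (hp₁ : p₁.Prime) (hp₂ : p₂.Prime) (h12 : p₁ ≠ p₂)
    (h1 : p₁ ≠ 2) (h2 : p₂ ≠ 2) (b : ZMod (p₁ * p₂)) :
    ∑ j : ZMod (p₁ * p₂), (eps (p₁ * p₂) j : ℂ) * ZMod.stdAddChar (j * b) =
      (eps (p₁ * p₂) b : ℂ) * tau (p₁ * p₂) := by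
  have key : ∀ (u : (ZMod (p₁ * p₂))ˣ) (b : ZMod (p₁ * p₂)),
      ∑ j : ZMod (p₁ * p₂), (eps (p₁ * p₂) j : ℂ) * ZMod.stdAddChar (j * ((u : ZMod (p₁ * p₂)) * b)) =
      (eps (p₁ * p₂) u : ℂ) *
        ∑ j : ZMod (p₁ * p₂), (eps (p₁ * p₂) j : ℂ) * ZMod.stdAddChar (j * b) := by
    intro u b
    rw [← Equiv.sum_comp (Units.mulRight u)
      (fun j => (eps (p₁ * p₂) j : ℂ) * ZMod.stdAddChar (j * b)), Finset.mul_sum]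
    apply Finset.sum_congr rfl
    intro j _
    simp only [Units.mulRight_apply]
    rw [eps_mul]
    push_cast
    have := eps_sq_unit (p₁ * p₂) u.isUnit
    have : (eps (p₁ * p₂) u : ℂ) * eps (p₁ * p₂) u = 1 := by exact_mod_cast this
    rw [mul_assoc j]
    linear_combination (-(eps (p₁ * p₂) j : ℂ) * ZMod.stdAddChar (j * ((u : ZMod (p₁ * p₂)) * b))) * this
  by_cases hb : IsUnit b
  · obtain ⟨u, rfl⟩ := hb
    have := key u 1
    simpa [tau] using this
  · obtain ⟨c, hc, hcb⟩ := eps_exists_fix hp₁ hp₂ h12 h1 h2 b hb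
    have hcu : IsUnit c := by
      by_contra h
      rw [eps_nonunit _ h] at hc
      norm_num at hc
    obtain ⟨u, rfl⟩ := hcu
    have := key u b
    rw [hcb, hc] at this
    rw [eps_nonunit _ hb]
    push_cast at this ⊢
    rw [zero_mul]
    linear_combination this / 2

lemma tau_sq {p₁ p₂ : ℕ} [NeZero (p₁ * p₂)] (hp₁ : p₁.Prime) (hp₂ : p₂.Prime) (h12 : p₁ ≠ p₂)
    (h1 : p₁ ≠ 2) (h2 : p₂ ≠ 2) (hd : (p₁ * p₂) % 4 = 3) :
    tau (p₁ * p₂) ^ 2 = - ((p₁ * p₂ : ℕ) : ℂ) := by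
  set d := p₁ * p₂ with hdd
  have hdft : ZMod.dft (fun j : ZMod d => (eps d j : ℂ)) = (-tau d) • (fun j : ZMod d => (eps d j : ℂ)) := by
    funext k
    rw [ZMod.dft_apply]
    have := tau_shift hp₁ hp₂ h12 h1 h2 (-k)
    rw [show eps (p₁ * p₂) (-k) = - eps d k from eps_neg hd k] at this
    simp only [Pi.smul_apply, smul_eq_mul]
    rw [Int.cast_neg] at this
    change _ = -(eps d k : ℂ) * tau d at this
    rw [show -tau d * (eps d k : ℂ) = -(eps d k : ℂ) * tau d by ring, ← this]
    apply Finset.sum_congr rfl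
    intro j _
    rw [mul_neg, mul_comm]
  have h3 := ZMod.dft_dft (fun j : ZMod d => (eps d j : ℂ))
  rw [hdft, map_smul, hdft] at h3
  have h4 := congrFun h3 1
  simp only [Pi.smul_apply, smul_eq_mul, eps_neg hd, eps_one] at h4
  push_cast at h4
  linear_combination h4

end TauTheory

section ClassNumberFormula

open Filter Topology NumberField

lemma class_number_formula {p₁ p₂ : ℕ} [NeZero (p₁ * p₂)] (hp₁ : p₁.Prime) (hp₂ : p₂.Prime)
    (h12 : p₁ ≠ p₂)
    (h1 : p₁ ≠ 2) (h2 : p₂ ≠ 2) (hd : (p₁ * p₂) % 4 = 3)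
    {K : Type*} [Field K] [NumberField K] {α : K}
    (hα : α ^ 2 = -((p₁ * p₂ : ℕ) : K)) (hKα : Algebra.adjoin ℚ {α} = ⊤) :
    (∑ b : ZMod (p₁ * p₂), eps (p₁ * p₂) b * b.val) ^ 2 = ((classNumber K * (p₁ * p₂) : ℕ) : ℤ) ^ 2 := by
  have hsq : Squarefree (p₁ * p₂) :=
    (Nat.squarefree_mul ((Nat.coprime_primes hp₁ hp₂).2 h12)).2 ⟨hp₁.squarefree, hp₂.squarefree⟩
  have hd5 : 5 ≤ p₁ * p₂ := by
    have := hp₁.two_le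
    have := hp₂.two_le
    have : 3 ≤ p₁ := by omega
    nlinarith
  have hd1 : 1 < p₁ * p₂ := by omega
  have htau2 := tau_sq hp₁ hp₂ h12 h1 h2 hd
  have htau := tau_shift hp₁ hp₂ h12 h1 h2
  have hres := quad_residue hsq hd hd5 hα hKα
  have hcount := fun n hn => quad_idealCount_arith hsq hd hd1 hα hKα n hn
  generalize hdd : p₁ * p₂ = d at *
  set ε : ZMod d → ℂ := fun j => (eps d j : ℂ) with hε
  have hodd : ∀ j, ε (-j) = - ε j := by intro j; simp [hε, eps_neg hd]
  have hb : ∀ j, ‖ε j‖ ≤ 1 := by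
    intro j
    simp only [hε]
    by_cases hj : IsUnit j
    · rcases eps_unit_or d hj with h | h <;> simp [h]
    · simp [eps_nonunit d hj]
  have hlim1 := odd_LSeries_tendsto ε hodd hb
  rw [cot_sum_eq ε hodd (tau d) htau] at hlim1
  have hL : ∀ s : ℝ, 1 < s → dedekindZeta K s = riemannZeta s * LSeries (fun n => ε (n : ZMod d)) (s : ℂ) := by
    intro s hs
    have hs' : 1 < (s : ℂ).re := by simpa using hs
    let g : ArithmeticFunction ℂ := (jacArith d hd1 : ArithmeticFunction ℂ)
    have hg : ∀ n, g n = ε (n : ZMod d) := by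
      intro n
      simp only [hε, eps_natCast, g, ArithmeticFunction.intCoe_apply]
      rfl
    have hgs : LSeriesSummable (fun n => g n) (s : ℂ) :=
      LSeriesSummable_of_bounded_of_one_lt_re (m := 1) (fun n _ => by rw [hg]; exact hb _) hs'
    have hzs : LSeriesSummable (fun n => (ArithmeticFunction.zeta : ArithmeticFunction ℂ) n) (s : ℂ) :=
      ArithmeticFunction.LSeriesSummable_zeta_iff.2 hs'
    have e1 := ArithmeticFunction.LSeries_mul' (f := (ArithmeticFunction.zeta : ArithmeticFunction ℂ)) (g := g) hzs hgs
    have e0 : LSeries (fun n => (ArithmeticFunction.zeta : ArithmeticFunction ℂ) n) (s : ℂ) = riemannZeta s := by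
      rw [← ArithmeticFunction.LSeries_zeta_eq_riemannZeta hs']; rfl
    rw [e0] at e1
    have e2 : LSeries (fun n => g n) (s : ℂ) = LSeries (fun n => ε (n : ZMod d)) (s : ℂ) := by
      congr 1; funext n; exact hg n
    rw [← e2, ← e1]
    unfold dedekindZeta
    apply LSeries_congr
    intro n hn
    have := hcount n hn
    have h3 := congrArg (Int.cast : ℤ → ℂ) this
    rw [show (idealCount (𝓞 K) n) = Nat.card {I : Ideal (𝓞 K) // Ideal.absNorm I = n} from rfl] at h3
    rw [Int.cast_natCast] at h3
    rw [h3, ArithmeticFunction.mul_apply, ArithmeticFunction.mul_apply]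
    push_cast
    apply Finset.sum_congr rfl
    intro x _
    simp [g]
  have hlim2 := NumberField.tendsto_sub_one_mul_dedekindZeta_nhdsGT K
  have hlim3 : Tendsto (fun s : ℝ => ((s : ℂ) - 1) * riemannZeta s) (𝓝[>] 1) (𝓝 1) := by
    refine riemannZeta_residue_one.comp ?_
    apply tendsto_nhdsWithin_of_tendsto_nhds_of_eventually_within
    · exact (Complex.continuous_ofReal.tendsto' 1 1 (by simp)).mono_left nhdsWithin_le_nhds
    · filter_upwards [self_mem_nhdsWithin] with s hs
      have : s ≠ 1 := (ne_of_gt hs)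
      simpa using (by exact_mod_cast this : (s : ℂ) ≠ 1)
  have hlim4 := hlim3.mul hlim1
  have huniq := tendsto_nhds_unique (hlim4.congr' (f₂ := fun s : ℝ => ((s : ℂ) - 1) * dedekindZeta K s) (by
    filter_upwards [self_mem_nhdsWithin] with s hs
    rw [hL s hs]; ring)) (by simpa using hlim2)
  rw [hres] at huniq
  have hpi : (Real.pi : ℂ) ≠ 0 := by exact_mod_cast Real.pi_ne_zero
  have hd0 : (d : ℂ) ≠ 0 := by exact_mod_cast NeZero.ne d
  have hsq2 : ((√(d : ℝ) : ℝ) : ℂ) ^ 2 = d := by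
    rw [← Complex.ofReal_pow, Real.sq_sqrt (by positivity)]; simp
  have hsd0 : ((√(d : ℝ) : ℝ) : ℂ) ≠ 0 := by
    intro h; rw [h] at hsq2; apply hd0; rw [← hsq2]; ring
  have hS : (((∑ b : ZMod d, eps d b * b.val : ℤ)) : ℂ) = ∑ b : ZMod d, ε b * b.val := by
    push_cast; rfl
  rw [← hS] at huniq
  push_cast at huniq
  have : (((∑ b : ZMod d, eps d b * b.val : ℤ)) : ℂ) ^ 2 = ((classNumber K * d : ℕ) : ℂ) ^ 2 := by
    push_cast
    generalize (∑ b : ZMod d, (eps d b : ℂ) * (b.val : ℂ)) = S at *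
    generalize (((√(d : ℝ) : ℝ) : ℂ)) = r at *
    have h5 : Complex.I * tau d * S * r = classNumber K * d ^ 2 := by
      field_simp at huniq
      linear_combination huniq
    have h6 := congrArg (fun z => z ^ 2) h5
    simp only [mul_pow, htau2, hsq2, Complex.I_sq] at h6
    have : (d : ℂ) ^ 2 * (S ^ 2) = d ^ 2 * ((classNumber K : ℂ) * d) ^ 2 := by
      linear_combination h6
    exact mul_left_cancel₀ (pow_ne_zero 2 hd0) this
  exact_mod_cast this

end ClassNumberFormula

section GaussBasics

/-- The canonical additive character as an `AddChar`. -/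
noncomputable def psiA (p : ℕ) [Fact p.Prime] (F : Type*) [Field F] [Fintype F] [Algebra (ZMod p) F] :
    AddChar F ℂ :=
  (ZMod.stdAddChar (N := p)).compAddMonoidHom (Algebra.trace (ZMod p) F).toAddMonoidHom

variable {p : ℕ} [Fact p.Prime] {F : Type*} [Field F] [Fintype F] [Algebra (ZMod p) F]

lemma psiA_apply (x : F) : psiA p F x = ZMod.stdAddChar (Algebra.trace (ZMod p) F x) := rfl

lemma psiA_eq (x : F) : psiA p F x = psi p x := by
  rw [psiA_apply, ZMod.stdAddChar_apply, ZMod.toCircle_apply]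
  unfold psi
  congr 1

lemma gaussSumF_eq (χ : MulChar F ℂ) : gaussSumF p χ = gaussSum χ (psiA p F) := by
  unfold gaussSumF gaussSum
  simp_rw [← psiA_eq]
  rw [← Finset.sum_subset (Finset.subset_univ (Finset.univ.image (fun x : Fˣ => (x : F))))]
  · rw [Finset.sum_image (fun a _ b _ h => Units.ext h)]
  · intro x _ hx
    have : ¬ IsUnit x := by
      rintro ⟨u, rfl⟩
      exact hx (by simp)
    rw [MulChar.map_nonunit _ this, zero_mul]

lemma psiA_ne_one : psiA p F ≠ 1 := by
  intro h
  have hs : Function.Surjective (Algebra.trace (ZMod p) F) := Algebra.trace_surjective _ _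
  obtain ⟨x, hx⟩ := hs 1
  have h1 : psiA p F x = 1 := by rw [h]; rfl
  rw [psiA_apply, hx] at h1
  have : (1 : ZMod p) = 0 := by
    apply ZMod.injective_stdAddChar
    rw [h1, AddChar.map_zero_eq_one]
  exact one_ne_zero this

lemma psiA_primitive : (psiA p F).IsPrimitive := AddChar.IsPrimitive.of_ne_one psiA_ne_one

lemma psiA_pow (x : F) : psiA p F (x ^ p) = psiA p F x := by
  rw [psiA_apply, psiA_apply]
  congr 1
  have : CharP F p := charP_of_injective_algebraMap (algebraMap (ZMod p) F).injective p
  have h := Algebra.trace_eq_of_algEquiv (FiniteField.frobeniusAlgEquiv (ZMod p) F p) x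
  simpa using h

lemma gaussSum_pow_p (χ : MulChar F ℂ) : gaussSum (χ ^ p) (psiA p F) = gaussSum χ (psiA p F) := by
  have hp : p.Prime := Fact.out
  have : CharP F p := charP_of_injective_algebraMap (algebraMap (ZMod p) F).injective p
  unfold gaussSum
  rw [← Function.Bijective.sum_comp (bijective_frobenius F p) (fun a => χ a * psiA p F a)]
  apply Finset.sum_congr rfl
  intro x _
  rw [frobenius_def, psiA_pow, map_pow, MulChar.pow_apply' _ hp.ne_zero]

lemma gaussSum_pow_p_pow (χ : MulChar F ℂ) (i : ℕ) :
    gaussSum (χ ^ (p ^ i)) (psiA p F) = gaussSum χ (psiA p F) := by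
  induction i with
  | zero => simp
  | succ i ih => rw [pow_succ, pow_mul, gaussSum_pow_p, ih]

lemma mulChar_neg_one {χ : MulChar F ℂ} {N : ℕ} (hN : Odd N) (hχ : χ ^ N = 1) : χ (-1) = 1 := by
  have h1 : χ (-1) ^ 2 = 1 := by
    rw [← map_pow]; simp
  have h2 : χ (-1) ^ N = 1 := by
    rw [← MulChar.pow_apply' _ (by rintro rfl; simp at hN), hχ, MulChar.one_apply]
    exact isUnit_one.neg
  have := pow_gcd_eq_one.2 ⟨h1, h2⟩
  rwa [(Nat.coprime_two_left.2 hN), pow_one] at this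

lemma gaussSum_conj {χ : MulChar F ℂ} {N : ℕ} (hN : Odd N) (hχ : χ ^ N = 1) :
    (starRingEnd ℂ) (gaussSum χ (psiA p F)) = gaussSum χ⁻¹ (psiA p F) := by
  have h1 := star_gaussSum_eq χ (psiA p F)
  have h2 := mul_gaussSum_inv_eq_gaussSum χ⁻¹ (psiA p F)
  have h3 : χ⁻¹ (-1) = 1 := by
    apply mulChar_neg_one hN; rw [inv_pow, hχ, inv_one]
  rw [h3, one_mul] at h2
  rw [← h2, ← h1]; rfl

lemma gaussSum_mul_conj {χ : MulChar F ℂ} (hχ1 : χ ≠ 1) :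
    gaussSum χ (psiA p F) * (starRingEnd ℂ) (gaussSum χ (psiA p F)) = Fintype.card F := by
  rw [← gaussSum_mul_gaussSum_eq_card hχ1 (psiA_primitive (p := p) (F := F))]
  congr 1
  exact star_gaussSum_eq χ (psiA p F)

lemma mulChar_prime_field {χ : MulChar F ℂ} {N : ℕ} (hN : N.Coprime (p - 1)) (hχ : χ ^ N = 1)
    (t : ZMod p) (ht : t ≠ 0) : χ (algebraMap (ZMod p) F t) = 1 := by
  have ht' : IsUnit (algebraMap (ZMod p) F t) := (isUnit_iff_ne_zero.2 ht).map _
  have h1 : χ (algebraMap (ZMod p) F t) ^ (p - 1) = 1 := by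
    rw [← map_pow, ← map_pow, ZMod.pow_card_sub_one_eq_one ht]; simp
  have h2 : χ (algebraMap (ZMod p) F t) ^ N = 1 := by
    by_cases h0 : N = 0
    · simp [h0]
    rw [← MulChar.pow_apply' _ h0, hχ, MulChar.one_apply ht']
  have := pow_gcd_eq_one.2 ⟨h2, h1⟩
  rwa [hN, pow_one] at this

/-- Sum of a character over the elements of trace one. -/
noncomputable def traceOneSum (p : ℕ) [Fact p.Prime] {F : Type*} [Field F] [Fintype F]
    [Algebra (ZMod p) F] (χ : MulChar F ℂ) : ℂ :=
  ∑ x ∈ Finset.univ.filter (fun x : F => Algebra.trace (ZMod p) F x = 1), χ x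

lemma gaussSum_eq_traceOneSum {χ : MulChar F ℂ} {N : ℕ} (hN : N.Coprime (p - 1)) (hχ : χ ^ N = 1)
    (hχ1 : χ ≠ 1) : gaussSum χ (psiA p F) = - (p : ℂ) * traceOneSum p χ := by
  have hp : p.Prime := Fact.out
  let S : ZMod p → ℂ := fun t => ∑ x ∈ Finset.univ.filter (fun x : F => Algebra.trace (ZMod p) F x = t), χ x
  have hS : ∀ t : ZMod p, t ≠ 0 → S t = S 1 := by
    intro t ht
    have ht' : algebraMap (ZMod p) F t ≠ 0 := by simpa using ht
    symm
    apply Finset.sum_bij' (fun x _ => algebraMap (ZMod p) F t * x)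
      (fun x _ => (algebraMap (ZMod p) F t)⁻¹ * x)
    · intro x hx
      simp only [Finset.mem_filter, Finset.mem_univ, true_and] at hx ⊢
      rw [← Algebra.smul_def, map_smul, hx]; simp
    · intro x hx
      simp only [Finset.mem_filter, Finset.mem_univ, true_and] at hx ⊢
      rw [← map_inv₀, ← Algebra.smul_def, map_smul, hx]; simp [ht]
    · intro x _
      rw [inv_mul_cancel_left₀ ht']
    · intro x _
      rw [mul_inv_cancel_left₀ ht']
    · intro x _
      rw [map_mul, mulChar_prime_field hN hχ t ht, one_mul]
  have h0 : ∑ t : ZMod p, S t = 0 := by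
    simp only [S]
    rw [Finset.sum_fiberwise, MulChar.sum_eq_zero_of_ne_one hχ1]
  have hG : gaussSum χ (psiA p F) = ∑ t : ZMod p, ZMod.stdAddChar t * S t := by
    unfold gaussSum
    rw [← Finset.sum_fiberwise Finset.univ (fun x => Algebra.trace (ZMod p) F x)]
    apply Finset.sum_congr rfl
    intro t _
    simp only [S]
    rw [Finset.mul_sum]
    apply Finset.sum_congr rfl
    intro x hx
    simp only [Finset.mem_filter, Finset.mem_univ, true_and] at hx
    rw [psiA_apply, hx, mul_comm]
  have h1 : ∑ t : ZMod p, (ZMod.stdAddChar t : ℂ) = 0 := by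
    apply AddChar.sum_eq_zero_of_ne_one
    intro h
    have : (1 : ZMod p) = 0 := by
      apply ZMod.injective_stdAddChar
      rw [h]; simp
    exact one_ne_zero this
  have hS' : ∀ t : ZMod p, S t = S 1 + (if t = 0 then S 0 - S 1 else 0) := by
    intro t
    split_ifs with h
    · rw [h]; ring
    · rw [hS t h, add_zero]
  have h2 : (p : ℂ) * S 1 + (S 0 - S 1) = 0 := by
    rw [← h0]
    rw [Finset.sum_congr rfl (fun t _ => hS' t), Finset.sum_add_distrib]
    simp
  have h3 : gaussSum χ (psiA p F) = S 0 - S 1 := by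
    rw [hG, Finset.sum_congr rfl (fun t _ => by rw [hS' t, mul_add]), Finset.sum_add_distrib,
      ← Finset.sum_mul, h1]
    simp
  have h4 : traceOneSum p χ = S 1 := rfl
  rw [h4, h3]
  linear_combination h2

end GaussBasics

section Rationality

open Polynomial

lemma int_of_poly {N : ℕ} (hN : 0 < N) {ζ : ℂ} (hζ : IsPrimitiveRoot ζ N) (P : ℤ[X]) (c : ℂ)
    (h : ∀ a : ℕ, a.Coprime N → aeval (ζ ^ a) P = c) : ∃ z : ℤ, c = z := by
  have := NeZero.mk hN.ne'
  let R := P %ₘ cyclotomic N ℤ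
  have hmon : (cyclotomic N ℤ).Monic := cyclotomic.monic N ℤ
  have hR : ∀ w ∈ primitiveRoots N ℂ, (R.map (Int.castRingHom ℂ) - C c).eval w = 0 := by
    intro w hw
    have hw' : IsPrimitiveRoot w N := (mem_primitiveRoots hN).1 hw
    obtain ⟨a, _, ha, rfl⟩ := hζ.isPrimitiveRoot_iff.1 hw'
    have h1 := h a ha
    have h2 : aeval (ζ ^ a) R = c := by
      rw [← h1]
      conv_rhs => rw [← modByMonic_add_div P (cyclotomic N ℤ)]
      have h3 : aeval (ζ ^ a) (cyclotomic N ℤ) = 0 := by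
        rw [aeval_def, eval₂_eq_eval_map, map_cyclotomic]
        exact hw'.isRoot_cyclotomic hN
      rw [map_add, map_mul, h3, zero_mul, add_zero]
    rw [eval_sub, eval_C, ← h2, aeval_def, eval₂_eq_eval_map]
    exact sub_self _
  have hdeg : (R.map (Int.castRingHom ℂ) - C c).natDegree < (primitiveRoots N ℂ).card := by
    rw [hζ.card_primitiveRoots, natDegree_sub_C]
    refine lt_of_le_of_lt natDegree_map_le ?_
    rw [← natDegree_cyclotomic N ℤ]
    apply natDegree_modByMonic_lt _ hmon
    intro h1
    have := natDegree_cyclotomic N ℤ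
    rw [h1, natDegree_one] at this
    exact absurd this.symm (Nat.totient_pos.2 hN).ne'
  have h0 := eq_zero_of_natDegree_lt_card_of_eval_eq_zero' _ _ hR hdeg
  refine ⟨R.coeff 0, ?_⟩
  have := congrArg (fun q => q.coeff 0) h0
  simp only [coeff_sub, coeff_map, coeff_C_zero, coeff_zero] at this
  rw [sub_eq_zero] at this
  rw [← this]; simp

variable {p : ℕ} [Fact p.Prime] {F : Type*} [Field F] [Fintype F] [Algebra (ZMod p) F]

lemma traceOneSum_poly {N : ℕ} (hN : 0 < N) {ζ : ℂ} (hζ : IsPrimitiveRoot ζ N) (θ : MulChar F ℂ)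
    (hθ : θ ^ N = 1) : ∃ P : ℤ[X], ∀ a : ℕ, traceOneSum p (θ ^ a) = aeval (ζ ^ a) P := by
  have := NeZero.mk hN.ne'
  have h1 : ∀ x : F, x ≠ 0 → ∃ n : ℕ, θ x = ζ ^ n := by
    intro x hx
    obtain ⟨k, _, hk⟩ := MulChar.exists_apply_eq_pow hθ hζ hx
    exact ⟨k, hk⟩
  choose! n hn using h1
  refine ⟨∑ x ∈ Finset.univ.filter (fun x : F => Algebra.trace (ZMod p) F x = 1), X ^ (n x), ?_⟩
  intro a
  rw [map_sum]
  unfold traceOneSum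
  apply Finset.sum_congr rfl
  intro x hx
  have hx0 : x ≠ 0 := by
    rintro rfl
    simp at hx
  rw [map_pow, aeval_X, ← pow_mul, mul_comm, pow_mul, ← hn x hx0]
  rw [← hx0.isUnit.unit_spec, MulChar.pow_apply_coe]

lemma tau_poly {N d : ℕ} [NeZero d] (hN : 0 < N) (hd : d ∣ N) {ζ : ℂ} (hζ : IsPrimitiveRoot ζ N) :
    ∃ T : ℤ[X], ∀ a : ℕ, ∑ j : ZMod d, (eps d j : ℂ) * ZMod.stdAddChar (j * (a : ZMod d)) =
      aeval (ζ ^ a) T := by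
  have := NeZero.mk hN.ne'
  have h1 : (ZMod.stdAddChar (1 : ZMod d) : ℂ) ^ N = 1 := by
    rw [← AddChar.map_nsmul_eq_pow, nsmul_eq_mul, mul_one, (ZMod.natCast_eq_zero_iff N d).2 hd,
      AddChar.map_zero_eq_one]
  obtain ⟨i, _, hi⟩ := hζ.eq_pow_of_pow_eq_one h1
  refine ⟨∑ j : ZMod d, C (eps d j) * X ^ (i * j.val), ?_⟩
  intro a
  rw [map_sum]
  apply Finset.sum_congr rfl
  intro j _
  rw [map_mul (aeval (ζ ^ a)), aeval_C, map_pow, aeval_X]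
  congr 1
  rw [← pow_mul, show a * (i * j.val) = i * (j.val * a) by ring, pow_mul, hi,
    ← AddChar.map_nsmul_eq_pow]
  congr 1
  simp

lemma gauss_form {p₁ p₂ : ℕ} [NeZero (p₁ * p₂)] (hp₁ : p₁.Prime) (hp₂ : p₂.Prime) (h12 : p₁ ≠ p₂)
    (h1 : p₁ ≠ 2) (h2 : p₂ ≠ 2) (hd : (p₁ * p₂) % 4 = 3) {N : ℕ} (hN : Odd N) (hdN : p₁ * p₂ ∣ N)
    (hNp : N.Coprime (p - 1)) (θ : MulChar F ℂ) (hθ : θ ^ N = 1) (hθ1 : θ ≠ 1)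
    (hH : ∀ a : ℕ, a.Coprime N →
      (jacobiSym a (p₁ * p₂) = 1 ∧ ∃ i : ℕ, (a : ZMod N) = (p : ZMod N) ^ i) ∨
      (jacobiSym a (p₁ * p₂) = -1 ∧ ∃ i : ℕ, (a : ZMod N) = -(p : ZMod N) ^ i)) :
    ∃ B C : ℤ, 2 * gaussSum θ (psiA p F) =
      B + C * (Complex.I * Real.sqrt ((p₁ * p₂ : ℕ) : ℝ)) := by
  have hN0 : 0 < N := hN.pos
  have hp0 : (p : ℂ) ≠ 0 := by exact_mod_cast (Fact.out : p.Prime).ne_zero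
  have hdsq : Squarefree (p₁ * p₂) :=
    (Nat.squarefree_mul ((Nat.coprime_primes hp₁ hp₂).2 h12)).2 ⟨hp₁.squarefree, hp₂.squarefree⟩
  have htau := tau_shift hp₁ hp₂ h12 h1 h2
  have htau2 := tau_sq hp₁ hp₂ h12 h1 h2 hd
  generalize p₁ * p₂ = d at *
  have hζ := Complex.isPrimitiveRoot_exp N hN0.ne'
  generalize Complex.exp (2 * Real.pi * Complex.I / N) = ζ at hζ
  set G := gaussSum θ (psiA p F) with hG
  have hinv : θ⁻¹ ^ N = 1 := by rw [inv_pow, hθ, inv_one]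
  have hconj : (starRingEnd ℂ) G = gaussSum θ⁻¹ (psiA p F) := gaussSum_conj hN hθ
  -- powers
  have hpow : ∀ η : MulChar F ℂ, η ^ N = 1 → ∀ a b : ℕ, (a : ZMod N) = b → η ^ a = η ^ b := by
    intro η hη a b hab
    rw [ZMod.natCast_eq_natCast_iff] at hab
    have ho : orderOf η ∣ N := orderOf_dvd_of_pow_eq_one hη
    exact pow_eq_pow_iff_modEq.2 (hab.of_dvd ho)
  have hGpow : ∀ η : MulChar F ℂ, η ^ N = 1 → ∀ a : ℕ, a.Coprime N →
      ((eps d (a : ZMod d) = 1 ∧ gaussSum (η ^ a) (psiA p F) = gaussSum η (psiA p F)) ∨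
      (eps d (a : ZMod d) = -1 ∧ gaussSum (η ^ a) (psiA p F) = gaussSum η⁻¹ (psiA p F))) := by
    intro η hη a ha
    rw [eps_natCast]
    rcases hH a ha with ⟨e, i, hi⟩ | ⟨e, i, hi⟩
    · left
      refine ⟨e, ?_⟩
      rw [hpow η hη a (p ^ i) (by rw [hi]; push_cast; rfl), gaussSum_pow_p_pow]
    · right
      refine ⟨e, ?_⟩
      have e2 : η ^ a * η ^ (p ^ i) = 1 := by
        rw [← pow_add, hpow η hη (a + p ^ i) 0 (by push_cast; rw [hi]; ring), pow_zero]
      have e3 : η ^ a = (η⁻¹) ^ (p ^ i) := by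
        rw [inv_pow]; exact eq_inv_of_mul_eq_one_left e2
      rw [e3, gaussSum_pow_p_pow]
  have hne : ∀ η : MulChar F ℂ, η ^ N = 1 → η ≠ 1 → ∀ a : ℕ, a.Coprime N → η ^ a ≠ 1 := by
    intro η hη hη1 a ha h
    apply hη1
    have := pow_gcd_eq_one.2 ⟨h, hη⟩
    rwa [ha, pow_one] at this
  have hS : ∀ η : MulChar F ℂ, η ^ N = 1 → η ≠ 1 → ∀ a : ℕ, a.Coprime N →
      gaussSum (η ^ a) (psiA p F) = - (p : ℂ) * traceOneSum p (η ^ a) := by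
    intro η hη hη1 a ha
    apply gaussSum_eq_traceOneSum hNp _ (hne η hη hη1 a ha)
    rw [← pow_mul, mul_comm, pow_mul, hη, one_pow]
  have hS1 : ∀ η : MulChar F ℂ, η ^ N = 1 → η ≠ 1 →
      gaussSum η (psiA p F) = - (p : ℂ) * traceOneSum p η := by
    intro η hη hη1
    have := hS η hη hη1 1 (by simp)
    simpa using this
  have hinv1 : θ⁻¹ ≠ 1 := by simpa using hθ1
  have hSpow : ∀ η : MulChar F ℂ, η ^ N = 1 → η ≠ 1 → ∀ a : ℕ, a.Coprime N →
      ((eps d (a : ZMod d) = 1 ∧ traceOneSum p (η ^ a) = traceOneSum p η) ∨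
      (eps d (a : ZMod d) = -1 ∧ traceOneSum p (η ^ a) = traceOneSum p η⁻¹)) := by
    intro η hη hη1 a ha
    rcases hGpow η hη a ha with ⟨e, h⟩ | ⟨e, h⟩
    · left
      refine ⟨e, ?_⟩
      rw [hS η hη hη1 a ha, hS1 η hη hη1] at h
      exact mul_left_cancel₀ (neg_ne_zero.2 hp0) h
    · right
      refine ⟨e, ?_⟩
      rw [hS η hη hη1 a ha, hS1 η⁻¹ (by rw [inv_pow, hη, inv_one]) (by simpa using hη1)] at h
      exact mul_left_cancel₀ (neg_ne_zero.2 hp0) h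
  obtain ⟨P, hP⟩ := traceOneSum_poly (p := p) hN0 hζ θ hθ
  obtain ⟨P', hP'⟩ := traceOneSum_poly (p := p) hN0 hζ θ⁻¹ hinv
  obtain ⟨T, hT⟩ := tau_poly (d := d) hN0 hdN hζ
  set S := traceOneSum p θ
  set S' := traceOneSum p θ⁻¹
  obtain ⟨B₀, hB₀⟩ := int_of_poly hN0 hζ (P + P') (S + S') (by
    intro a ha
    rw [map_add, ← hP, ← hP']
    rcases hSpow θ hθ hθ1 a ha with ⟨e, h⟩ | ⟨e, h⟩ <;>
    rcases hSpow θ⁻¹ hinv hinv1 a ha with ⟨e', h'⟩ | ⟨e', h'⟩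
    · rw [h, h']
    · rw [e] at e'; norm_num at e'
    · rw [e] at e'; norm_num at e'
    · rw [h, h', inv_inv, add_comm])
  obtain ⟨D₀, hD₀⟩ := int_of_poly hN0 hζ ((P - P') * T) ((S - S') * tau d) (by
    intro a ha
    rw [map_mul, map_sub, ← hP, ← hP', ← hT, htau]
    rcases hSpow θ hθ hθ1 a ha with ⟨e, h⟩ | ⟨e, h⟩ <;>
    rcases hSpow θ⁻¹ hinv hinv1 a ha with ⟨e', h'⟩ | ⟨e', h'⟩
    · rw [h, h', e]; push_cast; ring
    · rw [e] at e'; norm_num at e'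
    · rw [e] at e'; norm_num at e'
    · rw [h, h', inv_inv, e]; push_cast; ring)
  have hGS : G = - (p : ℂ) * S := hS1 θ hθ hθ1
  have hGS' : (starRingEnd ℂ) G = - (p : ℂ) * S' := by rw [hconj]; exact hS1 θ⁻¹ hinv hinv1
  have hnorm : G * (starRingEnd ℂ) G = Fintype.card F := gaussSum_mul_conj hθ1
  have hD2 : ((-(p : ℤ) * D₀) ^ 2 : ℤ) = d * (4 * Fintype.card F - (-(p : ℤ) * B₀) ^ 2) := by
    have : (((-(p : ℤ) * D₀) ^ 2 : ℤ) : ℂ) = ((d * (4 * Fintype.card F - (-(p : ℤ) * B₀) ^ 2) : ℤ) : ℂ) := by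
      push_cast
      rw [← hB₀, ← hD₀, ← hnorm, hGS', hGS, mul_pow, mul_pow, htau2]
      ring
    exact_mod_cast this
  have hdvd : (d : ℤ) ∣ -(p : ℤ) * D₀ := by
    have h3 : (d : ℤ) ∣ (-(p : ℤ) * D₀) ^ 2 := ⟨_, hD2⟩
    have h4 : Squarefree (d : ℤ) := Int.squarefree_natCast.2 hdsq
    exact (h4.dvd_pow_iff_dvd two_ne_zero).1 h3
  obtain ⟨C', hC'⟩ := hdvd
  have hC'' : -(p : ℂ) * D₀ = d * C' := by exact_mod_cast hC'
  have hd0 : (d : ℂ) ≠ 0 := by exact_mod_cast NeZero.ne d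
  -- G - conj G = - C' tau
  have hdiff : G - (starRingEnd ℂ) G = - C' * tau d := by
    have h5 : (d : ℂ) * (G - (starRingEnd ℂ) G) = d * (- C' * tau d) := by
      rw [hGS', hGS]
      have : (d : ℂ) = - tau d ^ 2 := by rw [htau2]; ring
      calc _ = -tau d * (-(p : ℂ) * ((S - S') * tau d)) := by rw [this]; ring
        _ = _ := by rw [hD₀, hC'']; ring
    exact mul_left_cancel₀ hd0 h5
  have hsqrt : (Complex.I * (Real.sqrt (d : ℝ) : ℂ)) ^ 2 = - d := by
    rw [mul_pow, Complex.I_sq, ← Complex.ofReal_pow, Real.sq_sqrt (by positivity)]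
    push_cast; ring
  have hsum : G + (starRingEnd ℂ) G = -(p : ℂ) * B₀ := by
    rw [← hB₀, hGS', hGS]; ring
  rcases sq_eq_sq_iff_eq_or_eq_neg.1 (htau2.trans hsqrt.symm) with h6 | h6
  · refine ⟨-p * B₀, -C', ?_⟩
    rw [h6] at hdiff
    push_cast
    linear_combination hdiff + hsum
  · refine ⟨-p * B₀, C', ?_⟩
    rw [h6] at hdiff
    push_cast
    linear_combination hdiff + hsum

end Rationality

section NT

lemma modpow_lift {ℓ p e : ℕ} {m : ℕ} (hm : 1 ≤ m) {c : ℤ} (hc : (p : ZMod ℓ) ^ e = (c : ZMod ℓ)) :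
    (p : ZMod (ℓ ^ m)) ^ (e * ℓ ^ (m - 1)) = (c : ZMod (ℓ ^ m)) ^ (ℓ ^ (m - 1)) := by
  have h1 : (ℓ : ℤ) ∣ (p : ℤ) ^ e - c := by
    rw [← ZMod.intCast_zmod_eq_zero_iff_dvd _ ℓ]
    push_cast
    rw [hc, sub_self]
  have h2 := dvd_sub_pow_of_dvd_sub h1 (m - 1)
  rw [Nat.sub_add_cancel hm] at h2
  have h3 : (((ℓ ^ m : ℕ) : ℤ)) ∣ ((p : ℤ) ^ e) ^ ℓ ^ (m - 1) - c ^ ℓ ^ (m - 1) := by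
    push_cast; exact h2
  rw [← ZMod.intCast_zmod_eq_zero_iff_dvd] at h3
  push_cast at h3
  rw [pow_mul]
  exact sub_eq_zero.1 h3

lemma prim_root_facts {ℓ m p : ℕ} (hℓ : ℓ.Prime) (hℓ2 : ℓ ≠ 2) (hm : 1 ≤ m)
    (hord : orderOf ((p : ZMod (ℓ ^ m))) = Nat.totient (ℓ ^ m)) :
    (p : ZMod ℓ) ^ ((ℓ - 1) / 2) = -1 ∧ jacobiSym p ℓ = -1 ∧
    (p : ZMod (ℓ ^ m)) ^ ((ℓ - 1) / 2 * ℓ ^ (m - 1)) = -1 ∧ ¬ ℓ ∣ p := by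
  have := Fact.mk hℓ
  have hodd : Odd ℓ := hℓ.odd_of_ne_two hℓ2
  have htot : Nat.totient (ℓ ^ m) = ℓ ^ (m - 1) * (ℓ - 1) := Nat.totient_prime_pow hℓ (by omega)
  have hℓ3 : 3 ≤ ℓ := by have := hℓ.two_le; omega
  have htpos : 0 < Nat.totient (ℓ ^ m) := Nat.totient_pos.2 (pow_pos hℓ.pos m)
  have hnd : ¬ ℓ ∣ p := by
    intro h
    have hfin : IsOfFinOrder (p : ZMod (ℓ ^ m)) := orderOf_pos_iff.1 (by rw [hord]; exact htpos)
    have hu : IsUnit (p : ZMod (ℓ ^ m)) := hfin.isUnit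
    rw [ZMod.isUnit_iff_coprime, Nat.coprime_pow_right_iff (by omega), Nat.coprime_comm,
      hℓ.coprime_iff_not_dvd] at hu
    exact hu h
  have hp0 : (p : ZMod ℓ) ≠ 0 := by rwa [Ne, ZMod.natCast_eq_zero_iff]
  have hpos : 0 < (ℓ - 1) / 2 := by omega
  have hhalf : (ℓ - 1) / 2 * 2 = ℓ - 1 := by
    obtain ⟨k, hk⟩ := hodd; omega
  have h1 : (p : ZMod ℓ) ^ ((ℓ - 1) / 2) = -1 := by
    have h2 : ((p : ZMod ℓ) ^ ((ℓ - 1) / 2)) ^ 2 = 1 := by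
      rw [← pow_mul, hhalf, ZMod.pow_card_sub_one_eq_one hp0]
    rcases sq_eq_one_iff.1 h2 with h | h
    · exfalso
      have h3 := modpow_lift (c := 1) hm (by simpa using h)
      simp only [Int.cast_one, one_pow] at h3
      have h4 := orderOf_dvd_of_pow_eq_one h3
      rw [hord, htot] at h4
      have h5 := Nat.le_of_dvd (Nat.mul_pos hpos (pow_pos hℓ.pos _)) h4
      have : 0 < ℓ ^ (m - 1) := pow_pos hℓ.pos _
      nlinarith
    · exact h
  refine ⟨h1, ?_, ?_, hnd⟩
  · rw [← jacobiSym.legendreSym.to_jacobiSym]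
    have h2 := legendreSym.eq_pow ℓ (p : ℤ)
    have h3 : ℓ / 2 = (ℓ - 1) / 2 := by obtain ⟨k, hk⟩ := hodd; omega
    rw [h3] at h2
    push_cast at h2
    rw [h1] at h2
    rcases legendreSym.eq_one_or_neg_one ℓ (a := (p : ℤ)) (by exact_mod_cast hp0) with h | h
    · rw [h] at h2
      exfalso
      have : Fact (2 < ℓ) := ⟨by omega⟩
      push_cast at h2
      exact ZMod.neg_one_ne_one h2.symm
    · exact h
  · have h3 := modpow_lift (c := -1) hm (by simpa using h1)
    rw [h3]
    push_cast
    exact (hodd.pow).neg_one_pow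

lemma index_two_facts {p₁ p₂ m n N p : ℕ} (hp₁ : p₁.Prime) (hp₂ : p₂.Prime)
    (hm : 1 ≤ m) (hn : 1 ≤ n) (hd : (p₁ * p₂) % 4 = 3)
    (hN : N = p₁ ^ m * p₂ ^ n) (hj : jacobiSym p (p₁ * p₂) = 1) (u : (ZMod N)ˣ)
    (hu : (u : ZMod N) = (p : ZMod N)) (hidx : (Subgroup.zpowers u).index = 2) :
    ∀ a : ℕ, a.Coprime N →
      (jacobiSym a (p₁ * p₂) = 1 ∧ ∃ i : ℕ, (a : ZMod N) = (p : ZMod N) ^ i) ∨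
      (jacobiSym a (p₁ * p₂) = -1 ∧ ∃ i : ℕ, (a : ZMod N) = -(p : ZMod N) ^ i) := by
  have hN0 : N ≠ 0 := by
    rw [hN]; exact mul_ne_zero (pow_ne_zero _ hp₁.ne_zero) (pow_ne_zero _ hp₂.ne_zero)
  have := NeZero.mk hN0
  have : NeZero (p₁ * p₂) := ⟨mul_ne_zero hp₁.ne_zero hp₂.ne_zero⟩
  have hdN : p₁ * p₂ ∣ N := by
    rw [hN]; exact mul_dvd_mul (dvd_pow_self _ (by omega)) (dvd_pow_self _ (by omega))
  generalize p₁ * p₂ = d at *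
  have hcast : ∀ x y : ℕ, (x : ZMod N) = (y : ZMod N) → jacobiSym x d = jacobiSym y d := by
    intro x y hxy
    rw [← eps_natCast, ← eps_natCast]
    congr 1
    have := congrArg (ZMod.castHom hdN (ZMod d)) hxy
    simpa using this
  have hmem : ∀ g : (ZMod N)ˣ, g ∈ Subgroup.zpowers u → ∃ i : ℕ, (g : ZMod N) = (p : ZMod N) ^ i := by
    intro g hg
    rw [← mem_powers_iff_mem_zpowers] at hg
    obtain ⟨i, rfl⟩ := hg
    exact ⟨i, by push_cast; rw [hu]⟩
  have hpj : ∀ i : ℕ, jacobiSym ((p ^ i : ℕ) : ℤ) d = 1 := by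
    intro i; push_cast; rw [jacobiSym.pow_left, hj, one_pow]
  have hneg : ∀ x i : ℕ, (x : ZMod N) = -(p : ZMod N) ^ i → jacobiSym x d = -1 := by
    intro x i hx
    have h1 : eps d (x : ZMod d) = eps d (-((p ^ i : ℕ) : ZMod d)) := by
      congr 1
      have := congrArg (ZMod.castHom hdN (ZMod d)) hx
      rw [map_neg, map_pow, map_natCast, map_natCast] at this
      rw [this]; push_cast; rfl
    rw [eps_natCast, eps_neg hd, eps_natCast, hpj] at h1
    exact h1
  have hm1 : (-1 : (ZMod N)ˣ) ∉ Subgroup.zpowers u := by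
    intro h
    obtain ⟨i, hi⟩ := hmem _ h
    have h1 : ((p ^ i : ℕ) : ZMod N) = -(p : ZMod N) ^ 0 := by
      push_cast; rw [← hi]; simp
    have h2 := hneg _ _ h1
    rw [hpj] at h2
    norm_num at h2
  intro a ha
  let g := ZMod.unitOfCoprime a ha
  have hg : (g : ZMod N) = a := ZMod.coe_unitOfCoprime a ha
  by_cases hgm : g ∈ Subgroup.zpowers u
  · left
    obtain ⟨i, hi⟩ := hmem g hgm
    rw [hg] at hi
    refine ⟨?_, i, hi⟩
    rw [hcast a (p ^ i) (by rw [hi]; push_cast; rfl), hpj]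
  · right
    have h2 : -1 * g ∈ Subgroup.zpowers u := by
      rw [Subgroup.mul_mem_iff_of_index_two hidx]
      tauto
    obtain ⟨i, hi⟩ := hmem _ h2
    have h3 : (a : ZMod N) = -(p : ZMod N) ^ i := by
      rw [← hi, ← hg]; simp
    exact ⟨hneg a i h3, i, h3⟩

end NT

section Val

lemma mul_lt_one_val {Γ : Type*} [LinearOrderedCommGroupWithZero Γ] {a b : Γ} (ha : a ≤ 1) (hb : b < 1) :
    a * b < 1 := lt_of_le_of_lt (mul_le_of_le_one_left' ha) hb

lemma exists_valSubring {ℓ : ℕ} (hℓ : ℓ.Prime) : ∃ A : ValuationSubring ℂ, A.valuation (ℓ : ℂ) < 1 := by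
  let I : Ideal (⊥ : Subring ℂ) := Ideal.span {(ℓ : (⊥ : Subring ℂ))}
  have hI : I ≠ ⊤ := by
    intro h
    rw [Ideal.eq_top_iff_one, Ideal.mem_span_singleton] at h
    obtain ⟨x, hx⟩ := h
    obtain ⟨n, hn⟩ := Subring.mem_bot.1 x.2
    have h1 := congrArg (Subtype.val) hx
    push_cast at h1
    rw [← hn] at h1
    have h2 : (1 : ℤ) = ℓ * n := by exact_mod_cast h1
    have h3 : (ℓ : ℤ) ∣ 1 := ⟨n, h2⟩
    have h4 : ℓ ∣ 1 := by exact_mod_cast h3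
    exact hℓ.one_lt.ne' (Nat.dvd_one.1 h4)
  obtain ⟨B, _, hB⟩ := Ideal.image_subset_nonunits_valuationSubring I hI
  refine ⟨B, ?_⟩
  rw [← ValuationSubring.mem_nonunits_iff]
  apply hB
  exact ⟨(ℓ : (⊥ : Subring ℂ)), Ideal.subset_span rfl, by simp⟩

lemma mem_of_integral (A : ValuationSubring ℂ) {z : ℂ} (hz : IsIntegral ℤ z) : z ∈ A := by
  have h1 : IsIntegral A z := hz.tower_top
  obtain ⟨y, hy⟩ := IsIntegrallyClosed.algebraMap_eq_of_integral h1
  rw [← hy]; exact y.2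

lemma val_le_one_of_integral (A : ValuationSubring ℂ) {z : ℂ} (hz : IsIntegral ℤ z) :
    A.valuation z ≤ 1 := (A.valuation_le_one_iff z).2 (mem_of_integral A hz)

lemma residue_charP {ℓ : ℕ} (hℓ : ℓ.Prime) {A : ValuationSubring ℂ} (hA : A.valuation (ℓ : ℂ) < 1) :
    CharP (IsLocalRing.ResidueField A) ℓ := by
  rw [CharP.charP_iff_prime_eq_zero hℓ]
  have h1 : ((ℓ : A) : A) ∈ IsLocalRing.maximalIdeal A := by
    rw [ValuationSubring.valuation_lt_one_iff]
    simpa using hA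
  have := (IsLocalRing.residue_eq_zero_iff _).2 h1
  simpa using this

lemma residue_eq_iff {A : ValuationSubring ℂ} (x y : A) :
    IsLocalRing.residue A x = IsLocalRing.residue A y ↔ A.valuation ((x : ℂ) - y) < 1 := by
  rw [← sub_eq_zero, ← map_sub, IsLocalRing.residue_eq_zero_iff, ValuationSubring.valuation_lt_one_iff]
  simp

lemma root_of_unity_integral {z : ℂ} {n : ℕ} (hn : 0 < n) (hz : z ^ n = 1) : IsIntegral ℤ z := by
  apply IsIntegral.of_pow hn
  rw [hz]; exact isIntegral_one

lemma val_root_sub_one_lt {ℓ : ℕ} (hℓ : ℓ.Prime) {A : ValuationSubring ℂ}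
    (hA : A.valuation (ℓ : ℂ) < 1) {z : ℂ} {n : ℕ} (hz : z ^ (ℓ ^ n) = 1) :
    A.valuation (z - 1) < 1 := by
  have := residue_charP hℓ hA
  have := Fact.mk hℓ
  have hzA : z ∈ A := mem_of_integral A (root_of_unity_integral (pow_pos hℓ.pos n) hz)
  have h1 : (⟨z, hzA⟩ : A) ^ (ℓ ^ n) = 1 := Subtype.ext (by simpa using hz)
  have h2 : (IsLocalRing.residue A ⟨z, hzA⟩) ^ (ℓ ^ n * 1) = 1 := by
    rw [mul_one, ← map_pow, h1, map_one]
  rw [ExpChar.pow_prime_pow_mul_eq_one_iff, pow_one, ← map_one (IsLocalRing.residue A), residue_eq_iff] at h2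
  simpa using h2

lemma int_val_lt_one_iff {ℓ : ℕ} (hℓ : ℓ.Prime) {A : ValuationSubring ℂ}
    (hA : A.valuation (ℓ : ℂ) < 1) {z : ℤ} (hz : A.valuation (z : ℂ) < 1) : (ℓ : ℤ) ∣ z := by
  by_contra h
  have hc : IsCoprime (ℓ : ℤ) z := by
    rw [(Nat.prime_iff_prime_int.1 hℓ).coprime_iff_not_dvd]; exact h
  obtain ⟨a, b, hab⟩ := hc
  have h1 : (a : ℂ) * ℓ + b * z = 1 := by exact_mod_cast hab
  have hi : ∀ c : ℤ, A.valuation (c : ℂ) ≤ 1 := fun c =>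
    val_le_one_of_integral A (isIntegral_algebraMap (R := ℤ) (x := c))
  have h2 : A.valuation ((a : ℂ) * ℓ + b * z) < 1 := by
    apply Valuation.map_add_lt
    · rw [map_mul]; exact mul_lt_one_val (hi a) hA
    · rw [map_mul]; exact mul_lt_one_val (hi b) hz
  rw [h1, map_one] at h2
  exact lt_irrefl _ h2

variable {p : ℕ} [Fact p.Prime] {F : Type*} [Field F] [Fintype F] [Algebra (ZMod p) F]

lemma mulChar_integral (χ : MulChar F ℂ) (x : F) : IsIntegral ℤ (χ x) := by
  by_cases hx : x = 0
  · rw [hx, MulChar.map_zero]; exact isIntegral_zero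
  · have h1 : x ^ (Fintype.card F - 1) = 1 := FiniteField.pow_card_sub_one_eq_one x hx
    apply root_of_unity_integral (n := Fintype.card F - 1)
    · have := Fintype.one_lt_card (α := F); omega
    · rw [← map_pow, h1, map_one]

lemma stdAddChar_integral (t : ZMod p) : IsIntegral ℤ (ZMod.stdAddChar t : ℂ) := by
  apply root_of_unity_integral (n := p) (Fact.out : p.Prime).pos
  rw [← AddChar.map_nsmul_eq_pow]; simp

lemma gaussSum_integral (χ : MulChar F ℂ) : IsIntegral ℤ (gaussSum χ (psiA p F)) := by
  unfold gaussSum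
  exact IsIntegral.sum _ (fun x _ => (mulChar_integral χ x).mul (stdAddChar_integral _))

lemma jacobiSum_integral (χ φ : MulChar F ℂ) : IsIntegral ℤ (jacobiSum χ φ) := by
  unfold jacobiSum
  exact IsIntegral.sum _ (fun x _ => (mulChar_integral χ x).mul (mulChar_integral φ _))

lemma gaussSum_one_val : gaussSum (1 : MulChar F ℂ) (psiA p F) = -1 :=
  gaussSum_one_left psiA_ne_one

lemma val_gaussSum_mul (A : ValuationSubring ℂ) (χ φ : MulChar F ℂ) :
    A.valuation (gaussSum χ (psiA p F)) * A.valuation (gaussSum φ (psiA p F)) ≤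
      A.valuation (gaussSum (χ * φ) (psiA p F)) := by
  by_cases h : χ * φ = 1
  · rw [h, gaussSum_one_val, Valuation.map_neg, map_one]
    exact mul_le_one' (val_le_one_of_integral A (gaussSum_integral _))
      (val_le_one_of_integral A (gaussSum_integral _))
  · rw [← map_mul, ← jacobiSum_mul_nontrivial h, map_mul]
    exact mul_le_of_le_one_right' (val_le_one_of_integral A (jacobiSum_integral _ _))

lemma val_gaussSum_pow (A : ValuationSubring ℂ) (χ : MulChar F ℂ) (n : ℕ) :
    A.valuation (gaussSum χ (psiA p F)) ^ n ≤ A.valuation (gaussSum (χ ^ n) (psiA p F)) := by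
  induction n with
  | zero => rw [pow_zero, pow_zero, gaussSum_one_val, Valuation.map_neg, map_one]
  | succ n ih =>
    rw [pow_succ, pow_succ]
    exact (mul_le_mul_left ih _).trans (val_gaussSum_mul A _ _)

/-- Characters whose quotient has `ℓ`-power order have congruent Gauss sums. -/
lemma val_gaussSum_sub_lt {ℓ : ℕ} (hℓ : ℓ.Prime) {A : ValuationSubring ℂ}
    (hA : A.valuation (ℓ : ℂ) < 1) (η θ : MulChar F ℂ) {n : ℕ} (hθ : θ ^ (ℓ ^ n) = 1) :
    A.valuation (gaussSum (η * θ) (psiA p F) - gaussSum η (psiA p F)) < 1 := by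
  unfold gaussSum
  rw [← Finset.sum_sub_distrib]
  apply Valuation.map_sum_lt _ one_ne_zero
  intro x _
  by_cases hx : x = 0
  · rw [hx, MulChar.map_zero, MulChar.map_zero]; simp
  · have e : (η * θ) x * psiA p F x - η x * psiA p F x = (η x * psiA p F x) * (θ x - 1) := by
      rw [MulChar.mul_apply]; ring
    rw [e, map_mul]
    apply mul_lt_one_val
    · exact val_le_one_of_integral A ((mulChar_integral η x).mul (stdAddChar_integral _))
    · apply val_root_sub_one_lt hℓ hA (n := n)
      rw [← MulChar.pow_apply' _ (pow_pos hℓ.pos n).ne', hθ, MulChar.one_apply (isUnit_iff_ne_zero.2 hx)]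

end Val

section Teich

variable {p : ℕ} [Fact p.Prime] {F : Type*} [Field F] [Fintype F] [Algebra (ZMod p) F]

/-- Existence of the Teichmüller character for a place of `ℂ` above `p`. -/
lemma exists_teich {A : ValuationSubring ℂ} (hA : A.valuation (p : ℂ) < 1) :
    ∃ (ι : F →+* IsLocalRing.ResidueField A) (ω : MulChar F ℂ),
      (∀ x, ∃ hx : ω x ∈ A, IsLocalRing.residue A ⟨ω x, hx⟩ = ι x) ∧
      orderOf ω = Fintype.card F - 1 ∧
      ∀ χ : MulChar F ℂ, ∃ a : ℕ, χ = ω ^ a := by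
  have hp : p.Prime := Fact.out
  have hk := residue_charP hp hA
  have hq : 1 < Fintype.card F := Fintype.one_lt_card
  set Q := Fintype.card F - 1 with hQ
  have hQ0 : 0 < Q := by omega
  have : NeZero Q := ⟨hQ0.ne'⟩
  let ζ := Complex.exp (2 * Real.pi * Complex.I / Q)
  have hζ : IsPrimitiveRoot ζ Q := Complex.isPrimitiveRoot_exp Q hQ0.ne'
  have hζA : ζ ∈ A := mem_of_integral A (root_of_unity_integral hQ0 hζ.pow_eq_one)
  have hζ' : IsPrimitiveRoot (⟨ζ, hζA⟩ : A) Q :=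
    IsPrimitiveRoot.of_map_of_injective (f := A.subtype) hζ Subtype.val_injective
  have hprod := Polynomial.X_pow_sub_one_eq_prod hQ0 hζ'
  let : Algebra (ZMod p) (IsLocalRing.ResidueField A) := ZMod.algebra _ p
  have hsplA : (Polynomial.X ^ Fintype.card F - Polynomial.X : Polynomial A).Splits := by
    have e : (Polynomial.X ^ Fintype.card F - Polynomial.X : Polynomial A) =
        (Polynomial.X - Polynomial.C 0) * (Polynomial.X ^ Q - 1) := by
      have : Fintype.card F = Q + 1 := by omega
      rw [this, pow_succ, Polynomial.C_0]; ring
    rw [e, hprod]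
    exact (Polynomial.Splits.X_sub_C _).mul (Polynomial.Splits.prod (fun i _ => Polynomial.Splits.X_sub_C i))
  have hspl : (Polynomial.map (algebraMap (ZMod p) (IsLocalRing.ResidueField A))
      (Polynomial.X ^ Fintype.card F - Polynomial.X)).Splits := by
    have := hsplA.map (IsLocalRing.residue A)
    simpa using this
  have inst := FiniteField.isSplittingField_sub F (ZMod p)
  let ι' := Polynomial.IsSplittingField.lift F (Polynomial.X ^ Fintype.card F - Polynomial.X : Polynomial (ZMod p)) hspl
  let ι : F →+* IsLocalRing.ResidueField A := ι'.toRingHom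
  obtain ⟨g, hg⟩ := IsCyclic.exists_generator (α := Fˣ)
  have hgQ : (g : F) ^ Q = 1 := FiniteField.pow_card_sub_one_eq_one (g : F) g.ne_zero
  have hroot : ∃ z : A, z ^ Q = 1 ∧ IsLocalRing.residue A z = ι g := by
    have h1 := congrArg (fun P => Polynomial.eval (ι g) (Polynomial.map (IsLocalRing.residue A) P)) hprod
    simp only [Polynomial.map_sub, Polynomial.map_pow, Polynomial.map_X, Polynomial.map_one,
      Polynomial.eval_sub, Polynomial.eval_pow, Polynomial.eval_X, Polynomial.eval_one,
      Polynomial.map_prod, Polynomial.eval_prod, Polynomial.map_C, Polynomial.eval_C] at h1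
    rw [← map_pow, hgQ, map_one, sub_self] at h1
    obtain ⟨z, hz, hz0⟩ := Finset.prod_eq_zero_iff.1 h1.symm
    exact ⟨z, (Polynomial.mem_nthRootsFinset hQ0 1).1 hz, (sub_eq_zero.1 hz0).symm⟩
  obtain ⟨z, hzQ, hz⟩ := hroot
  have hzQ' : (z : ℂ) ^ Q = 1 := by rw [← SubmonoidClass.coe_pow, hzQ]; rfl
  have hcu : Fintype.card Fˣ = Q := Fintype.card_units F
  let zu : ℂˣ := Units.mk0 (z : ℂ) (by
    intro h0; rw [h0, zero_pow hQ0.ne'] at hzQ'; exact zero_ne_one hzQ')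
  have hzu : zu ∈ rootsOfUnity (Fintype.card Fˣ) ℂ := by
    rw [mem_rootsOfUnity, hcu]; ext; simpa [zu] using hzQ'
  let ω : MulChar F ℂ := MulChar.ofRootOfUnity hzu hg
  have hωg : ω g = z := MulChar.ofRootOfUnity_spec hzu hg
  have hogen : orderOf g = Q := by
    rw [orderOf_eq_card_of_forall_mem_zpowers hg, Nat.card_eq_fintype_card, hcu]
  have hres : ∀ i : ℕ, IsLocalRing.residue A (z ^ i) = ι (g ^ i : F) := by
    intro i; rw [map_pow, map_pow, hz]
  have hzprim : IsPrimitiveRoot (z : ℂ) Q := by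
    refine ⟨hzQ', fun l hl => ?_⟩
    have h1 : z ^ l = 1 := Subtype.ext (by simpa using hl)
    have h2 := hres l
    rw [h1, map_one, ← map_one ι] at h2
    have h3 : (g : F) ^ l = 1 := (ι.injective h2).symm
    rw [← hogen]
    apply orderOf_dvd_of_pow_eq_one
    ext; simpa using h3
  refine ⟨ι, ω, ?_, ?_, ?_⟩
  · intro x
    by_cases hx : x = 0
    · subst hx
      have h0 : ω 0 = 0 := MulChar.map_zero _
      refine ⟨by rw [h0]; exact A.zero_mem, ?_⟩
      rw [map_zero ι, IsLocalRing.residue_eq_zero_iff]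
      have : (⟨ω 0, by rw [h0]; exact A.zero_mem⟩ : A) = 0 := Subtype.ext h0
      rw [this]; exact Ideal.zero_mem _
    · obtain ⟨i, hi⟩ := (Submonoid.mem_powers_iff _ _).1 ((mem_powers_iff_mem_zpowers).2 (hg (Units.mk0 x hx)))
      have hxg : x = (g : F) ^ i := by
        have := congrArg Units.val hi; simpa using this.symm
      have hωx : ω x = ((z ^ i : A) : ℂ) := by rw [hxg, map_pow, hωg]; simp
      refine ⟨by rw [hωx]; exact (z ^ i).2, ?_⟩
      have : (⟨ω x, by rw [hωx]; exact (z ^ i).2⟩ : A) = z ^ i := Subtype.ext hωx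
      rw [this, hres, hxg]
  · apply Nat.dvd_antisymm
    · apply orderOf_dvd_of_pow_eq_one
      rw [MulChar.eq_iff hg, MulChar.pow_apply_coe, hωg, hzQ', MulChar.one_apply_coe]
    · apply hzprim.dvd_of_pow_eq_one
      rw [← hωg, ← MulChar.pow_apply_coe, pow_orderOf_eq_one, MulChar.one_apply_coe]
  · intro χ
    have h1 : χ g ^ Q = 1 := by rw [← map_pow, hgQ, map_one]
    obtain ⟨a, _, ha⟩ := hzprim.eq_pow_of_pow_eq_one h1
    refine ⟨a, ?_⟩
    rw [MulChar.eq_iff hg, MulChar.pow_apply_coe, hωg, ha]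

lemma stdAddChar_primitive : IsPrimitiveRoot (ZMod.stdAddChar (1 : ZMod p) : ℂ) p := by
  have hp : p.Prime := Fact.out
  rw [IsPrimitiveRoot.iff_def]
  refine ⟨by rw [← AddChar.map_nsmul_eq_pow]; simp, fun l hl => ?_⟩
  rw [← AddChar.map_nsmul_eq_pow, nsmul_eq_mul, mul_one] at hl
  have h0 : ((l : ZMod p)) = 0 := by
    apply ZMod.injective_stdAddChar
    rw [hl, AddChar.map_zero_eq_one]
  exact (ZMod.natCast_eq_zero_iff _ _).1 h0

lemma val_p_le (A : ValuationSubring ℂ) :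
    A.valuation (p : ℂ) ≤ A.valuation ((ZMod.stdAddChar (1 : ZMod p) : ℂ) - 1) ^ (p - 1) := by
  have hp : p.Prime := Fact.out
  obtain ⟨n, rfl⟩ : ∃ n, p = n + 1 := ⟨p - 1, by have := hp.pos; omega⟩
  have h := stdAddChar_primitive (p := n + 1)
  set z : ℂ := ZMod.stdAddChar (1 : ZMod (n + 1)) with hz
  have h1 := h.prod_one_sub_pow_eq_order
  push_cast
  rw [← h1, map_prod]
  calc _ ≤ ∏ k ∈ Finset.range n, A.valuation (z - 1) := by
        apply Finset.prod_le_prod'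
        intro k _
        have e : 1 - z ^ (k + 1) = -((z - 1) * ∑ i ∈ Finset.range (k + 1), z ^ i) := by
          rw [mul_geom_sum]; ring
        rw [e, Valuation.map_neg, map_mul]
        apply mul_le_of_le_one_right'
        apply val_le_one_of_integral
        exact IsIntegral.sum _ (fun i _ => (stdAddChar_integral _).pow i)
    _ = _ := by simp

/-- A power sum computation for the trace. -/
lemma sum_inv_mul_trace : ∑ x : F, x⁻¹ * algebraMap (ZMod p) F (Algebra.trace (ZMod p) F x) = -1 := by
  have hp : p.Prime := Fact.out
  have hcard : Fintype.card F = p ^ Module.finrank (ZMod p) F := by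
    rw [Module.card_eq_pow_finrank (K := ZMod p) (V := F), ZMod.card]
  have hr : 0 < Module.finrank (ZMod p) F := Module.finrank_pos
  have h0 : ∑ x : F, x⁻¹ * algebraMap (ZMod p) F (Algebra.trace (ZMod p) F x) =
      ∑ x : Fˣ, (x : F)⁻¹ * algebraMap (ZMod p) F (Algebra.trace (ZMod p) F x) := by
    rw [← Finset.sum_subset (Finset.subset_univ (Finset.univ.image (fun x : Fˣ => (x : F))))]
    · rw [Finset.sum_image (fun a _ b _ h => Units.ext h)]
    · intro x _ hx
      have hx0 : x = 0 := by
        by_contra hne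
        exact hx (Finset.mem_image.2 ⟨Units.mk0 x hne, Finset.mem_univ _, rfl⟩)
      simp [hx0]
  rw [h0]
  simp_rw [FiniteField.algebraMap_trace_eq_sum_pow, Finset.mul_sum, Nat.card_zmod]
  rw [Finset.sum_comm]
  have h1 : ∀ i ∈ Finset.range (Module.finrank (ZMod p) F),
      ∑ x : Fˣ, (x : F)⁻¹ * (x : F) ^ p ^ i = if i = 0 then -1 else 0 := by
    intro i hi
    have h2 : ∀ x : Fˣ, (x : F)⁻¹ * (x : F) ^ p ^ i = (x : F) ^ (p ^ i - 1) := by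
      intro x
      have : p ^ i = (p ^ i - 1) + 1 := by have := pow_pos hp.pos i; omega
      rw [this, pow_succ, Nat.add_sub_cancel]
      field_simp
    simp_rw [h2]
    rw [FiniteField.sum_pow_units]
    by_cases hi0 : i = 0
    · simp [hi0]
    · rw [if_neg hi0, if_neg]
      intro hd
      have h3 : p ^ i < p ^ Module.finrank (ZMod p) F := Nat.pow_lt_pow_right hp.one_lt (Finset.mem_range.1 hi)
      have h4 : 1 < p ^ i := Nat.one_lt_pow hi0 hp.one_lt
      have h5 := Nat.le_of_dvd (by omega) hd
      rw [hcard] at h5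
      omega
  rw [Finset.sum_congr rfl h1]
  have hr0 := hr.ne'
  simp [hr0]

/-- The exact valuation of the Gauss sum of the inverse Teichmüller character. -/
lemma val_gaussSum_teich {A : ValuationSubring ℂ} (hA : A.valuation (p : ℂ) < 1)
    {ι : F →+* IsLocalRing.ResidueField A} {ω : MulChar F ℂ}
    (hω : ∀ x, ∃ hx : ω x ∈ A, IsLocalRing.residue A ⟨ω x, hx⟩ = ι x) (hω1 : ω ≠ 1) :
    A.valuation (gaussSum ω⁻¹ (psiA p F)) = A.valuation ((ZMod.stdAddChar (1 : ZMod p) : ℂ) - 1) := by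
  have hp : p.Prime := Fact.out
  have hk := residue_charP hp hA
  choose hωA hωr using hω
  set z : ℂ := ZMod.stdAddChar (1 : ZMod p) with hz
  have hzA : z ∈ A := mem_of_integral A (stdAddChar_integral _)
  let zA : A := ⟨z, hzA⟩
  have hzr : IsLocalRing.residue A zA = 1 := by
    rw [← map_one (IsLocalRing.residue A), residue_eq_iff]
    have : A.valuation (z - 1) < 1 :=
      val_root_sub_one_lt hp hA (n := 1) (by rw [pow_one]; exact stdAddChar_primitive.pow_eq_one)
    simpa using this
  let t : F → ℕ := fun x => (Algebra.trace (ZMod p) F x).val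
  let W : F → A := fun x => ⟨ω x⁻¹, hωA x⁻¹⟩
  let Q : A := ∑ x : F, W x * ∑ i ∈ Finset.range (t x), zA ^ i
  have hQ : IsLocalRing.residue A Q = -1 := by
    have h1 : IsLocalRing.residue A Q =
        ι (∑ x : F, x⁻¹ * algebraMap (ZMod p) F (Algebra.trace (ZMod p) F x)) := by
      rw [map_sum, map_sum]
      apply Finset.sum_congr rfl
      intro x _
      have e : algebraMap (ZMod p) F (Algebra.trace (ZMod p) F x) = (t x : F) := by
        have : ((t x : ZMod p)) = Algebra.trace (ZMod p) F x := ZMod.natCast_zmod_val _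
        rw [← this, map_natCast]
      rw [map_mul, map_mul, hωr, e, map_natCast, map_sum]
      simp [hzr]
    rw [h1, sum_inv_mul_trace, map_neg, map_one]
  have hQv : A.valuation (Q : ℂ) = 1 := by
    rw [← ValuationSubring.valuation_eq_one_iff]
    by_contra hnu
    have := (IsLocalRing.residue_eq_zero_iff Q).2 ((IsLocalRing.mem_maximalIdeal _).2 hnu)
    rw [hQ] at this
    exact one_ne_zero (neg_eq_zero.1 this)
  have hG : gaussSum ω⁻¹ (psiA p F) = (z - 1) * Q := by
    have hs : ∑ x : F, ω⁻¹ x = 0 := MulChar.sum_eq_zero_of_ne_one (inv_ne_one.2 hω1)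
    have h1 : gaussSum ω⁻¹ (psiA p F) = ∑ x : F, ω⁻¹ x * (psiA p F x - 1) := by
      unfold gaussSum
      simp_rw [mul_sub, mul_one]
      rw [Finset.sum_sub_distrib, hs, sub_zero]
    rw [h1]
    have hc : ((Q : A) : ℂ) = ∑ x : F, ω x⁻¹ * ∑ i ∈ Finset.range (t x), z ^ i := by
      simp only [Q, W, zA]
      push_cast
      rfl
    rw [hc, Finset.mul_sum]
    apply Finset.sum_congr rfl
    intro x _
    have hx : psiA p F x = z ^ (t x) := by
      rw [psiA_apply, hz, ← AddChar.map_nsmul_eq_pow, nsmul_eq_mul, mul_one, ZMod.natCast_zmod_val]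
    rw [hx, MulChar.inv_apply', ← mul_geom_sum]
    ring
  rw [hG, map_mul, hQv, mul_one]

lemma stick_lower {A : ValuationSubring ℂ} (hA : A.valuation (p : ℂ) < 1)
    {ι : F →+* IsLocalRing.ResidueField A} {ω : MulChar F ℂ}
    (hω : ∀ x, ∃ hx : ω x ∈ A, IsLocalRing.residue A ⟨ω x, hx⟩ = ι x) (hω1 : ω ≠ 1)
    (f : ℕ) (d e : ℕ → ℕ) :
    A.valuation (p : ℂ) ^ (∑ i ∈ Finset.range f, d i) ≤
      A.valuation (gaussSum (ω⁻¹ ^ (∑ i ∈ Finset.range f, d i * p ^ (e i))) (psiA p F)) ^ (p - 1) := by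
  have h1 : A.valuation (gaussSum ω⁻¹ (psiA p F)) ^ (∑ i ∈ Finset.range f, d i) ≤
      A.valuation (gaussSum (ω⁻¹ ^ (∑ i ∈ Finset.range f, d i * p ^ (e i))) (psiA p F)) := by
    induction f with
    | zero => simp [gaussSum_one_val]
    | succ f ih =>
      rw [Finset.sum_range_succ, Finset.sum_range_succ, pow_add, pow_add]
      refine le_trans ?_ (val_gaussSum_mul A _ _)
      refine mul_le_mul' ih ?_
      rw [mul_comm (d f), pow_mul]
      refine le_trans (le_of_eq ?_) (val_gaussSum_pow A _ _)
      rw [gaussSum_pow_p_pow]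
  rw [val_gaussSum_teich hA hω hω1] at h1
  calc _ ≤ (A.valuation ((ZMod.stdAddChar (1 : ZMod p) : ℂ) - 1) ^ (p - 1)) ^ (∑ i ∈ Finset.range f, d i) :=
        pow_le_pow_left' (val_p_le A) _
    _ = (A.valuation ((ZMod.stdAddChar (1 : ZMod p) : ℂ) - 1) ^ (∑ i ∈ Finset.range f, d i)) ^ (p - 1) := by
        rw [← pow_mul, ← pow_mul, mul_comm]
    _ ≤ _ := pow_le_pow_left' h1 _

end Teich

section Stick

variable {p : ℕ} [Fact p.Prime] {F : Type*} [Field F] [Fintype F] [Algebra (ZMod p) F]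

/-- Digit sums of fractions: the arithmetic behind Stickelberger's formula. -/
lemma digit_facts {p N f : ℕ} (hN : 0 < N) (hp : 0 < p) (hpf : p ^ f ≡ 1 [MOD N]) (j : ℕ) :
    N * ∑ i ∈ Finset.range f, (p * ((p ^ i * j) % N)) / N =
      (p - 1) * ∑ i ∈ Finset.range f, (p ^ i * j) % N ∧
    N * ∑ i ∈ Finset.range f, ((p * ((p ^ i * j) % N)) / N) * p ^ (f - 1 - i) = (p ^ f - 1) * (j % N) := by
  set r : ℕ → ℕ := fun i => (p ^ i * j) % N with hr
  have hrec : ∀ i, p * r i = N * ((p * r i) / N) + r (i + 1) := by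
    intro i
    have h1 := Nat.div_add_mod (p * r i) N
    have h2 : (p * r i) % N = r (i + 1) := by
      simp only [hr]
      rw [pow_succ, Nat.mul_mod, Nat.mod_mod, ← Nat.mul_mod]
      congr 1; ring
    omega
  have hrf : r f = r 0 := by
    simp only [hr]
    have := hpf.mul_right j
    simpa [Nat.ModEq] using this
  have hr0 : r 0 = j % N := by simp [hr]
  have hpf1 : 1 ≤ p ^ f := Nat.pow_pos hp
  constructor
  · have key : ∀ g, (N * ∑ i ∈ Finset.range g, (p * r i) / N) + r g = (p - 1) * ∑ i ∈ Finset.range g, r i + r 0 := by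
      intro g
      induction g with
      | zero => simp
      | succ g ih =>
        rw [Finset.sum_range_succ, Finset.sum_range_succ, mul_add, mul_add]
        have := hrec g
        have e : p * r g = (p - 1) * r g + r g := by
          obtain ⟨p', rfl⟩ : ∃ p', p = p' + 1 := ⟨p - 1, by omega⟩
          simp; ring
        omega
    have := key f
    rw [hrf] at this
    exact Nat.add_right_cancel this
  · have key : ∀ g, (N * ∑ i ∈ Finset.range g, ((p * r i) / N) * p ^ (g - 1 - i)) + r g = p ^ g * r 0 := by
      intro g
      induction g with
      | zero => simp
      | succ g ih =>
        rw [Finset.sum_range_succ]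
        have h1 : ∑ i ∈ Finset.range g, ((p * r i) / N) * p ^ (g + 1 - 1 - i) =
            p * ∑ i ∈ Finset.range g, ((p * r i) / N) * p ^ (g - 1 - i) := by
          rw [Finset.mul_sum]
          apply Finset.sum_congr rfl
          intro i hi
          have hi' := Finset.mem_range.1 hi
          have : g + 1 - 1 - i = (g - 1 - i) + 1 := by omega
          rw [this, pow_succ]; ring
        rw [h1]
        have h2 := hrec g
        have h3 : g + 1 - 1 - g = 0 := by omega
        rw [h3, pow_zero, mul_one, pow_succ]
        calc _ = p * (N * ∑ i ∈ Finset.range g, ((p * r i) / N) * p ^ (g - 1 - i)) +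
              (N * ((p * r g) / N) + r (g + 1)) := by ring
          _ = p * ((N * ∑ i ∈ Finset.range g, ((p * r i) / N) * p ^ (g - 1 - i)) + r g) := by
              rw [← h2]; ring
          _ = _ := by rw [ih]; ring
    have := key f
    rw [hrf] at this
    rw [← hr0]
    obtain ⟨P, hP⟩ : ∃ P, p ^ f = P + 1 := ⟨p ^ f - 1, by omega⟩
    rw [hP] at this ⊢
    have e : (P + 1) * r 0 = P * r 0 + r 0 := by ring
    rw [Nat.add_sub_cancel]
    rw [e] at this
    exact Nat.add_right_cancel this

/-- Lower bound half of Stickelberger's theorem. -/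
lemma stick_ineq {A : ValuationSubring ℂ} (hA : A.valuation (p : ℂ) < 1) {f N : ℕ}
    (hcard : Fintype.card F = p ^ f) (hq : 2 < p ^ f) (hN : 0 < N) (hNd : N ∣ p ^ f - 1) :
    ∃ Ω : MulChar F ℂ, Ω ^ N = 1 ∧ (∀ χ : MulChar F ℂ, χ ^ N = 1 → ∃ j : ℕ, χ = Ω ^ j) ∧
      ∀ j : ℕ, A.valuation (p : ℂ) ^ (∑ i ∈ Finset.range f, (p ^ i * j) % N) ≤
        A.valuation (gaussSum (Ω ^ j) (psiA p F)) ^ N := by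
  have hp : p.Prime := Fact.out
  obtain ⟨ι, ω, hω, hord, hgen⟩ := exists_teich (F := F) hA
  rw [hcard] at hord
  have hω1 : ω ≠ 1 := by
    rintro rfl
    rw [orderOf_one] at hord; omega
  obtain ⟨M, hM⟩ := hNd
  have hMpos : 0 < M := by
    rcases Nat.eq_zero_or_pos M with h | h
    · rw [h] at hM; omega
    · exact h
  have hΩN : (ω⁻¹ ^ M) ^ N = 1 := by
    rw [← pow_mul, mul_comm, ← hM, inv_pow, ← hord, pow_orderOf_eq_one, inv_one]
  refine ⟨ω⁻¹ ^ M, hΩN, ?_, ?_⟩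
  · intro χ hχ
    obtain ⟨a, ha⟩ := hgen χ⁻¹
    have h1 : ω ^ (a * N) = 1 := by rw [pow_mul, ← ha, inv_pow, hχ, inv_one]
    have h2 := orderOf_dvd_of_pow_eq_one h1
    rw [hord, hM, mul_comm a N] at h2
    obtain ⟨j, rfl⟩ := Nat.dvd_of_mul_dvd_mul_left hN h2
    refine ⟨j, ?_⟩
    rw [← pow_mul, inv_pow, ← ha, inv_inv]
  · intro j
    have hpf : p ^ f ≡ 1 [MOD N] := by
      rw [Nat.ModEq.comm, Nat.modEq_iff_dvd' (by omega)]
      exact ⟨M, hM⟩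
    obtain ⟨h1, h2⟩ := digit_facts hN hp.pos hpf j
    have h3 := stick_lower (F := F) hA hω hω1 f (fun i => (p * ((p ^ i * j) % N)) / N) (fun i => f - 1 - i)
    have h4 : ∑ i ∈ Finset.range f, ((p * ((p ^ i * j) % N)) / N) * p ^ (f - 1 - i) = M * (j % N) := by
      apply Nat.eq_of_mul_eq_mul_left hN
      rw [h2, hM]; ring
    have h6 : (ω⁻¹ ^ M) ^ (j % N) = (ω⁻¹ ^ M) ^ j := (pow_eq_pow_mod j hΩN).symm
    rw [h4, pow_mul, h6] at h3
    have h5 := pow_le_pow_left' h3 N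
    rw [← pow_mul, mul_comm _ N, h1, mul_comm (p - 1), pow_mul, ← pow_mul _ (p - 1), mul_comm (p - 1) N, pow_mul] at h5
    exact (pow_le_pow_iff_left₀ zero_le' zero_le' (by have := hp.two_le; omega)).1 h5

end Stick

section StickEq

variable {p : ℕ} [Fact p.Prime] {F : Type*} [Field F] [Fintype F] [Algebra (ZMod p) F]

lemma val_cancel {Γ : Type*} [LinearOrderedCommGroupWithZero Γ] {a b x y : Γ} (ha : a ≠ 0) (hb : b ≠ 0)
    (hax : a ≤ x) (hby : b ≤ y) (h : x * y = a * b) : x = a := by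
  apply le_antisymm _ hax
  by_contra hlt
  rw [not_le] at hlt
  have h1 : a * b < x * b := mul_lt_mul_of_pos_right hlt (zero_lt_iff.2 hb)
  have h2 : x * b ≤ x * y := mul_le_mul' le_rfl hby
  exact absurd (h1.trans_le h2) (by rw [h]; exact lt_irrefl _)

lemma val_p_ne_zero (A : ValuationSubring ℂ) (hp : p.Prime) : A.valuation (p : ℂ) ≠ 0 := by
  rw [Valuation.ne_zero_iff]; exact_mod_cast hp.ne_zero

/-- The conjugate digit sum. -/
lemma digit_neg {p N f : ℕ} (hN : 1 < N) (hpN : p.Coprime N) {j : ℕ} (hj : ¬ N ∣ j) :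
    (∑ i ∈ Finset.range f, (p ^ i * j) % N) + ∑ i ∈ Finset.range f, (p ^ i * ((N - 1) * j)) % N = f * N := by
  rw [← Finset.sum_add_distrib]
  have : ∀ i ∈ Finset.range f, (p ^ i * j) % N + (p ^ i * ((N - 1) * j)) % N = N := by
    intro i _
    have h1 : ¬ N ∣ p ^ i * j := fun h => hj ((Nat.Coprime.pow_left i hpN).symm.dvd_of_dvd_mul_left h)
    have h2 : N ∣ p ^ i * j + p ^ i * ((N - 1) * j) := by
      refine ⟨p ^ i * j, ?_⟩
      obtain ⟨M, rfl⟩ : ∃ M, N = M + 1 := ⟨N - 1, by omega⟩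
      simp; ring
    have h3 : (p ^ i * j) % N ≠ 0 := fun h => h1 (Nat.dvd_of_mod_eq_zero h)
    have h4 := Nat.mod_lt (p ^ i * j) (by omega : 0 < N)
    have h5 := Nat.mod_lt (p ^ i * ((N - 1) * j)) (by omega : 0 < N)
    have h6 := (Nat.dvd_iff_mod_eq_zero).1 h2
    rw [Nat.add_mod] at h6
    have h7 := Nat.dvd_of_mod_eq_zero h6
    obtain ⟨c, hc⟩ := h7
    have hc1 : 0 < c := by rcases Nat.eq_zero_or_pos c with h | h; · (rw [h] at hc; omega)
                           exact h
    have hc2 : c < 2 := by by_contra hge; have : N * 2 ≤ N * c := Nat.mul_le_mul_left _ (by omega); omega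
    have : c = 1 := by omega
    rw [hc, this, mul_one]
  rw [Finset.sum_congr rfl this]; simp

/-- Stickelberger's theorem, with the valuation raised to the `N`-th power. -/
lemma stick_eq {A : ValuationSubring ℂ} (hA : A.valuation (p : ℂ) < 1) {f N : ℕ}
    (hcard : Fintype.card F = p ^ f) (hq : 2 < p ^ f) (hf : 0 < f) (hN : 1 < N) (hNodd : Odd N) (hNd : N ∣ p ^ f - 1)
    (χ : MulChar F ℂ) (hχ : orderOf χ = N) :
    ∃ j₀ : ℕ, j₀.Coprime N ∧ ∀ k : ℕ, ¬ N ∣ k →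
      A.valuation (gaussSum (χ ^ k) (psiA p F)) ^ N =
        A.valuation (p : ℂ) ^ (∑ i ∈ Finset.range f, (p ^ i * (j₀ * k)) % N) := by
  have hp : p.Prime := Fact.out
  obtain ⟨Ω, hΩN, hgen, hle⟩ := stick_ineq (F := F) hA hcard hq (by omega) hNd
  obtain ⟨j₀, hj₀⟩ := hgen χ (by rw [← hχ, pow_orderOf_eq_one])
  have hpN : p.Coprime N := by
    rw [Nat.coprime_comm]
    apply Nat.Coprime.coprime_dvd_left hNd
    rw [Nat.coprime_comm, hp.coprime_iff_not_dvd]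
    intro h
    have h2 : p ∣ p ^ f := dvd_pow_self p hf.ne'
    have h3 := (Nat.dvd_sub h2 h)
    rw [Nat.sub_sub_self (by omega)] at h3
    exact hp.one_lt.ne' (Nat.dvd_one.1 h3)
  have hcop : j₀.Coprime N := by
    have hg := Nat.gcd_dvd_left j₀ N
    obtain ⟨x, hx⟩ := hg
    obtain ⟨y, hy⟩ := Nat.gcd_dvd_right j₀ N
    have h1 : χ ^ y = 1 := by
      rw [hj₀, ← pow_mul]
      have : j₀ * y = N * x := by
        calc j₀ * y = (j₀.gcd N * x) * y := by rw [← hx]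
          _ = (j₀.gcd N * y) * x := by ring
          _ = N * x := by rw [← hy]
      rw [this, pow_mul, hΩN, one_pow]
    have h2 := orderOf_dvd_of_pow_eq_one h1
    rw [hχ] at h2
    have hy0 : 0 < y := by rcases Nat.eq_zero_or_pos y with h | h; · (rw [h] at hy; omega)
                           exact h
    have h3 := Nat.le_of_dvd hy0 h2
    have h4 : 0 < j₀.gcd N := Nat.gcd_pos_of_pos_right _ (by omega)
    by_contra hne
    have h5 : 2 ≤ j₀.gcd N := by
      have : j₀.gcd N ≠ 1 := hne
      omega
    nlinarith
  refine ⟨j₀, hcop, ?_⟩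
  intro k hk
  have hjk : ¬ N ∣ j₀ * k := fun h => hk (hcop.symm.dvd_of_dvd_mul_left h)
  have hχk : χ ^ k ≠ 1 := by
    intro h
    exact hk (hχ ▸ orderOf_dvd_of_pow_eq_one h)
  have hχkN : (χ ^ k) ^ N = 1 := by rw [← pow_mul, mul_comm, pow_mul, ← hχ, pow_orderOf_eq_one, one_pow]
  have e1 : Ω ^ (j₀ * k) = χ ^ k := by rw [pow_mul, hj₀]
  have e2 : Ω ^ ((N - 1) * (j₀ * k)) = (χ ^ k)⁻¹ := by
    rw [eq_inv_iff_mul_eq_one, ← e1, ← pow_add]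
    have : (N - 1) * (j₀ * k) + j₀ * k = N * (j₀ * k) := by
      obtain ⟨M, rfl⟩ : ∃ M, N = M + 1 := ⟨N - 1, by omega⟩
      simp; ring
    rw [this, pow_mul, hΩN, one_pow]
  have h1 := hle (j₀ * k)
  have h2 := hle ((N - 1) * (j₀ * k))
  rw [e1] at h1
  rw [e2] at h2
  refine val_cancel (pow_ne_zero _ (val_p_ne_zero A hp)) (pow_ne_zero _ (val_p_ne_zero A hp)) h1 h2 ?_
  rw [← pow_add, digit_neg hN hpN hjk, ← mul_pow, ← map_mul, ← gaussSum_conj hNodd hχkN, gaussSum_mul_conj hχk, hcard,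
    pow_mul]
  congr 1
  push_cast
  rw [map_pow]

end StickEq

section Comb

/-- Digit sum attached to a residue class. -/
noncomputable def RR (p f N : ℕ) (a : ZMod N) : ℤ := ∑ i ∈ Finset.range f, (((p : ZMod N) ^ i * a).val : ℤ)

lemma RR_shift {p f N : ℕ} (hpf : (p : ZMod N) ^ f = 1) (a : ZMod N) : RR p f N (p * a) = RR p f N a := by
  have h1 := Finset.sum_range_succ (fun i => (((p : ZMod N) ^ i * a).val : ℤ)) f
  have h2 := Finset.sum_range_succ' (fun i => (((p : ZMod N) ^ i * a).val : ℤ)) f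
  rw [hpf] at h1
  rw [pow_zero] at h2
  have h3 := h1.symm.trans h2
  have h4 := add_right_cancel h3
  unfold RR
  rw [h4]
  apply Finset.sum_congr rfl
  intro i _
  rw [pow_succ, mul_assoc]

lemma RR_shift_pow {p f N : ℕ} (hpf : (p : ZMod N) ^ f = 1) (a : ZMod N) (i : ℕ) :
    RR p f N (p ^ i * a) = RR p f N a := by
  induction i with
  | zero => simp
  | succ i ih => rw [pow_succ', mul_assoc, RR_shift hpf, ih]

lemma RR_neg {p f N : ℕ} [NeZero N] (hf : 0 < f) (hpf : (p : ZMod N) ^ f = 1) {a : ZMod N} (ha : a ≠ 0) :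
    RR p f N (-a) = f * N - RR p f N a := by
  have hu : IsUnit (p : ZMod N) := IsUnit.of_pow_eq_one hpf hf.ne'
  unfold RR
  rw [eq_sub_iff_add_eq, ← Finset.sum_add_distrib]
  have : ∀ i ∈ Finset.range f, (((p : ZMod N) ^ i * -a).val : ℤ) + (((p : ZMod N) ^ i * a).val : ℤ) = N := by
    intro i _
    have h1 : (p : ZMod N) ^ i * a ≠ 0 := by
      rw [Ne, (hu.pow i).mul_right_eq_zero]; exact ha
    rw [mul_neg, ZMod.neg_val, if_neg h1]
    have := (ZMod.val_lt ((p : ZMod N) ^ i * a)).le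
    push_cast [this]
    ring
  rw [Finset.sum_congr rfl this]
  simp

lemma comb_main {p f N d k : ℕ} [NeZero N] [NeZero d] (hf : 0 < f) (hpf : (p : ZMod N) ^ f = 1)
    (hd : d % 4 = 3) (hdN : d ∣ N) (hφ : 2 * f = N.totient) (hk : ¬ N ∣ k)
    (hj : jacobiSym p d = 1)
    (hH : ∀ a : ℕ, a.Coprime N →
      (jacobiSym a d = 1 ∧ ∃ i : ℕ, (a : ZMod N) = (p : ZMod N) ^ i) ∨
      (jacobiSym a d = -1 ∧ ∃ i : ℕ, (a : ZMod N) = -(p : ZMod N) ^ i)) (j₀ : (ZMod N)ˣ) :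
    ∑ y : (ZMod N)ˣ, eps d (ZMod.castHom hdN (ZMod d) y) * (((k : ZMod N) * y).val : ℤ) =
      eps d (ZMod.castHom hdN (ZMod d) j₀) * (2 * RR p f N (k * j₀) - f * N) := by
  have hup : IsUnit (p : ZMod N) := IsUnit.of_pow_eq_one hpf hf.ne'
  obtain ⟨u, hu⟩ := hup
  set E : (ZMod N)ˣ → ℤ := fun y => eps d (ZMod.castHom hdN (ZMod d) y) with hE
  have hEmul : ∀ x y, E (x * y) = E x * E y := by
    intro x y; simp only [hE, Units.val_mul, map_mul, eps_mul]
  have hEneg : ∀ x, E (-x) = - E x := by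
    intro x; simp only [hE, Units.val_neg, map_neg, eps_neg hd]
  have hEu : E u = 1 := by
    simp only [hE, hu, map_natCast, eps_natCast, hj]
  have hEupow : ∀ i : ℕ, E (u ^ i) = 1 := by
    intro i
    induction i with
    | zero => simp only [hE, pow_zero, Units.val_one, map_one, eps_one]
    | succ i ih => rw [pow_succ, hEmul, ih, hEu, one_mul]
  have hsumE : ∑ y, E y = 0 := by
    have h1 := Equiv.sum_comp (Equiv.neg (ZMod N)ˣ) E
    simp only [Equiv.neg_apply, hEneg, Finset.sum_neg_distrib] at h1
    linarith
  have hk0 : ∀ y : (ZMod N)ˣ, (k : ZMod N) * y ≠ 0 := by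
    intro y
    rw [Ne, Units.mul_left_eq_zero, ZMod.natCast_eq_zero_iff]; exact hk
  -- every unit is plus or minus a power of `u`
  have hdich : ∀ y : (ZMod N)ˣ, (∃ i : ℕ, y = u ^ i) ∨ ∃ i : ℕ, y = -u ^ i := by
    intro y
    have hc := ZMod.val_coe_unit_coprime y
    rcases hH _ hc with ⟨_, i, hi⟩ | ⟨_, i, hi⟩
    · left; refine ⟨i, Units.ext ?_⟩
      rw [ZMod.natCast_zmod_val] at hi
      rw [hi, Units.val_pow_eq_pow_val, hu]
    · right; refine ⟨i, Units.ext ?_⟩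
      rw [ZMod.natCast_zmod_val] at hi
      rw [hi, Units.val_neg, Units.val_pow_eq_pow_val, hu]
  have hone : ∀ y : (ZMod N)ˣ, E y * (2 * RR p f N (k * y) - f * N) = 2 * RR p f N (k * 1) - f * N := by
    intro y
    rcases hdich y with ⟨i, rfl⟩ | ⟨i, rfl⟩
    · rw [hEupow, one_mul, Units.val_pow_eq_pow_val, hu, mul_comm (k : ZMod N), RR_shift_pow hpf, mul_one]
    · have h1 : (k : ZMod N) * ((-u ^ i : (ZMod N)ˣ) : ZMod N) = -((p : ZMod N) ^ i * k) := by
        rw [Units.val_neg, Units.val_pow_eq_pow_val, hu]; ring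
      rw [hEneg, hEupow, h1, RR_neg hf hpf, RR_shift_pow hpf, mul_one]
      · ring
      · have := hk0 (u ^ i)
        rw [Units.val_pow_eq_pow_val, hu, mul_comm] at this
        exact this
  have hT : ∀ i : ℕ, ∑ y, E y * (((p : ZMod N) ^ i * (k * (y : ZMod N))).val : ℤ) =
      ∑ y, E y * (((k : ZMod N) * y).val : ℤ) := by
    intro i
    rw [← Equiv.sum_comp (Equiv.mulLeft (u ^ i)) (fun y => E y * (((k : ZMod N) * y).val : ℤ))]
    apply Finset.sum_congr rfl
    intro y _
    rw [Equiv.coe_mulLeft, hEmul, hEupow, one_mul, Units.val_mul, Units.val_pow_eq_pow_val, hu]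
    congr 3
    ring
  have hL : ∑ y, E y * (2 * RR p f N (k * y) - f * N) = 2 * f * ∑ y, E y * (((k : ZMod N) * y).val : ℤ) := by
    have h1 : ∑ y, E y * RR p f N (k * y) = f * ∑ y, E y * (((k : ZMod N) * y).val : ℤ) := by
      unfold RR
      simp_rw [Finset.mul_sum]
      rw [Finset.sum_comm, Finset.sum_congr rfl (fun i _ => hT i)]
      simp [Finset.mul_sum]
    calc _ = 2 * ∑ y, E y * RR p f N (k * y) - (∑ y, E y) * (f * N) := by
          rw [Finset.mul_sum, Finset.sum_mul, ← Finset.sum_sub_distrib]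
          apply Finset.sum_congr rfl; intro y _; ring
      _ = _ := by rw [h1, hsumE]; ring
  rw [Finset.sum_congr rfl (fun y _ => hone y), Finset.sum_const, Finset.card_univ, ZMod.card_units_eq_totient,
    ← hφ, nsmul_eq_mul] at hL
  have h2 := hone j₀
  have hf' : (2 * f : ℤ) ≠ 0 := by positivity
  rw [h2]
  apply mul_left_cancel₀ hf'
  push_cast at hL
  exact hL.symm

lemma sum_zmod_range {N : ℕ} [NeZero N] (g : ℕ → ℤ) : ∑ y : ZMod N, g y.val = ∑ y ∈ Finset.range N, g y := by
  apply Finset.sum_bij (fun (y : ZMod N) _ => y.val)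
  · intro a _; exact Finset.mem_range.2 (ZMod.val_lt a)
  · intro a _ b _ h; exact ZMod.val_injective N h
  · intro b hb; exact ⟨(b : ZMod N), Finset.mem_univ _, ZMod.val_cast_of_lt (Finset.mem_range.1 hb)⟩
  · intro a _; rfl

lemma sum_range_mul (g : ℕ → ℤ) (a b : ℕ) :
    ∑ y ∈ Finset.range (a * b), g y = ∑ l ∈ Finset.range a, ∑ r ∈ Finset.range b, g (b * l + r) := by
  induction a with
  | zero => simp
  | succ a ih => rw [Finset.sum_range_succ, ← ih, add_mul, one_mul, Finset.sum_range_add]; congr 1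
                 apply Finset.sum_congr rfl; intro i _; rw [mul_comm]

lemma jac_periodic (d b l r : ℕ) (hdb : d ∣ b) : jacobiSym ((b * l + r : ℕ) : ℤ) d = jacobiSym (r : ℤ) d := by
  obtain ⟨c, rfl⟩ := hdb
  rw [jacobiSym.mod_left]
  conv_rhs => rw [jacobiSym.mod_left]
  congr 1
  push_cast
  rw [mul_assoc, Int.mul_add_emod_self_left]

lemma comb_sum {N d k L : ℕ} [NeZero N] [NeZero d] (hd : d % 4 = 3) (hN : N = k * (L * d)) (hdN : d ∣ N)
    (hrad : ∀ a : ℕ, a.Coprime d → a.Coprime N) :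
    ∑ y : (ZMod N)ˣ, eps d (ZMod.castHom hdN (ZMod d) y) * (((k : ZMod N) * y).val : ℤ) =
      k * (k * L) * ∑ b : ZMod d, eps d b * b.val := by
  have hjac : ∀ y : ZMod N, eps d (ZMod.castHom hdN (ZMod d) y) = jacobiSym (y.val : ℤ) d := by
    intro y
    rw [← eps_natCast, ← map_natCast (ZMod.castHom hdN (ZMod d)), ZMod.natCast_zmod_val]
  have hk0 : 0 < k := by
    rcases Nat.eq_zero_or_pos k with h | h
    · exfalso; rw [h, zero_mul] at hN; exact NeZero.ne N hN
    · exact h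
  have h1 : ∑ y : (ZMod N)ˣ, eps d (ZMod.castHom hdN (ZMod d) y) * (((k : ZMod N) * y).val : ℤ) =
      ∑ y : ZMod N, eps d (ZMod.castHom hdN (ZMod d) y) * (((k : ZMod N) * y).val : ℤ) := by
    rw [← Finset.sum_subset (Finset.subset_univ (Finset.univ.image (fun x : (ZMod N)ˣ => (x : ZMod N))))]
    · rw [Finset.sum_image (fun a _ b _ h => Units.ext h)]
    · intro y _ hy
      rw [hjac, jacobiSym.eq_zero_iff_not_coprime.2, zero_mul]
      intro hc
      apply hy
      have hc' : y.val.Coprime N := hrad _ (by rw [Int.gcd_natCast_natCast] at hc; exact hc)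
      obtain ⟨u, hu⟩ := (ZMod.isUnit_iff_coprime y.val N).2 hc'
      exact Finset.mem_image.2 ⟨u, Finset.mem_univ _, by rw [hu, ZMod.natCast_zmod_val]⟩
  have h2 : ∀ y : ZMod N, eps d (ZMod.castHom hdN (ZMod d) y) * (((k : ZMod N) * y).val : ℤ) =
      (fun y : ℕ => jacobiSym (y : ℤ) d * (((k * y) % N : ℕ) : ℤ)) y.val := by
    intro y
    simp only
    rw [hjac, ← ZMod.val_natCast, Nat.cast_mul, ZMod.natCast_zmod_val]
  have hJ0 : ∑ r ∈ Finset.range d, jacobiSym (r : ℤ) d = 0 := by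
    rw [← sum_zmod_range (N := d) (fun r => jacobiSym (r : ℤ) d)]
    have h3 := Equiv.sum_comp (Equiv.neg (ZMod d)) (fun y => eps d y)
    simp only [Equiv.neg_apply, eps_neg hd, Finset.sum_neg_distrib] at h3
    have h4 : ∑ y : ZMod d, eps d y = 0 := by linarith
    exact h4
  have h5 : ∑ b : ZMod d, eps d b * b.val = ∑ r ∈ Finset.range d, jacobiSym (r : ℤ) d * r :=
    sum_zmod_range (N := d) (fun r => jacobiSym (r : ℤ) d * r)
  rw [h1, Finset.sum_congr rfl (fun y _ => h2 y),
    sum_zmod_range (N := N) (fun y : ℕ => jacobiSym (y : ℤ) d * (((k * y) % N : ℕ) : ℤ)), h5]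
  have h6 : ∀ y : ℕ, (k * y) % N = k * (y % (L * d)) := by
    intro y; rw [hN, Nat.mul_mod_mul_left]
  simp_rw [h6]
  have h7 : ∑ y ∈ Finset.range (L * d), jacobiSym (y : ℤ) d * (y : ℤ) =
      L * ∑ r ∈ Finset.range d, jacobiSym (r : ℤ) d * r := by
    rw [sum_range_mul (fun y => jacobiSym (y : ℤ) d * (y : ℤ))]
    have : ∀ l ∈ Finset.range L, ∑ r ∈ Finset.range d, jacobiSym ((d * l + r : ℕ) : ℤ) d * ((d * l + r : ℕ) : ℤ) =
        ∑ r ∈ Finset.range d, jacobiSym (r : ℤ) d * r := by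
      intro l _
      calc _ = (∑ r ∈ Finset.range d, jacobiSym (r : ℤ) d) * (d * l) + ∑ r ∈ Finset.range d, jacobiSym (r : ℤ) d * r := by
            rw [Finset.sum_mul, ← Finset.sum_add_distrib]
            apply Finset.sum_congr rfl
            intro r _
            rw [jac_periodic d d l r dvd_rfl]; push_cast; ring
        _ = _ := by rw [hJ0]; ring
    rw [Finset.sum_congr rfl this]; simp
  have h8 : ∑ y ∈ Finset.range N, jacobiSym (y : ℤ) d * ((k * (y % (L * d)) : ℕ) : ℤ) =
      k * (k * ∑ y ∈ Finset.range (L * d), jacobiSym (y : ℤ) d * (y : ℤ)) := by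
    rw [hN, sum_range_mul (fun y => jacobiSym (y : ℤ) d * ((k * (y % (L * d)) : ℕ) : ℤ))]
    have : ∀ l ∈ Finset.range k, ∑ r ∈ Finset.range (L * d), jacobiSym (((L * d) * l + r : ℕ) : ℤ) d *
        ((k * (((L * d) * l + r) % (L * d)) : ℕ) : ℤ) =
        k * ∑ y ∈ Finset.range (L * d), jacobiSym (y : ℤ) d * (y : ℤ) := by
      intro l _
      rw [Finset.mul_sum]
      apply Finset.sum_congr rfl
      intro r hr
      rw [jac_periodic d (L * d) l r (Dvd.intro_left L rfl), Nat.mul_add_mod, Nat.mod_eq_of_lt (Finset.mem_range.1 hr)]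
      push_cast; ring
    rw [Finset.sum_congr rfl this]; simp
  rw [h8, h7]; ring

end Comb

section Final

variable {p : ℕ} [Fact p.Prime] {F : Type*} [Field F] [Fintype F] [Algebra (ZMod p) F]

lemma stick_signed {A : ValuationSubring ℂ} (hA : A.valuation (p : ℂ) < 1) {f N d h : ℕ}
    [NeZero N] [NeZero d]
    (hcard : Fintype.card F = p ^ f) (hq : 2 < p ^ f) (hf : 0 < f) (hN : 1 < N) (hNodd : Odd N) (hNd : N ∣ p ^ f - 1)
    (hd : d % 4 = 3) (hdN : d ∣ N) (hφ : 2 * f = N.totient)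
    (hrad : ∀ a : ℕ, a.Coprime d → a.Coprime N)
    (hj : jacobiSym p d = 1)
    (hH : ∀ a : ℕ, a.Coprime N →
      (jacobiSym a d = 1 ∧ ∃ i : ℕ, (a : ZMod N) = (p : ZMod N) ^ i) ∨
      (jacobiSym a d = -1 ∧ ∃ i : ℕ, (a : ZMod N) = -(p : ZMod N) ^ i))
    (hS : (∑ b : ZMod d, eps d b * b.val) ^ 2 = ((h * d : ℕ) : ℤ) ^ 2)
    (χ : MulChar F ℂ) (hχ : orderOf χ = N) :
    ∃ σ : ℤ, (σ = 1 ∨ σ = -1) ∧ ∀ k L : ℕ, N = k * (L * d) → ∃ e e' : ℕ,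
      (2 * e : ℤ) = f + σ * (k * h) ∧ (2 * e' : ℤ) = f - σ * (k * h) ∧
      A.valuation (gaussSum (χ ^ k) (psiA p F)) = A.valuation (p : ℂ) ^ e ∧
      A.valuation (starRingEnd ℂ (gaussSum (χ ^ k) (psiA p F))) = A.valuation (p : ℂ) ^ e' := by
  have hp : p.Prime := Fact.out
  have hvp := val_p_ne_zero A hp
  obtain ⟨j₀, hj₀, hv⟩ := stick_eq (F := F) hA hcard hq hf hN hNodd hNd χ hχ
  obtain ⟨ju, hju⟩ := (ZMod.isUnit_iff_coprime j₀ N).2 hj₀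
  have hpf : (p : ZMod N) ^ f = 1 := by
    have h1 : ((p ^ f - 1 : ℕ) : ZMod N) = 0 := (ZMod.natCast_eq_zero_iff _ _).2 hNd
    rw [Nat.cast_sub (by omega), sub_eq_zero] at h1
    exact_mod_cast h1
  have hE := eps_unit_or d (ju.isUnit.map (ZMod.castHom hdN (ZMod d)))
  have hSpm : ∃ τ : ℤ, (τ = 1 ∨ τ = -1) ∧ ∑ b : ZMod d, eps d b * b.val = τ * (h * d) := by
    rcases sq_eq_sq_iff_eq_or_eq_neg.1 hS with h1 | h1
    · exact ⟨1, Or.inl rfl, by rw [h1]; push_cast; ring⟩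
    · exact ⟨-1, Or.inr rfl, by rw [h1]; push_cast; ring⟩
  obtain ⟨τ, hτ, hSτ⟩ := hSpm
  set E := eps d (ZMod.castHom hdN (ZMod d) ju) with hEdef
  refine ⟨E * τ, ?_, ?_⟩
  · rcases hE with h1 | h1 <;> rcases hτ with h2 | h2 <;> rw [h1, h2] <;> simp
  intro k L hkL
  have hk0 : 0 < k := by
    rcases Nat.eq_zero_or_pos k with h1 | h1
    · rw [h1, zero_mul] at hkL; omega
    · exact h1
  have hL0 : 0 < L := by
    rcases Nat.eq_zero_or_pos L with h1 | h1
    · rw [h1, zero_mul, mul_zero] at hkL; omega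
    · exact h1
  have hk : ¬ N ∣ k := by
    intro h1
    have h2 := Nat.le_of_dvd hk0 h1
    have h3 : 2 ≤ L * d := by nlinarith [show 3 ≤ d by omega]
    nlinarith
  have h1 := comb_main hf hpf hd hdN hφ hk hj hH ju
  have h2 := comb_sum hd hkL hdN hrad
  rw [h2, hSτ, ← hEdef] at h1
  set R := ∑ i ∈ Finset.range f, (p ^ i * (j₀ * k)) % N with hR
  have hRR : RR p f N (k * ju) = (R : ℤ) := by
    rw [hR]; unfold RR
    push_cast
    apply Finset.sum_congr rfl
    intro i _
    have e : (p : ZMod N) ^ i * ((k : ZMod N) * ju) = ((p ^ i * (j₀ * k) : ℕ) : ZMod N) := by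
      rw [hju]; push_cast; ring
    rw [e, ZMod.val_natCast]; push_cast; rfl
  rw [hRR] at h1
  have hEE : E * E = 1 := by rcases hE with h3 | h3 <;> rw [h3] <;> norm_num
  have hNZ : (N : ℤ) = k * (L * d) := by exact_mod_cast hkL
  have h3 : 2 * (R : ℤ) = N * (f + E * τ * (k * h)) := by
    have : E * (E * (2 * R - f * N)) = E * (k * (k * L) * (τ * (h * d))) := by rw [h1]
    rw [← mul_assoc, hEE, one_mul] at this
    have e : E * (k * (k * L) * (τ * (h * d))) = N * (E * τ * (k * h)) := by rw [hNZ]; ring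
    rw [e] at this
    linarith
  have h4 : N ∣ R := by
    have h5 : (N : ℤ) ∣ 2 * R := ⟨_, h3⟩
    have h6 : N ∣ 2 * R := by exact_mod_cast h5
    exact (Nat.Coprime.dvd_of_dvd_mul_left (Nat.Coprime.symm (Nat.coprime_two_left.2 hNodd)) h6)
  obtain ⟨e, he⟩ := h4
  have he2 : (2 * e : ℤ) = f + E * τ * (k * h) := by
    have hN0 : (N : ℤ) ≠ 0 := by positivity
    apply mul_left_cancel₀ hN0
    rw [← h3, he]; push_cast; ring
  have h5 : A.valuation (gaussSum (χ ^ k) (psiA p F)) = A.valuation (p : ℂ) ^ e := by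
    have h6 := hv k hk
    rw [← hR, he, mul_comm N e, pow_mul] at h6
    exact (pow_left_inj₀ zero_le' zero_le' (by omega)).1 h6
  have hχk : χ ^ k ≠ 1 := fun h7 => hk (hχ ▸ orderOf_dvd_of_pow_eq_one h7)
  have h8 := congrArg A.valuation (gaussSum_mul_conj (p := p) hχk)
  rw [map_mul, hcard, h5] at h8
  push_cast at h8
  rw [map_pow] at h8
  have hRle : R ≤ f * N := by
    rw [hR]
    calc _ ≤ ∑ i ∈ Finset.range f, N := Finset.sum_le_sum (fun i _ => (Nat.mod_lt _ (by omega)).le)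
      _ = f * N := by simp
  have hef : e ≤ f := by
    rw [he, mul_comm] at hRle
    exact Nat.le_of_mul_le_mul_right hRle (by omega)
  obtain ⟨e', rfl⟩ := Nat.exists_eq_add_of_le hef
  refine ⟨e, e', he2, ?_, h5, ?_⟩
  · push_cast at he2 ⊢; linarith
  · rw [pow_add] at h8
    exact mul_left_cancel₀ (pow_ne_zero e hvp) h8

/-- Stickelberger for index two Gauss sums: a normalized place above `p`. -/
lemma stick_place {f N d h : ℕ}
    [NeZero N] [NeZero d]
    (hcard : Fintype.card F = p ^ f) (hq : 2 < p ^ f) (hf : 0 < f) (hN : 1 < N) (hNodd : Odd N) (hNd : N ∣ p ^ f - 1)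
    (hd : d % 4 = 3) (hdN : d ∣ N) (hφ : 2 * f = N.totient)
    (hrad : ∀ a : ℕ, a.Coprime d → a.Coprime N)
    (hj : jacobiSym p d = 1)
    (hH : ∀ a : ℕ, a.Coprime N →
      (jacobiSym a d = 1 ∧ ∃ i : ℕ, (a : ZMod N) = (p : ZMod N) ^ i) ∨
      (jacobiSym a d = -1 ∧ ∃ i : ℕ, (a : ZMod N) = -(p : ZMod N) ^ i))
    (hS : (∑ b : ZMod d, eps d b * b.val) ^ 2 = ((h * d : ℕ) : ℤ) ^ 2)
    (χ : MulChar F ℂ) (hχ : orderOf χ = N) :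
    ∃ (Γ : Type) (_ : LinearOrderedCommGroupWithZero Γ) (v : Valuation ℂ Γ),
      v (p : ℂ) < 1 ∧ (∀ z : ℂ, IsIntegral ℤ z → v z ≤ 1) ∧ (∀ z : ℤ, v (z : ℂ) < 1 → (p : ℤ) ∣ z) ∧
      ∀ k L : ℕ, N = k * (L * d) → ∃ e : ℕ, f = k * h + 2 * e ∧
        v (gaussSum (χ ^ k) (psiA p F)) = v (p : ℂ) ^ e ∧
        v (starRingEnd ℂ (gaussSum (χ ^ k) (psiA p F))) = v (p : ℂ) ^ (e + k * h) := by
  have hp : p.Prime := Fact.out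
  obtain ⟨A, hA⟩ := exists_valSubring hp
  obtain ⟨σ, hσ, hmain⟩ := stick_signed (F := F) hA hcard hq hf hN hNodd hNd hd hdN hφ hrad hj hH hS χ hχ
  rcases hσ with rfl | rfl
  · refine ⟨A.ValueGroup, inferInstance, A.valuation.comap (starRingEnd ℂ), ?_, ?_, ?_, ?_⟩
    · simpa [Valuation.comap_apply] using hA
    · intro z hz
      rw [Valuation.comap_apply]
      exact val_le_one_of_integral A (hz.map ((starRingEnd ℂ).toIntAlgHom))
    · intro z hz
      rw [Valuation.comap_apply, map_intCast] at hz
      exact int_val_lt_one_iff hp hA hz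
    · intro k L hkL
      obtain ⟨e, e', h1, h2, h3, h4⟩ := hmain k L hkL
      have h5 : e = e' + k * h := by zify; linarith
      refine ⟨e', by zify; linarith, ?_, ?_⟩
      · rw [Valuation.comap_apply, h4, Valuation.comap_apply, map_natCast (starRingEnd ℂ)]
      · rw [Valuation.comap_apply, Complex.conj_conj, h3, Valuation.comap_apply, map_natCast (starRingEnd ℂ), h5]
  · refine ⟨A.ValueGroup, inferInstance, A.valuation, hA, fun z hz => val_le_one_of_integral A hz,
      fun z hz => int_val_lt_one_iff hp hA hz, ?_⟩
    intro k L hkL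
    obtain ⟨e, e', h1, h2, h3, h4⟩ := hmain k L hkL
    have h5 : e' = e + k * h := by zify; linarith
    refine ⟨e, by zify; linarith, h3, ?_⟩
    rw [h4, h5]

end Final

section NT

lemma nt_facts {p₁ p₂ m n N p f : ℕ} (hp₁ : p₁.Prime) (hp₂ : p₂.Prime)
    (hp₁mod : p₁ % 4 = 1) (hp₂mod : p₂ % 4 = 3) (hm : 1 ≤ m) (hn : 1 ≤ n)
    (hN : N = p₁ ^ m * p₂ ^ n) (hp : p.Prime)
    (hord₁ : orderOf ((p : ZMod (p₁ ^ m))) = Nat.totient (p₁ ^ m))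
    (hord₂ : orderOf ((p : ZMod (p₂ ^ n))) = Nat.totient (p₂ ^ n))
    (hf : 2 * f = Nat.totient N) :
    jacobiSym p (p₁ * p₂) = 1 ∧ N.Coprime (p - 1) ∧ N ∣ p ^ f - 1 ∧ 2 < p ^ f ∧ 0 < f ∧
    (∃ i : ℕ, (p : ZMod (p₁ ^ m)) ^ i = -1) ∧ (∃ i : ℕ, (p : ZMod (p₂ ^ n)) ^ i = -1) ∧
    ∃ e₀ : ℕ, f = 2 * e₀ ∧ (p₁ : ℤ) ∣ (p : ℤ) ^ e₀ - (-1) ∧ (p₂ : ℤ) ∣ (p : ℤ) ^ e₀ - 1 := by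
  have h12 : p₁ ≠ p₂ := by rintro rfl; omega
  have h1 : p₁ ≠ 2 := by rintro rfl; omega
  have h2 : p₂ ≠ 2 := by rintro rfl; omega
  obtain ⟨a1, a2, a3, a4⟩ := prim_root_facts hp₁ h1 hm hord₁
  obtain ⟨b1, b2, b3, b4⟩ := prim_root_facts hp₂ h2 hn hord₂
  have hcop : Nat.Coprime (p₁ ^ m) (p₂ ^ n) := Nat.Coprime.pow _ _ ((Nat.coprime_primes hp₁ hp₂).2 h12)
  have := Fact.mk hp₁
  have := Fact.mk hp₂
  set A₁ := (p₁ - 1) / 2 * p₁ ^ (m - 1) with hA₁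
  set A₂ := (p₂ - 1) / 2 * p₂ ^ (n - 1) with hA₂
  have hA₁e : Even A₁ := by
    apply Even.mul_right
    rw [Nat.even_iff]; omega
  have hp₁o : Odd p₁ := Nat.odd_iff.2 (by omega)
  have hp₂o : Odd p₂ := Nat.odd_iff.2 (by omega)
  have hA₂o : Odd A₂ := by
    apply Odd.mul
    · rw [Nat.odd_iff]; omega
    · exact hp₂o.pow
  have hf2 : f = 2 * (A₁ * A₂) := by
    have e1 : p₁ - 1 = 2 * ((p₁ - 1) / 2) := by omega
    have e2 : p₂ - 1 = 2 * ((p₂ - 1) / 2) := by omega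
    rw [hN, Nat.totient_mul hcop, Nat.totient_prime_pow hp₁ (by omega), Nat.totient_prime_pow hp₂ (by omega), e1, e2] at hf
    have : 2 * f = 2 * (2 * (A₁ * A₂)) := by rw [hf, hA₁, hA₂]; ring
    omega
  have hA₁p : 0 < A₁ := Nat.mul_pos (by have := hp₁.two_le; omega) (pow_pos hp₁.pos _)
  have hA₂p : 0 < A₂ := Nat.mul_pos (by omega) (pow_pos hp₂.pos _)
  have hf0 : 0 < f := by rw [hf2]; positivity
  have c1 : (p : ZMod (p₁ ^ m)) ^ (A₁ * A₂) = -1 := by rw [pow_mul, a3, hA₂o.neg_one_pow]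
  have c2 : (p : ZMod (p₂ ^ n)) ^ (A₁ * A₂) = 1 := by rw [mul_comm, pow_mul, b3, hA₁e.neg_one_pow]
  have hpf1 : 1 ≤ p ^ f := Nat.pow_pos hp.pos
  have d1 : p₁ ^ m ∣ p ^ f - 1 := by
    rw [← ZMod.natCast_eq_zero_iff, Nat.cast_sub hpf1, Nat.cast_pow, hf2, mul_comm, pow_mul, c1]; simp
  have d2 : p₂ ^ n ∣ p ^ f - 1 := by
    rw [← ZMod.natCast_eq_zero_iff, Nat.cast_sub hpf1, Nat.cast_pow, hf2, mul_comm, pow_mul, c2]; simp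
  have hNd : N ∣ p ^ f - 1 := by rw [hN]; exact hcop.mul_dvd_of_dvd_of_dvd d1 d2
  have hno : ∀ ℓ : ℕ, ℓ.Prime → ℓ ≠ 2 → (p : ZMod ℓ) ^ ((ℓ - 1) / 2) = -1 → ¬ ℓ ∣ p - 1 := by
    intro ℓ hℓ hℓ2 hh hdv
    have := Fact.mk hℓ
    rw [← ZMod.natCast_eq_zero_iff, Nat.cast_sub hp.one_lt.le, sub_eq_zero, Nat.cast_one] at hdv
    rw [hdv, one_pow] at hh
    have : Fact (2 < ℓ) := ⟨by have := hℓ.two_le; omega⟩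
    exact ZMod.neg_one_ne_one hh.symm
  refine ⟨?_, ?_, hNd, ?_, hf0, ⟨_, a3⟩, ⟨_, b3⟩, A₁ * A₂, hf2, ?_, ?_⟩
  · rw [jacobiSym.mul_right, a2, b2]; norm_num
  · rw [hN]
    apply Nat.Coprime.mul_left
    · exact Nat.Coprime.pow_left _ (hp₁.coprime_iff_not_dvd.2 (hno p₁ hp₁ h1 a1))
    · exact Nat.Coprime.pow_left _ (hp₂.coprime_iff_not_dvd.2 (hno p₂ hp₂ h2 b1))
  · have h3 : p₁ ≤ p₁ ^ m := Nat.le_self_pow (by omega) _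
    have h4 : 1 < p ^ f := Nat.one_lt_pow hf0.ne' hp.one_lt
    have h5 := Nat.le_of_dvd (by omega) d1
    have := hp₁.two_le
    omega
  · have := (ZMod.intCast_zmod_eq_zero_iff_dvd ((p : ℤ) ^ (A₁ * A₂) - (-1)) (p₁ ^ m)).1 (by push_cast; rw [c1]; ring)
    refine dvd_trans ?_ this
    exact_mod_cast dvd_pow_self p₁ (by omega : m ≠ 0)
  · have := (ZMod.intCast_zmod_eq_zero_iff_dvd ((p : ℤ) ^ (A₁ * A₂) - 1) (p₂ ^ n)).1 (by push_cast; rw [c2]; ring)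
    refine dvd_trans ?_ this
    exact_mod_cast dvd_pow_self p₂ (by omega : n ≠ 0)

lemma rad_coprime {p₁ p₂ m n : ℕ} (a : ℕ) (ha : a.Coprime (p₁ * p₂)) : a.Coprime (p₁ ^ m * p₂ ^ n) :=
  Nat.Coprime.mul_right (Nat.Coprime.pow_right _ (Nat.Coprime.coprime_mul_right_right ha))
    (Nat.Coprime.pow_right _ (Nat.Coprime.coprime_mul_left_right ha))

end NT

section Semi

variable {p : ℕ} [Fact p.Prime] {F : Type*} [Field F] [Fintype F] [Algebra (ZMod p) F]

lemma val_int_lt_one {ℓ : ℕ} {A : ValuationSubring ℂ}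
    (hA : A.valuation (ℓ : ℂ) < 1) {z : ℤ} (hz : (ℓ : ℤ) ∣ z) : A.valuation (z : ℂ) < 1 := by
  obtain ⟨w, rfl⟩ := hz
  push_cast
  rw [map_mul, mul_comm]
  exact mul_lt_one_val (val_le_one_of_integral A (isIntegral_algebraMap (R := ℤ) (x := w))) hA

/-- Semiprimitive Gauss sums of prime power order. -/
lemma semiprim {ℓ n e₀ : ℕ} (hℓ : ℓ.Prime) (hℓ2 : ℓ ≠ 2) (hcard : Fintype.card F = p ^ (2 * e₀))
    (hi : ∃ i : ℕ, (p : ZMod (ℓ ^ n)) ^ i = -1) {c : ℤ} (hc : c = 1 ∨ c = -1) (hdc : (ℓ : ℤ) ∣ (p : ℤ) ^ e₀ - c)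
    (θ : MulChar F ℂ) (hθ1 : θ ≠ 1) (hθ : θ ^ (ℓ ^ n) = 1) :
    gaussSum θ (psiA p F) = -(c : ℂ) * (p : ℂ) ^ e₀ := by
  obtain ⟨i, hi⟩ := hi
  obtain ⟨A, hA⟩ := exists_valSubring hℓ
  have hodd : Odd (ℓ ^ n) := (hℓ.odd_of_ne_two hℓ2).pow
  have h1 : θ ^ (p ^ i) = θ⁻¹ := by
    rw [eq_inv_iff_mul_eq_one, ← pow_succ]
    have h2 : ℓ ^ n ∣ p ^ i + 1 := by
      rw [← ZMod.natCast_eq_zero_iff]; push_cast; rw [hi]; ring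
    obtain ⟨w, hw⟩ := h2
    rw [hw, pow_mul, hθ, one_pow]
  have h2 : starRingEnd ℂ (gaussSum θ (psiA p F)) = gaussSum θ (psiA p F) := by
    rw [gaussSum_conj hodd hθ, ← h1, gaussSum_pow_p_pow]
  have h3 := gaussSum_mul_conj (p := p) hθ1
  rw [h2, hcard] at h3
  set G := gaussSum θ (psiA p F) with hG
  have h4 : G ^ 2 = ((p : ℂ) ^ e₀) ^ 2 := by
    rw [sq, h3]; push_cast; rw [← pow_mul, mul_comm]
  have h5 : A.valuation (G - -1) < 1 := by
    have := val_gaussSum_sub_lt (p := p) hℓ hA (1 : MulChar F ℂ) θ hθ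
    rwa [one_mul, gaussSum_one_val] at this
  have hcc : c * c = 1 := by rcases hc with rfl | rfl <;> norm_num
  have key : ∀ s : ℤ, (s = 1 ∨ s = -1) → G = s * (p : ℂ) ^ e₀ → s = -c := by
    intro s hs hGs
    have h6 : A.valuation (((s * (p : ℤ) ^ e₀ + 1 : ℤ)) : ℂ) < 1 := by
      push_cast; rw [← hGs]; simpa using h5
    have h7 := int_val_lt_one_iff hℓ hA h6
    have h8 : (ℓ : ℤ) ∣ s * c + 1 := by
      have : s * c + 1 = (s * (p : ℤ) ^ e₀ + 1) - s * ((p : ℤ) ^ e₀ - c) := by ring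
      rw [this]; exact dvd_sub h7 (Dvd.dvd.mul_left hdc s)
    have h9 : ¬ (ℓ : ℤ) ∣ 2 := by
      intro h
      have h' : ℓ ∣ 2 := by exact_mod_cast h
      exact hℓ2 ((Nat.prime_dvd_prime_iff_eq hℓ Nat.prime_two).1 h')
    rcases hs with rfl | rfl <;> rcases hc with rfl | rfl <;> norm_num at h8 ⊢ <;> exact h9 h8
  rcases sq_eq_sq_iff_eq_or_eq_neg.1 h4 with h6 | h6
  · have := key 1 (Or.inl rfl) (by rw [h6]; push_cast; ring)
    have h7 : (c : ℂ) = -1 := by have : c = -1 := by omega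
                                 rw [this]; norm_num
    rw [h6, h7]; ring
  · have := key (-1) (Or.inr rfl) (by rw [h6]; push_cast; ring)
    have h7 : (c : ℂ) = 1 := by have : c = 1 := by omega
                                rw [this]; norm_num
    rw [h6, h7]; ring

/-- Congruence for Gauss sums of mixed order. -/
lemma mixed_congr {p₁ p₂ m n e₀ : ℕ} (hp₁ : p₁.Prime) (hp₂ : p₂.Prime) (h12 : p₁ ≠ p₂) (h2 : p₂ ≠ 2)
    (hcard : Fintype.card F = p ^ (2 * e₀))
    (hi : ∃ i : ℕ, (p : ZMod (p₂ ^ n)) ^ i = -1) {c : ℤ} (hc : c = 1 ∨ c = -1)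
    (hdc₁ : (p₁ : ℤ) ∣ (p : ℤ) ^ e₀ + c)
    (hdc₂ : (p₂ : ℤ) ∣ (p : ℤ) ^ e₀ - c)
    (θ : MulChar F ℂ) (hθ1 : θ ^ (p₁ ^ m) ≠ 1) (hθ : θ ^ (p₁ ^ m * p₂ ^ n) = 1)
    {A : ValuationSubring ℂ} (hA : A.valuation (p₁ : ℂ) < 1) :
    A.valuation (gaussSum θ (psiA p F) - 1) < 1 := by
  have hcop : Nat.Coprime (p₁ ^ m) (p₂ ^ n) := Nat.Coprime.pow _ _ ((Nat.coprime_primes hp₁ hp₂).2 h12)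
  obtain ⟨x, hx1, hx2⟩ := Nat.chineseRemainder hcop 0 1
  have e1 : (θ ^ x) ^ (p₂ ^ n) = 1 := by
    obtain ⟨w, rfl⟩ := (Nat.modEq_zero_iff_dvd).1 hx1
    rw [← pow_mul, mul_assoc, mul_comm w, ← mul_assoc, pow_mul, hθ, one_pow]
  obtain ⟨y, hy1, hy2⟩ := Nat.chineseRemainder hcop 1 0
  have e2 : (θ ^ y) ^ (p₁ ^ m) = 1 := by
    obtain ⟨w, rfl⟩ := (Nat.modEq_zero_iff_dvd).1 hy2
    rw [← pow_mul, mul_comm, ← mul_assoc, pow_mul, hθ, one_pow]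
  have e3 : θ ^ x * θ ^ y = θ := by
    rw [← pow_add]
    have h3 : x + y ≡ 1 [MOD p₁ ^ m * p₂ ^ n] := by
      rw [← Nat.modEq_and_modEq_iff_modEq_mul hcop]
      exact ⟨by simpa using hx1.add hy1, by simpa using hx2.add hy2⟩
    rw [pow_eq_pow_mod (x + y) hθ, h3, ← pow_eq_pow_mod 1 hθ, pow_one]
  have e4 : θ ^ x ≠ 1 := by
    intro h
    rw [h, one_mul] at e3
    rw [e3] at e2
    exact hθ1 e2
  have h4 := semiprim (F := F) hp₂ h2 hcard hi hc hdc₂ (θ ^ x) e4 e1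
  have h5 := val_gaussSum_sub_lt (p := p) hp₁ hA (θ ^ x) (θ ^ y) e2
  rw [e3, h4] at h5
  have h6 : A.valuation ((-(c : ℂ) * (p : ℂ) ^ e₀) - 1) < 1 := by
    have h7 : (p₁ : ℤ) ∣ -c * (p : ℤ) ^ e₀ - 1 := by
      have hcc : c * c = 1 := by rcases hc with rfl | rfl <;> norm_num
      have : -c * (p : ℤ) ^ e₀ - 1 = -c * ((p : ℤ) ^ e₀ + c) := by linear_combination hcc
      rw [this]; exact Dvd.dvd.mul_left hdc₁ _
    have := val_int_lt_one hA h7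
    push_cast at this
    exact this
  have := Valuation.map_add_lt _ h5 h6
  rwa [sub_add_sub_cancel] at this

end Semi

section Alg

variable {Γ : Type*} [LinearOrderedCommGroupWithZero Γ]

lemma vpow_inj {a : Γ} (ha0 : a ≠ 0) (ha : a < 1) {r e : ℕ} (h : a ^ r = a ^ e) : r = e :=
  (pow_right_strictAnti₀ (zero_lt_iff.2 ha0) ha).injective h

lemma v_int_unit {p : ℕ} {v : Valuation ℂ Γ}
    (hvi : ∀ z : ℂ, IsIntegral ℤ z → v z ≤ 1) (hvd : ∀ z : ℤ, v (z : ℂ) < 1 → (p : ℤ) ∣ z)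
    {z : ℤ} (hz : ¬ (p : ℤ) ∣ z) : v (z : ℂ) = 1 :=
  le_antisymm (hvi _ (isIntegral_algebraMap (R := ℤ) (x := z))) (not_lt.1 (fun h => hz (hvd z h)))

lemma v_int_decomp {p : ℕ} (hp : p.Prime) {v : Valuation ℂ Γ}
    (hvi : ∀ z : ℂ, IsIntegral ℤ z → v z ≤ 1) (hvd : ∀ z : ℤ, v (z : ℂ) < 1 → (p : ℤ) ∣ z)
    {z : ℤ} (hz : z ≠ 0) : ∃ (r : ℕ) (b : ℤ), z = (p : ℤ) ^ r * b ∧ ¬ (p : ℤ) ∣ b ∧ v (z : ℂ) = v (p : ℂ) ^ r := by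
  have hfin : FiniteMultiplicity (p : ℤ) z := by
    rw [Int.finiteMultiplicity_iff]
    refine ⟨?_, hz⟩
    simpa using hp.one_lt.ne'
  obtain ⟨b, hb, hnd⟩ := hfin.exists_eq_pow_mul_and_not_dvd
  refine ⟨_, b, hb, hnd, ?_⟩
  have h1 := v_int_unit hvi hvd hnd
  have h2 : (z : ℂ) = (p : ℂ) ^ (multiplicity (p : ℤ) z) * (b : ℂ) := by
    conv_lhs => rw [hb]
    push_cast; rfl
  rw [h2, map_mul, h1, map_pow, mul_one]

lemma v_int_eq {p : ℕ} (hp : p.Prime) {v : Valuation ℂ Γ} (hv : v (p : ℂ) < 1)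
    (hvi : ∀ z : ℂ, IsIntegral ℤ z → v z ≤ 1) (hvd : ∀ z : ℤ, v (z : ℂ) < 1 → (p : ℤ) ∣ z)
    {z : ℤ} {e : ℕ} (hz : v (z : ℂ) = v (p : ℂ) ^ e) : ∃ b : ℤ, z = (p : ℤ) ^ e * b ∧ ¬ (p : ℤ) ∣ b := by
  have hp0 : v (p : ℂ) ≠ 0 := by rw [Valuation.ne_zero_iff]; exact_mod_cast hp.ne_zero
  have hz0 : z ≠ 0 := by
    rintro rfl
    rw [Int.cast_zero, map_zero] at hz
    exact pow_ne_zero e hp0 hz.symm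
  obtain ⟨r, b, h1, h2, h3⟩ := v_int_decomp hp hvi hvd hz0
  have := vpow_inj hp0 hv (h3.symm.trans hz)
  subst this
  exact ⟨b, h1, h2⟩

lemma v_int_le {p : ℕ} (hp : p.Prime) {v : Valuation ℂ Γ} (hv : v (p : ℂ) < 1)
    (hvi : ∀ z : ℂ, IsIntegral ℤ z → v z ≤ 1) (hvd : ∀ z : ℤ, v (z : ℂ) < 1 → (p : ℤ) ∣ z)
    {z : ℤ} {e : ℕ} (hz : v (z : ℂ) ≤ v (p : ℂ) ^ e) : ∃ b : ℤ, z = (p : ℤ) ^ e * b := by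
  have hp0 : v (p : ℂ) ≠ 0 := by rw [Valuation.ne_zero_iff]; exact_mod_cast hp.ne_zero
  by_cases hz0 : z = 0
  · exact ⟨0, by rw [hz0]; ring⟩
  obtain ⟨r, b, h1, h2, h3⟩ := v_int_decomp hp hvi hvd hz0
  rw [h3] at hz
  have hle : e ≤ r := (pow_right_strictAnti₀ (zero_lt_iff.2 hp0) hv).le_iff_ge.1 hz
  obtain ⟨s, rfl⟩ := Nat.exists_eq_add_of_le hle
  exact ⟨(p : ℤ) ^ s * b, by rw [h1, pow_add]; ring⟩

/-- Extraction of the `p`-part of an element of the imaginary quadratic order. -/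
lemma extract {p d f e h : ℕ} (hp : p.Prime) {v : Valuation ℂ Γ} (hv : v (p : ℂ) < 1)
    (hvi : ∀ z : ℂ, IsIntegral ℤ z → v z ≤ 1) (hvd : ∀ z : ℤ, v (z : ℂ) < 1 → (p : ℤ) ∣ z)
    (hpd : ¬ p ∣ d) (hh : 0 < h) (hf : f = h + 2 * e) {g D : ℂ} (hD2 : D ^ 2 = -(d : ℂ)) (hDc : starRingEnd ℂ D = -D)
    {B C : ℤ} (hg : 2 * g = B + C * D) (hgg : g * starRingEnd ℂ g = (p : ℂ) ^ f)
    (hv1 : v g = v (p : ℂ) ^ e) (hv2 : v (starRingEnd ℂ g) = v (p : ℂ) ^ (e + h)) :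
    ∃ b c : ℤ, B = (p : ℤ) ^ e * b ∧ C = (p : ℤ) ^ e * c ∧ ¬ (p : ℤ) ∣ b ∧ ¬ (p : ℤ) ∣ c ∧
      4 * (p : ℤ) ^ h = b ^ 2 + d * c ^ 2 ∧ g = (p : ℂ) ^ e * ((b + c * D) / 2) ∧
      v ((b + c * D) / 2) = 1 ∧ v (starRingEnd ℂ ((b + c * D) / 2)) = v (p : ℂ) ^ h := by
  have hp0 : v (p : ℂ) ≠ 0 := by rw [Valuation.ne_zero_iff]; exact_mod_cast hp.ne_zero
  have hpC : (p : ℂ) ≠ 0 := by exact_mod_cast hp.ne_zero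
  have hgc : 2 * starRingEnd ℂ g = B - C * D := by
    have := congrArg (starRingEnd ℂ) hg
    simp only [map_mul, map_add, map_intCast, hDc, map_ofNat] at this
    rw [this]; ring
  have hvD : v D = 1 := by
    have h1 : v ((d : ℤ) : ℂ) = 1 := v_int_unit hvi hvd (by exact_mod_cast hpd)
    have h2 : v D ^ 2 = 1 := by
      rw [← map_pow, hD2, Valuation.map_neg]; simpa using h1
    exact (pow_eq_one_iff_of_nonneg zero_le' (by norm_num)).1 h2
  have hlt : v (starRingEnd ℂ g) < v g := by
    rw [hv1, hv2]
    exact pow_right_strictAnti₀ (zero_lt_iff.2 hp0) hv (by omega)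
  have hB : v (B : ℂ) = v (p : ℂ) ^ e := by
    have : (B : ℂ) = g + starRingEnd ℂ g := by linear_combination (-1/2 : ℂ) * hg - (1/2 : ℂ) * hgc
    rw [this, Valuation.map_add_eq_of_lt_left v hlt, hv1]
  have hC : v (C : ℂ) = v (p : ℂ) ^ e := by
    have : (C : ℂ) * D = g - starRingEnd ℂ g := by linear_combination (-1/2 : ℂ) * hg + (1/2 : ℂ) * hgc
    have h2 : v ((C : ℂ) * D) = v (p : ℂ) ^ e := by
      rw [this, Valuation.map_sub_eq_of_lt_left v hlt, hv1]
    rwa [map_mul, hvD, mul_one] at h2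
  obtain ⟨b, hb, hpb⟩ := v_int_eq hp hv hvi hvd hB
  obtain ⟨c, hc, hpc⟩ := v_int_eq hp hv hvi hvd hC
  have hgform : g = (p : ℂ) ^ e * ((b + c * D) / 2) := by
    have : 2 * g = 2 * ((p : ℂ) ^ e * ((b + c * D) / 2)) := by
      rw [hg, hb, hc]; push_cast; ring
    exact mul_left_cancel₀ two_ne_zero this
  refine ⟨b, c, hb, hc, hpb, hpc, ?_, hgform, ?_, ?_⟩
  · have h1 : (4 : ℂ) * (p : ℂ) ^ f = B ^ 2 + d * C ^ 2 := by
      rw [← hgg]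
      linear_combination (2 * starRingEnd ℂ g) * hg + (B + C * D) * hgc - C ^ 2 * hD2
    have h2 : (4 : ℤ) * (p : ℤ) ^ f = B ^ 2 + d * C ^ 2 := by exact_mod_cast h1
    rw [hb, hc, hf, pow_add] at h2
    have hpe : ((p : ℤ) ^ (2 * e)) ≠ 0 := pow_ne_zero _ (by exact_mod_cast hp.ne_zero)
    apply mul_left_cancel₀ hpe
    rw [mul_comm 2 e, pow_mul] at h2 ⊢
    linear_combination h2
  · rw [hgform, map_mul, map_pow] at hv1
    exact (mul_eq_left₀ (pow_ne_zero e hp0)).1 hv1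
  · rw [hgform, map_mul, map_pow, map_natCast (starRingEnd ℂ), map_mul, map_pow, pow_add] at hv2
    exact mul_left_cancel₀ (pow_ne_zero e hp0) hv2

/-- Up to sign, the `k`-th normalized Gauss sum is the `k`-th power of the first one. -/
lemma unit_sign {p d h k : ℕ} (hp : p.Prime) {v : Valuation ℂ Γ} (hv : v (p : ℂ) < 1)
    (hvi : ∀ z : ℂ, IsIntegral ℤ z → v z ≤ 1) (hvd : ∀ z : ℤ, v (z : ℂ) < 1 → (p : ℤ) ∣ z)
    (hpd : ¬ p ∣ d) (hd4 : d % 4 = 3) (hd5 : 4 < d) {D : ℂ} (hD2 : D ^ 2 = -(d : ℂ)) (hDc : starRingEnd ℂ D = -D)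
    {b c b' c' : ℤ} (h1 : 4 * (p : ℤ) ^ h = b ^ 2 + d * c ^ 2) (h2 : 4 * (p : ℤ) ^ (k * h) = b' ^ 2 + d * c' ^ 2)
    (hv1 : v (((b : ℂ) + c * D) / 2) = 1) (hv1' : v (starRingEnd ℂ (((b : ℂ) + c * D) / 2)) = v (p : ℂ) ^ h)
    (hv2 : v (((b' : ℂ) + c' * D) / 2) = 1)
    (hv2' : v (starRingEnd ℂ (((b' : ℂ) + c' * D) / 2)) = v (p : ℂ) ^ (k * h)) :
    ((b' : ℂ) + c' * D) / 2 = (((b : ℂ) + c * D) / 2) ^ k ∨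
    ((b' : ℂ) + c' * D) / 2 = - (((b : ℂ) + c * D) / 2) ^ k := by
  set β : ℂ := ((b : ℂ) + c * D) / 2 with hβ
  set γ : ℂ := ((b' : ℂ) + c' * D) / 2 with hγ
  set βc := starRingEnd ℂ β with hβc
  set γc := starRingEnd ℂ γ with hγc
  have hβc' : βc = ((b : ℂ) - c * D) / 2 := by
    rw [hβc, hβ]; simp only [map_div₀, map_add, map_mul, map_intCast, hDc, map_ofNat]; ring
  have hγc' : γc = ((b' : ℂ) - c' * D) / 2 := by
    rw [hγc, hγ]; simp only [map_div₀, map_add, map_mul, map_intCast, hDc, map_ofNat]; ring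
  have h1C : (4 : ℂ) * (p : ℂ) ^ h = b ^ 2 + d * c ^ 2 := by exact_mod_cast h1
  have h2C : (4 : ℂ) * (p : ℂ) ^ (k * h) = b' ^ 2 + d * c' ^ 2 := by exact_mod_cast h2
  have hpC : (p : ℂ) ≠ 0 := by exact_mod_cast hp.ne_zero
  have hββ : β * βc = (p : ℂ) ^ h := by
    rw [hβc', hβ]
    linear_combination (1/4 : ℂ) * (-h1C) - (c ^ 2 : ℂ) / 4 * hD2
  -- powers of `β`
  have hpow : ∀ j : ℕ, ∃ x y : ℤ, β ^ j = x + y * β := by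
    intro j
    induction j with
    | zero => exact ⟨1, 0, by simp⟩
    | succ j ih =>
      obtain ⟨x, y, hxy⟩ := ih
      refine ⟨-y * (p : ℤ) ^ h, x + y * b, ?_⟩
      have h3 : β ^ 2 = b * β - (p : ℂ) ^ h := by
        rw [← hββ, hβc']
        have : β = ((b : ℂ) + c * D) / 2 := hβ
        linear_combination β * this
      rw [pow_succ, hxy]; push_cast
      linear_combination (y : ℂ) * h3
  obtain ⟨x', y', hxy⟩ := hpow k
  have hpar : ∀ {s t : ℤ} {r : ℤ}, 4 * r = s ^ 2 + d * t ^ 2 → ∃ w, s = t + 2 * w := by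
    intro s t r hr
    have h3 : (s - t) % 2 = 0 := by
      have hd' : (d : ℤ) % 2 = 1 := by omega
      obtain ⟨d', hd'⟩ : ∃ d' : ℤ, (d : ℤ) = 2 * d' + 1 := ⟨(d : ℤ) / 2, by omega⟩
      rw [hd'] at hr
      have h4 : (s - t) * (s - t) = 2 * (2 * r - d' * t ^ 2 - s * t) := by linear_combination -hr
      rcases Int.emod_two_eq_zero_or_one (s - t) with h5 | h5
      · exact h5
      · have h6 : Odd ((s - t) * (s - t)) := (Int.odd_iff.2 h5).mul (Int.odd_iff.2 h5)
        rw [h4] at h6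
        exact absurd (even_two_mul _) (Int.not_even_iff_odd.2 h6)
    exact ⟨(s - t) / 2, by omega⟩
  obtain ⟨w₁, hw₁⟩ := hpar h1
  obtain ⟨w₂, hw₂⟩ := hpar h2
  obtain ⟨d', hd'⟩ : ∃ d' : ℤ, (d : ℤ) = 2 * d' + 1 := ⟨(d : ℤ) / 2, by omega⟩
  -- coordinates of `γ * conj (β ^ k)`
  set X : ℤ := b' * x' + y' * (c' * w₁ + c * w₂ + 2 * w₁ * w₂ + c * c' * (d' + 1)) with hX
  set Y : ℤ := c' * (2 * x' + y' * b) - b' * (y' * c) with hY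
  have hβck : βc ^ k = x' + y' * βc := by
    have := congrArg (starRingEnd ℂ) hxy
    simpa [map_pow, ← hβc] using this
  have hd'C : (d : ℂ) = 2 * d' + 1 := by exact_mod_cast hd'
  have hw₁C : (b : ℂ) = c + 2 * w₁ := by exact_mod_cast hw₁
  have hw₂C : (b' : ℂ) = c' + 2 * w₂ := by exact_mod_cast hw₂
  have hXC : γ * βc ^ k + γc * β ^ k = X := by
    rw [hβck, hxy, hβc', hγc', hβ, hγ, hX]
    push_cast
    have e : (c' : ℂ) * w₁ + c * w₂ + 2 * w₁ * w₂ + c * c' * (d' + 1) = (b * b' + d * c * c') / 2 := by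
      rw [hd'C, hw₁C, hw₂C]; ring
    rw [e]
    linear_combination (-(y' : ℂ) * c * c' / 2) * hD2
  have hYC : 2 * (γ * βc ^ k - γc * β ^ k) = Y * D := by
    rw [hβck, hxy, hβc', hγc', hβ, hγ, hY]
    push_cast
    ring
  have hvD : v D = 1 := by
    have h1 : v ((d : ℤ) : ℂ) = 1 := v_int_unit hvi hvd (by exact_mod_cast hpd)
    have h2 : v D ^ 2 = 1 := by
      rw [← map_pow, hD2, Valuation.map_neg]; simpa using h1
    exact (pow_eq_one_iff_of_nonneg zero_le' (by norm_num)).1 h2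
  have hva : v (γ * βc ^ k) = v (p : ℂ) ^ (k * h) := by
    rw [map_mul, map_pow, hv2, hv1', one_mul, ← pow_mul, mul_comm]
  have hvb : v (γc * β ^ k) = v (p : ℂ) ^ (k * h) := by
    rw [map_mul, map_pow, hv1, hv2', one_pow, mul_one]
  have hvX : v (X : ℂ) ≤ v (p : ℂ) ^ (k * h) := by
    rw [← hXC]; exact v.map_add_le hva.le hvb.le
  have hvY : v (Y : ℂ) ≤ v (p : ℂ) ^ (k * h) := by
    have h3 : v ((Y : ℂ) * D) ≤ v (p : ℂ) ^ (k * h) := by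
      rw [← hYC, map_mul]
      refine le_trans (mul_le_of_le_one_left' (hvi 2 ?_)) (v.map_sub_le hva.le hvb.le)
      have := isIntegral_algebraMap (R := ℤ) (A := ℂ) (x := 2)
      simpa using this
    rwa [map_mul, hvD, mul_one] at h3
  obtain ⟨t, ht⟩ := v_int_le hp hv hvi hvd hvX
  obtain ⟨w, hw⟩ := v_int_le hp hv hvi hvd hvY
  have hpk : (p : ℂ) ^ (k * h) ≠ 0 := pow_ne_zero _ hpC
  have htC : (X : ℂ) = (p : ℂ) ^ (k * h) * t := by rw [ht]; push_cast; ring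
  have hwC : (Y : ℂ) = (p : ℂ) ^ (k * h) * w := by rw [hw]; push_cast; ring
  have hγγ : γ * γc = (p : ℂ) ^ (k * h) := by
    rw [hγc', hγ]
    linear_combination (1/4 : ℂ) * (-h2C) - (c' ^ 2 : ℂ) / 4 * hD2
  have hββk : β ^ k * βc ^ k = (p : ℂ) ^ (k * h) := by
    rw [← mul_pow, hββ, ← pow_mul, mul_comm]
  -- norm equation
  have hnorm : (16 : ℂ) = 4 * t ^ 2 + d * w ^ 2 := by
    have h3 : ((p : ℂ) ^ (k * h)) ^ 2 * 16 = ((p : ℂ) ^ (k * h)) ^ 2 * (4 * t ^ 2 + d * w ^ 2) := by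
      have h4 : ((p : ℂ) ^ (k * h)) ^ 2 = (γ * βc ^ k) * (γc * β ^ k) := by
        rw [sq]; nth_rewrite 1 [← hγγ]; rw [← hββk]; ring
      calc ((p : ℂ) ^ (k * h)) ^ 2 * 16 = 16 * ((γ * βc ^ k) * (γc * β ^ k)) := by rw [h4]; ring
        _ = 4 * (γ * βc ^ k + γc * β ^ k) ^ 2 - (2 * (γ * βc ^ k - γc * β ^ k)) ^ 2 := by ring
        _ = 4 * (X : ℂ) ^ 2 - (Y * D) ^ 2 := by rw [hXC, hYC]
        _ = _ := by rw [htC, hwC]; linear_combination (-((p : ℂ) ^ (k * h)) ^ 2 * (w : ℂ) ^ 2) * hD2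
    exact mul_left_cancel₀ (pow_ne_zero 2 hpk) h3
  have hnormZ : (16 : ℤ) = 4 * t ^ 2 + d * w ^ 2 := by exact_mod_cast hnorm
  have hw0 : w = 0 := by
    have hev : Even w := by
      by_contra hod
      rw [Int.not_even_iff_odd] at hod
      have h5 : Odd ((d : ℤ) * w ^ 2) := by
        apply Odd.mul
        · rw [Int.odd_iff]; omega
        · exact hod.pow
      have h6 : (d : ℤ) * w ^ 2 = 2 * (8 - 2 * t ^ 2) := by linarith
      rw [h6] at h5
      exact absurd (even_two_mul _) (Int.not_even_iff_odd.2 h5)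
    obtain ⟨r, hr⟩ := hev
    by_contra hne
    have hr0 : r ≠ 0 := by rintro rfl; exact hne (by simpa using hr)
    have h7 : 1 ≤ r ^ 2 := by have := sq_pos_of_ne_zero hr0; omega
    have h8 : (5 : ℤ) ≤ d := by omega
    have h9 : (d : ℤ) * w ^ 2 = 4 * (d * r ^ 2) := by rw [hr]; ring
    nlinarith [sq_nonneg t]
  have ht2 : t = 2 ∨ t = -2 := by
    rw [hw0] at hnormZ
    have : (t - 2) * (t + 2) = 0 := by linarith
    rcases mul_eq_zero.1 this with h3 | h3
    · left; linarith
    · right; linarith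
  have hfin : 2 * (γ * βc ^ k) = (p : ℂ) ^ (k * h) * t := by
    have h3 : (Y : ℂ) = 0 := by rw [hwC, hw0]; simp
    rw [h3, zero_mul] at hYC
    rw [← htC, ← hXC]; linear_combination (1/2 : ℂ) * hYC
  have hβck0 : βc ^ k ≠ 0 := by
    intro h0; rw [h0, mul_zero] at hββk; exact hpk hββk.symm
  rcases ht2 with h3 | h3
  · left
    apply mul_right_cancel₀ hβck0
    rw [hββk]; rw [h3] at hfin; push_cast at hfin; linear_combination (1/2 : ℂ) * hfin
  · right
    apply mul_right_cancel₀ hβck0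
    rw [neg_mul, hββk]; rw [h3] at hfin; push_cast at hfin; linear_combination (1/2 : ℂ) * hfin

end Alg

section OneUnits

variable {Γ : Type*} [LinearOrderedCommGroupWithZero Γ] {v : Valuation ℂ Γ}

lemma one_unit_mul {x y : ℂ} (hx : v (x - 1) < 1) (hy : v (y - 1) < 1) : v (x * y - 1) < 1 := by
  have e : x * y - 1 = (x - 1) * (y - 1) + (x - 1) + (y - 1) := by ring
  rw [e]
  refine Valuation.map_add_lt _ (Valuation.map_add_lt _ ?_ hx) hy
  rw [map_mul]
  exact mul_lt_one_val hx.le hy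

lemma one_unit_pow {x : ℂ} (hx : v (x - 1) < 1) (k : ℕ) : v (x ^ k - 1) < 1 := by
  induction k with
  | zero => simp
  | succ k ih => rw [pow_succ]; exact one_unit_mul ih hx

end OneUnits

lemma dvd_exps {p₁ p₂ m n a b : ℕ} (hp₁ : p₁.Prime) (hp₂ : p₂.Prime) (h12 : p₁ ≠ p₂)
    (h : p₁ ^ m * p₂ ^ n ∣ p₁ ^ a * p₂ ^ b) : m ≤ a ∧ n ≤ b := by
  have hc : Nat.Coprime p₁ p₂ := (Nat.coprime_primes hp₁ hp₂).2 h12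
  constructor
  · have h1 : p₁ ^ m ∣ p₁ ^ a * p₂ ^ b := (Dvd.intro _ rfl).trans h
    have h2 : p₁ ^ m ∣ p₁ ^ a := (Nat.Coprime.pow m b hc).dvd_of_dvd_mul_right h1
    exact (Nat.pow_dvd_pow_iff_le_right hp₁.one_lt).1 h2
  · have h1 : p₂ ^ n ∣ p₁ ^ a * p₂ ^ b := (Dvd.intro_left _ rfl).trans h
    have h2 : p₂ ^ n ∣ p₂ ^ b := (Nat.Coprime.pow n a hc.symm).dvd_of_dvd_mul_left h1
    exact (Nat.pow_dvd_pow_iff_le_right hp₂.one_lt).1 h2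

/-- Theorem 2.1 of the paper (index 2 Gauss sums, Case B1). -/
theorem statement_7 (p₁ p₂ m n : ℕ) (hp₁ : p₁.Prime) (hp₂ : p₂.Prime)
    (hp₁mod : p₁ % 4 = 1) (hp₂mod : p₂ % 4 = 3) (hm : 1 ≤ m) (hn : 1 ≤ n)
    (N : ℕ) (hN : N = p₁ ^ m * p₂ ^ n)
    (p : ℕ) (hp : p.Prime)
    (hord₁ : orderOf ((p : ZMod (p₁ ^ m))) = Nat.totient (p₁ ^ m))
    (hord₂ : orderOf ((p : ZMod (p₂ ^ n))) = Nat.totient (p₂ ^ n))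
    (hindex : ∃ u : (ZMod N)ˣ, ((u : ZMod N) = (p : ZMod N)) ∧
      (Subgroup.zpowers u).index = 2)
    (f : ℕ) (hf : 2 * f = Nat.totient N)
    (F : Type*) [Field F] [Fintype F] [Algebra (ZMod p) F]
    (hcard : Fintype.card F = p ^ f)
    (χ : MulChar F ℂ) (hχ : orderOf χ = N)
    -- `h` is the class number of `ℚ(√-p₁p₂)`
    (K : Type*) [Field K] [NumberField K] (α : K)
    (hα : α ^ 2 = -((p₁ : K) * p₂)) (hKα : Algebra.adjoin ℚ {α} = ⊤)
    (h : ℕ) (hh : h = NumberField.classNumber K) :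
    ∃ b c : ℤ, ¬ (p : ℤ) ∣ b ∧ ¬ (p : ℤ) ∣ c ∧
      4 * (p : ℤ) ^ h = b ^ 2 + (p₁ : ℤ) * p₂ * c ^ 2 ∧
      (∃ e : ℕ, f = h + 2 * e ∧ b * (p : ℤ) ^ e ≡ 2 [ZMOD ((p₁ : ℤ) * p₂)]) ∧
      (∀ s t : ℕ, s ≤ m - 1 → t ≤ n - 1 →
        gaussSumF p (χ ^ (p₁ ^ s * p₂ ^ t)) =
          (p : ℂ) ^ ((((f : ℂ) - (h : ℂ) * ((p₁ ^ s * p₂ ^ t : ℕ) : ℂ)) / 2 : ℂ)) *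
            (((b : ℂ) + (c : ℂ) * (Complex.I * Real.sqrt ((p₁ : ℝ) * p₂))) / 2) ^
              (p₁ ^ s * p₂ ^ t)) ∧
      (∀ t : ℕ, t ≤ n - 1 →
        gaussSumF p (χ ^ (p₁ ^ m * p₂ ^ t)) = -(p : ℂ) ^ (((f : ℂ) / 2 : ℂ))) ∧
      (∀ s : ℕ, s ≤ m - 1 →
        gaussSumF p (χ ^ (p₁ ^ s * p₂ ^ n)) = (p : ℂ) ^ (((f : ℂ) / 2 : ℂ))) := by
  haveI : Fact p.Prime := ⟨hp⟩
  have h1 : p₁ ≠ 2 := by rintro rfl; omega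
  have h2 : p₂ ≠ 2 := by rintro rfl; omega
  have h12 : p₁ ≠ p₂ := by rintro rfl; omega
  have hd : (p₁ * p₂) % 4 = 3 := by rw [Nat.mul_mod, hp₁mod, hp₂mod]
  have hd0 : p₁ * p₂ ≠ 0 := mul_ne_zero hp₁.ne_zero hp₂.ne_zero
  haveI : NeZero (p₁ * p₂) := ⟨hd0⟩
  have hd4 : 4 < p₁ * p₂ := by
    have := hp₁.two_le
    have := hp₂.two_le
    have : 5 ≤ p₁ := by omega
    nlinarith
  obtain ⟨hj, hNp, hNq, hq2, hf0, hi₁, hi₂, e₀, hfe, he1, he2⟩ :=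
    nt_facts hp₁ hp₂ hp₁mod hp₂mod hm hn hN hp hord₁ hord₂ hf
  have hNodd : Odd N := by
    rw [hN]
    exact (hp₁.odd_of_ne_two h1).pow.mul (hp₂.odd_of_ne_two h2).pow
  have hN0 : N ≠ 0 := by rintro rfl; simp at hNodd
  haveI : NeZero N := ⟨hN0⟩
  have hdN : p₁ * p₂ ∣ N := by
    rw [hN]
    exact mul_dvd_mul (dvd_pow_self _ (by omega)) (dvd_pow_self _ (by omega))
  have hN1 : 1 < N := lt_of_lt_of_le (by omega) (Nat.le_of_dvd (Nat.pos_of_ne_zero hN0) hdN)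
  obtain ⟨u, hu, hidx⟩ := hindex
  have hH := index_two_facts hp₁ hp₂ hm hn hd hN hj u hu hidx
  have hcn := class_number_formula hp₁ hp₂ h12 h1 h2 hd (K := K) (α := α)
    (by rw [hα]; push_cast; rfl) hKα
  rw [← hh] at hcn
  have hh0 : 0 < h := by rw [hh]; exact Fintype.card_pos
  obtain ⟨Γ, iΓ, v, hv, hvi, hvd, hst⟩ := stick_place hcard hq2 hf0 hN1 hNodd hNq hd hdN hf
    (by rw [hN]; exact fun a ha => rad_coprime a ha) hj hH hcn χ hχ
  have hpN : ¬ p ∣ N := by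
    intro hpn
    have h3 : p ∣ p ^ f - 1 := hpn.trans hNq
    have h4 : p ∣ p ^ f := dvd_pow_self _ (by omega)
    have h5 : p ∣ 1 := by
      have := (Nat.dvd_sub_iff_right (show 1 ≤ p ^ f by omega) h4).1 h3
      exact this
    exact hp.one_lt.ne' (Nat.dvd_one.1 h5)
  have hpd : ¬ p ∣ p₁ * p₂ := fun h3 => hpN (h3.trans hdN)
  obtain ⟨D, hD⟩ : ∃ D : ℂ, D = Complex.I * Real.sqrt ((p₁ * p₂ : ℕ) : ℝ) := ⟨_, rfl⟩
  have hD' : Complex.I * (Real.sqrt ((p₁ : ℝ) * p₂) : ℂ) = D := by rw [hD]; push_cast; rfl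
  have hD2 : D ^ 2 = -((p₁ * p₂ : ℕ) : ℂ) := by
    rw [hD, mul_pow, Complex.I_sq, ← Complex.ofReal_pow, Real.sq_sqrt (Nat.cast_nonneg _)]
    push_cast; ring
  have hDc : (starRingEnd ℂ) D = -D := by
    rw [hD, map_mul, Complex.conj_I, Complex.conj_ofReal]; ring
  have hpow1 : ∀ j, (χ ^ j) ^ N = 1 := by
    intro j
    rw [← pow_mul, mul_comm, pow_mul, ← hχ, pow_orderOf_eq_one, one_pow]
  have hne : ∀ a b, χ ^ (p₁ ^ a * p₂ ^ b) = 1 → m ≤ a ∧ n ≤ b := by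
    intro a b hab
    have := orderOf_dvd_of_pow_eq_one hab
    rw [hχ, hN] at this
    exact dvd_exps hp₁ hp₂ h12 this
  have hcard2 : Fintype.card F = p ^ (2 * e₀) := by rw [hcard, hfe]
  obtain ⟨A₁, hA₁⟩ := exists_valSubring hp₁
  obtain ⟨A₂, hA₂⟩ := exists_valSubring hp₂
  -- congruences modulo places above p₁ and p₂
  have hcg₁ : ∀ θ : MulChar F ℂ, θ ^ (p₁ ^ m) ≠ 1 → θ ^ N = 1 →
      A₁.valuation (gaussSum θ (psiA p F) - 1) < 1 := fun θ ht1 ht =>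
    mixed_congr hp₁ hp₂ h12 h2 hcard2 hi₂ (c := 1) (Or.inl rfl) (by simpa using he1) he2 θ ht1
      (by rw [← hN]; exact ht) hA₁
  have hcg₂ : ∀ θ : MulChar F ℂ, θ ^ (p₂ ^ n) ≠ 1 → θ ^ N = 1 →
      A₂.valuation (gaussSum θ (psiA p F) - 1) < 1 := fun θ ht1 ht =>
    mixed_congr hp₂ hp₁ h12.symm h1 hcard2 hi₁ (c := -1) (Or.inr rfl) (by rw [← sub_eq_add_neg]; exact he2) he1 θ
      ht1 (by rw [mul_comm, ← hN]; exact ht) hA₂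
  have hk1 : ∀ s t, t ≤ n - 1 → (χ ^ (p₁ ^ s * p₂ ^ t)) ^ (p₁ ^ m) ≠ 1 := by
    intro s t ht hc
    have : χ ^ (p₁ ^ (s + m) * p₂ ^ t) = 1 := by
      rw [← hc, ← pow_mul]; congr 1; ring
    have := (hne _ _ this).2
    omega
  have hk2 : ∀ s t, s ≤ m - 1 → (χ ^ (p₁ ^ s * p₂ ^ t)) ^ (p₂ ^ n) ≠ 1 := by
    intro s t ht hc
    have : χ ^ (p₁ ^ s * p₂ ^ (t + n)) = 1 := by
      rw [← hc, ← pow_mul]; congr 1; ring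
    have := (hne _ _ this).1
    omega
  -- the data attached to each exponent
  have key : ∀ s t, s ≤ m - 1 → t ≤ n - 1 → ∃ (e : ℕ) (b c : ℤ),
      f = (p₁ ^ s * p₂ ^ t) * h + 2 * e ∧ ¬ (p : ℤ) ∣ b ∧ ¬ (p : ℤ) ∣ c ∧
      4 * (p : ℤ) ^ ((p₁ ^ s * p₂ ^ t) * h) = b ^ 2 + ((p₁ * p₂ : ℕ) : ℤ) * c ^ 2 ∧
      gaussSum (χ ^ (p₁ ^ s * p₂ ^ t)) (psiA p F) = (p : ℂ) ^ e * (((b : ℂ) + c * D) / 2) ∧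
      v (((b : ℂ) + c * D) / 2) = 1 ∧
      v ((starRingEnd ℂ) (((b : ℂ) + c * D) / 2)) = v (p : ℂ) ^ ((p₁ ^ s * p₂ ^ t) * h) := by
    intro s t hs ht
    have hNk : N = (p₁ ^ s * p₂ ^ t) * ((p₁ ^ (m - 1 - s) * p₂ ^ (n - 1 - t)) * (p₁ * p₂)) := by
      have e1 : p₁ ^ m = p₁ ^ s * p₁ ^ (m - 1 - s) * p₁ := by
        rw [← pow_add, ← pow_succ]; congr 1; omega
      have e2 : p₂ ^ n = p₂ ^ t * p₂ ^ (n - 1 - t) * p₂ := by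
        rw [← pow_add, ← pow_succ]; congr 1; omega
      rw [hN, e1, e2]; ring
    obtain ⟨e, hfe', hv1, hv2⟩ := hst _ _ hNk
    have hθ1 : χ ^ (p₁ ^ s * p₂ ^ t) ≠ 1 := fun hc => by
      have := (hne _ _ hc).1
      omega
    obtain ⟨B, C, hBC⟩ := gauss_form hp₁ hp₂ h12 h1 h2 hd hNodd hdN hNp (χ ^ (p₁ ^ s * p₂ ^ t))
      (hpow1 _) hθ1 hH
    rw [← hD] at hBC
    have hgg := gaussSum_mul_conj (p := p) hθ1
    rw [hcard, Nat.cast_pow] at hgg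
    have hkpos : 0 < p₁ ^ s * p₂ ^ t := Nat.mul_pos (pow_pos hp₁.pos _) (pow_pos hp₂.pos _)
    obtain ⟨b, c, -, -, hb, hc, hbc, hg, hw1, hw2⟩ := extract hp hv hvi hvd hpd
      (Nat.mul_pos hkpos hh0) hfe' hD2 hDc hBC hgg hv1 hv2
    exact ⟨e, b, c, hfe', hb, hc, hbc, hg, hw1, hw2⟩
  obtain ⟨e, b, c, hfe1, hb, hc, hbc, hg, hw1, hw2⟩ := key 0 0 (Nat.zero_le _) (Nat.zero_le _)
  simp only [pow_zero, mul_one, one_mul, pow_one] at hfe1 hbc hg hw2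
  have hχN : χ ^ N = 1 := by rw [← hχ, pow_orderOf_eq_one]
  have hχ1 : χ ^ (p₁ ^ m) ≠ 1 := by simpa using hk1 0 0 (Nat.zero_le _)
  have hχ2 : χ ^ (p₂ ^ n) ≠ 1 := by simpa using hk2 0 0 (Nat.zero_le _)
  have hinvN : χ⁻¹ ^ N = 1 := by rw [inv_pow, hχN, inv_one]
  have hsum : ((b * (p : ℤ) ^ e - 2 : ℤ) : ℂ) =
      (gaussSum χ (psiA p F) - 1) + (gaussSum χ⁻¹ (psiA p F) - 1) := by
    rw [← gaussSum_conj hNodd hχN, hg]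
    simp only [map_mul, map_pow, map_add, map_div₀, hDc, Complex.conj_natCast, map_intCast,
      map_ofNat]
    push_cast
    ring
  have hcong : ((p₁ : ℤ) * p₂) ∣ b * (p : ℤ) ^ e - 2 := by
    have hcop : IsCoprime (p₁ : ℤ) (p₂ : ℤ) :=
      Nat.isCoprime_iff_coprime.2 ((Nat.coprime_primes hp₁ hp₂).2 h12)
    refine hcop.mul_dvd ?_ ?_
    · apply int_val_lt_one_iff hp₁ hA₁
      rw [hsum]
      exact Valuation.map_add_lt _ (hcg₁ _ hχ1 hχN)
        (hcg₁ _ (by rw [inv_pow]; exact inv_ne_one.2 hχ1) hinvN)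
    · apply int_val_lt_one_iff hp₂ hA₂
      rw [hsum]
      exact Valuation.map_add_lt _ (hcg₂ _ hχ2 hχN)
        (hcg₂ _ (by rw [inv_pow]; exact inv_ne_one.2 hχ2) hinvN)
  have hp0 : (p : ℂ) ≠ 0 := Nat.cast_ne_zero.2 hp.ne_zero
  have hhalf : (p : ℂ) ^ ((f : ℂ) / 2) = (p : ℂ) ^ e₀ := by
    have : (f : ℂ) / 2 = (e₀ : ℂ) := by rw [hfe]; push_cast; ring
    rw [this, Complex.cpow_natCast]
  refine ⟨b, c, hb, hc, by push_cast at hbc; exact hbc, ⟨e, hfe1, ?_⟩, ?_, ?_, ?_⟩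
  · exact (Int.modEq_iff_dvd.2 (by simpa using hcong)).symm
  · intro s t hs ht
    obtain ⟨e', b', c', hfe', -, -, hbc', hg', hw1', hw2'⟩ := key s t hs ht
    have hkk1 := hk1 s t ht
    have hkodd : Odd (p₁ ^ s * p₂ ^ t) :=
      (hp₁.odd_of_ne_two h1).pow.mul (hp₂.odd_of_ne_two h2).pow
    rw [gaussSumF_eq, hD']
    have hpk := hpow1 (p₁ ^ s * p₂ ^ t)
    generalize p₁ ^ s * p₂ ^ t = k at *
    have hexp : ((f : ℂ) - (h : ℂ) * (k : ℂ)) / 2 = (e' : ℂ) := by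
      rw [hfe']; push_cast; ring
    rw [hexp, Complex.cpow_natCast, hg']
    rcases unit_sign hp hv hvi hvd hpd hd hd4 hD2 hDc hbc hbc' hw1 hw2 hw1' hw2' with hs1 | hs1
    · rw [hs1]
    · exfalso
      obtain ⟨j, rfl⟩ := hkodd
      have hee : e * (2 * j + 1) = e' + f * j := by
        have : 2 * (e * (2 * j + 1)) = 2 * (e' + f * j) := by
          zify at hfe1 hfe' ⊢
          linear_combination (-(2 * (j : ℤ) + 1)) * hfe1 + hfe'
        omega
      have hrel : gaussSum (χ ^ (2 * j + 1)) (psiA p F) * ((p : ℂ) ^ f) ^ j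
          + gaussSum χ (psiA p F) ^ (2 * j + 1) = 0 := by
        rw [hg', hs1, hg, mul_pow _ _ (2 * j + 1), ← pow_mul, ← pow_mul, hee, pow_add]
        ring
      have hx := hcg₁ _ hkk1 hpk
      have hy := one_unit_pow (hcg₁ _ hχ1 hχN) (2 * j + 1)
      have hz : A₁.valuation ((p : ℂ) ^ f - 1) < 1 := by
        have h3 : (p₁ : ℤ) ∣ (p : ℤ) ^ f - 1 := by
          have h4 : p₁ ∣ p ^ f - 1 := ((Dvd.intro _ rfl).trans hdN).trans hNq
          have h5 := Int.natCast_dvd_natCast.2 h4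
          rwa [Nat.cast_sub (by omega), Nat.cast_pow, Nat.cast_one] at h5
        simpa using val_int_lt_one hA₁ h3
      have hxy := Valuation.map_add_lt _ (one_unit_mul hx (one_unit_pow hz j)) hy
      have h3 : (p₁ : ℤ) ∣ -2 := by
        apply int_val_lt_one_iff hp₁ hA₁
        have e3 : ((-2 : ℤ) : ℂ) = (gaussSum (χ ^ (2 * j + 1)) (psiA p F) * ((p : ℂ) ^ f) ^ j - 1)
          + (gaussSum χ (psiA p F) ^ (2 * j + 1) - 1) := by
          push_cast
          linear_combination -hrel
        rw [e3]
        exact hxy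
      have h4 : p₁ ∣ 2 := by
        have := Int.natAbs_dvd_natAbs.2 h3
        simpa using this
      exact h1 ((Nat.prime_dvd_prime_iff_eq hp₁ Nat.prime_two).1 h4)
  · intro t ht
    rw [gaussSumF_eq, hhalf, semiprim hp₂ h2 hcard2 hi₂ (c := 1) (Or.inl rfl) he2]
    · push_cast; ring
    · intro hc
      have := (hne _ _ hc).2
      omega
    · rw [← pow_mul, show p₁ ^ m * p₂ ^ t * p₂ ^ n = N * p₂ ^ t by rw [hN]; ring, pow_mul, hχN,
        one_pow]
  · intro s hs
    rw [gaussSumF_eq, hhalf, semiprim hp₁ h1 hcard2 hi₁ (c := -1) (Or.inr rfl) he1]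
    · push_cast; ring
    · intro hc
      have := (hne _ _ hc).1
      omega
    · rw [← pow_mul, show p₁ ^ s * p₂ ^ n * p₁ ^ m = N * p₁ ^ s by rw [hN]; ring, pow_mul, hχN,
        one_pow]
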